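/- Interior Hessian estimate for the negative σ_k-Yamabe equation (a priori form of Theorem 1.2). Let n ≥ 3, let Ω ⊆ ℝⁿ be a domain, let 2 ≤ k ≤ n and p > (k+1)n/2, and let f : Ω×(0,∞)×ℝⁿ → ℝ be positive and C¹ with locally Lipschitz first derivatives. Fix concentric open balls B_R ⊂ B_{2R} with closure(B_{2R}) ⊂ Ω and a constant M > 0. Then there exists a constant C, depending only on n, k, p, R, f and M, such that every positive u ∈ C²(Ω) satisfying σ_k(−A_u(x)) = f(x,u(x),∇u(x))^k and λ(−A_u(x)) ∈ Γ_k^+ for every x ∈ Ω, together with ‖ln u‖_{W^{2,p}(B_{2R})} ≤ M, obeys sup_{x ∈ B_R} |∇²u(x)| ≤ C. -/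

import Mathlib

open MeasureTheory Metric Set Matrix

noncomputable section

/-- The `k`-th elementary symmetric polynomial of the eigenvalues of an `n × n` real
matrix, defined via the coefficients of the characteristic polynomial. -/
def esymmMat {n : ℕ} (k : ℕ) (A : Matrix (Fin n) (Fin n) ℝ) : ℝ :=
  (-1 : ℝ) ^ k * A.charpoly.coeff (n - k)

/-- `λ(A) ∈ Γ_k^+`, i.e. `σ_j(A) > 0` for all `1 ≤ j ≤ k`. -/
def GammaPlus {n : ℕ} (k : ℕ) (A : Matrix (Fin n) (Fin n) ℝ) : Prop :=
  ∀ j : ℕ, 1 ≤ j → j ≤ k → 0 < esymmMat j A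

/-- The Newton tensors `T_0(A) = I`, `T_j(A) = σ_j(A) I - T_{j-1}(A) A`. -/
def newtonT {n : ℕ} : ℕ → Matrix (Fin n) (Fin n) ℝ → Matrix (Fin n) (Fin n) ℝ
  | 0, _ => 1
  | (j + 1), A => esymmMat (j + 1) A • (1 : Matrix (Fin n) (Fin n) ℝ) - newtonT j A * A

/-- `i`-th partial derivative. -/
def pd {n : ℕ} (i : Fin n) (w : (Fin n → ℝ) → ℝ) (x : Fin n → ℝ) : ℝ :=
  fderiv ℝ w x (Pi.single i 1)

/-- Gradient as a vector. -/
def grad {n : ℕ} (w : (Fin n → ℝ) → ℝ) (x : Fin n → ℝ) : Fin n → ℝ :=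
  fun i => pd i w x

/-- Hessian matrix. -/
def hess {n : ℕ} (w : (Fin n → ℝ) → ℝ) (x : Fin n → ℝ) : Matrix (Fin n) (Fin n) ℝ :=
  Matrix.of fun i j => pd i (pd j w) x

/-- Squared Euclidean norm of a vector. -/
def normSq {n : ℕ} (ξ : Fin n → ℝ) : ℝ := ∑ i, ξ i ^ 2

/-- Euclidean norm of a vector. -/
def vnorm {n : ℕ} (ξ : Fin n → ℝ) : ℝ := Real.sqrt (∑ i, ξ i ^ 2)

/-- Operator norm of a matrix, viewed as a linear map between Euclidean spaces. -/
def matNorm {n : ℕ} (M : Matrix (Fin n) (Fin n) ℝ) : ℝ :=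
  ‖LinearMap.toContinuousLinearMap (Matrix.toEuclideanLin M)‖

/-- Laplacian. -/
def lapl {n : ℕ} (w : (Fin n → ℝ) → ℝ) (x : Fin n → ℝ) : ℝ := ∑ l, pd l (pd l w) x

/-- `W^{2,p}` norm (with classical derivatives) on a set. -/
def W2pNorm {n : ℕ} (p : ℝ) (w : (Fin n → ℝ) → ℝ) (B : Set (Fin n → ℝ)) : ℝ :=
  (∫ x in B, (|w x| ^ p + vnorm (grad w x) ^ p + matNorm (hess w x) ^ p)) ^ (1 / p)

/-- `C^{1,1}_loc` on a set: continuously differentiable with locally Lipschitz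
first derivatives. -/
def C11On {E F : Type*} [NormedAddCommGroup E] [NormedSpace ℝ E]
    [NormedAddCommGroup F] [NormedSpace ℝ F] (f : E → F) (s : Set E) : Prop :=
  ContDiffOn ℝ 1 f s ∧
    ∀ x ∈ s, ∃ (K : NNReal) (t : Set E), t ∈ nhdsWithin x s ∧
      LipschitzOnWith K (fderivWithin ℝ f s) t

/-- First order difference quotient `∇_l^h`. -/
def dq {n : ℕ} (l : Fin n) (h : ℝ) (w : (Fin n → ℝ) → ℝ) (x : Fin n → ℝ) : ℝ :=
  (w (x + h • (Pi.single l 1 : Fin n → ℝ)) - w x) / h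

/-- Second order difference quotient `Δ_{ll}^h`. -/
def ddq {n : ℕ} (l : Fin n) (h : ℝ) (w : (Fin n → ℝ) → ℝ) (x : Fin n → ℝ) : ℝ :=
  (w (x + h • (Pi.single l 1 : Fin n → ℝ)) - 2 * w x + w (x - h • (Pi.single l 1 : Fin n → ℝ))) / h ^ 2

/-- `L^s` seminorm (as an extended real number) of a function on a set. -/
def lpN {n : ℕ} (s : ℝ) (w : (Fin n → ℝ) → ℝ) (S : Set (Fin n → ℝ)) : ENNReal :=
  (∫⁻ x in S, ENNReal.ofReal (|w x| ^ s)) ^ (1 / s)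

end

open MeasureTheory Metric Set Matrix

noncomputable section SGsec

/-- sum of principal minors over any commutative ring -/
def sg {n : ℕ} {K : Type*} [CommRing K] (k : ℕ) (A : Matrix (Fin n) (Fin n) K) : K :=
  ∑ s ∈ (Finset.univ : Finset (Fin n)).powersetCard k,
    (A.submatrix (Subtype.val : s → Fin n) (Subtype.val : s → Fin n)).det

lemma esymmMat_eq_sg {n : ℕ} {k : ℕ} (hk : k ≤ n) (A : Matrix (Fin n) (Fin n) ℝ) :
    esymmMat k A = sg k A := by
  have h := A.charpoly_coeff_eq_sum_minors k (by simpa using hk)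
  simp only [Fintype.card_fin] at h
  rw [esymmMat, h, ← mul_assoc, ← mul_pow]
  simp [sg]

lemma charpoly_neg_coeff {n : ℕ} {K : Type*} [CommRing K] {k : ℕ} (hk : k ≤ n)
    (A : Matrix (Fin n) (Fin n) K) : (-A).charpoly.coeff (n - k) = sg k A := by
  have h := (-A).charpoly_coeff_eq_sum_minors k (by simpa using hk)
  simp only [Fintype.card_fin] at h
  rw [h, sg, Finset.mul_sum]
  refine Finset.sum_congr rfl fun s hs => ?_
  have hs' := (Finset.mem_powersetCard.mp hs).2
  rw [Matrix.submatrix_neg]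
  simp only [Pi.neg_apply]
  rw [Matrix.det_neg, Fintype.card_coe, hs', ← mul_assoc, ← mul_pow]
  simp

lemma sg_map {n : ℕ} {K L : Type*} [CommRing K] [CommRing L] (φ : K →+* L) (k : ℕ)
    (A : Matrix (Fin n) (Fin n) K) : sg k (A.map φ) = φ (sg k A) := by
  simp only [sg, map_sum, RingHom.map_det]
  rfl

lemma sg_zero {n : ℕ} {K : Type*} [CommRing K] (A : Matrix (Fin n) (Fin n) K) : sg 0 A = 1 := by
  simp [sg]

lemma sg_smul {n : ℕ} {K : Type*} [CommRing K] (k : ℕ) (c : K) (A : Matrix (Fin n) (Fin n) K) :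
    sg k (c • A) = c ^ k * sg k A := by
  rw [sg, sg, Finset.mul_sum]
  refine Finset.sum_congr rfl fun s hs => ?_
  have hs' := (Finset.mem_powersetCard.mp hs).2
  rw [Matrix.submatrix_smul]
  simp only [Pi.smul_apply]
  rw [Matrix.det_smul, Fintype.card_coe, hs']

/-- the polynomial `t ↦ sg k (t A + B)`. -/
def sgP {n : ℕ} {K : Type*} [CommRing K] (k : ℕ) (A B : Matrix (Fin n) (Fin n) K) :
    Polynomial K :=
  ∑ s ∈ (Finset.univ : Finset (Fin n)).powersetCard k,
    (((Polynomial.X : Polynomial K) •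
        (A.submatrix (Subtype.val : s → Fin n) (Subtype.val : s → Fin n)).map Polynomial.C +
      (B.submatrix (Subtype.val : s → Fin n) (Subtype.val : s → Fin n)).map Polynomial.C)).det

lemma sgP_eval {n : ℕ} {K : Type*} [CommRing K] (k : ℕ) (A B : Matrix (Fin n) (Fin n) K) (t : K) :
    (sgP k A B).eval t = sg k (t • A + B) := by
  simp only [sgP, sg, Polynomial.eval_finsetSum]
  refine Finset.sum_congr rfl fun s hs => ?_
  rw [← Polynomial.coe_evalRingHom, RingHom.map_det]
  congr 1
  ext i j
  simp
  ring

lemma sgP_natDegree_le {n : ℕ} {K : Type*} [CommRing K] (k : ℕ) (A B : Matrix (Fin n) (Fin n) K) :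
    (sgP k A B).natDegree ≤ k := by
  refine Polynomial.natDegree_sum_le_of_forall_le _ _ fun s hs => ?_
  have hs' := (Finset.mem_powersetCard.mp hs).2
  refine (Polynomial.natDegree_det_X_add_C_le _ _).trans ?_
  simp [hs']

lemma sgP_coeff {n : ℕ} {K : Type*} [CommRing K] (k : ℕ) (A B : Matrix (Fin n) (Fin n) K) :
    (sgP k A B).coeff k = sg k A := by
  simp only [sgP, sg, Polynomial.finsetSum_coeff]
  refine Finset.sum_congr rfl fun s hs => ?_
  have hs' := (Finset.mem_powersetCard.mp hs).2
  have := Polynomial.coeff_det_X_add_C_card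
    (A.submatrix (Subtype.val : s → Fin n) (Subtype.val : s → Fin n))
    (B.submatrix (Subtype.val : s → Fin n) (Subtype.val : s → Fin n))
  rw [Fintype.card_coe, hs'] at this
  exact this

lemma continuous_sg {n : ℕ} {K : Type*} [CommRing K] [TopologicalSpace K] [IsTopologicalRing K]
    (k : ℕ) : Continuous (fun A : Matrix (Fin n) (Fin n) K => sg k A) := by
  unfold sg
  refine continuous_finsetSum _ fun s _ => ?_
  exact Continuous.matrix_det (by fun_prop)

/-- `z ↦ sg k (X + z)` as a polynomial. -/
lemma sg_add_scalar {n : ℕ} {K : Type*} [CommRing K] {k : ℕ} (hk : k ≤ n)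
    (A : Matrix (Fin n) (Fin n) K) (z : K) :
    sg k (A + z • (1 : Matrix (Fin n) (Fin n) K)) =
      (Polynomial.hasseDeriv (n - k) (-A).charpoly).eval z := by
  rw [← Polynomial.taylor_coeff, ← charpoly_neg_coeff hk]
  congr 1
  rw [Polynomial.taylor_apply, Matrix.charpoly, Matrix.charpoly]
  have h1 : ∀ p : Polynomial K, p.comp (Polynomial.X + Polynomial.C z) =
      Polynomial.eval₂RingHom Polynomial.C (Polynomial.X + Polynomial.C z) p := fun p => rfl
  rw [h1, RingHom.map_det]
  congr 1
  ext1 i j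
  by_cases hij : i = j
  · subst hij
    simp
    ring
  · simp [hij]

lemma splits_iterate_derivative (p : Polynomial ℝ) (hp : p.Splits) (m : ℕ) :
    (Polynomial.derivative^[m] p).Splits := by
  induction m with
  | zero => exact hp
  | succ m ih =>
    rw [Function.iterate_succ_apply']
    set q := Polynomial.derivative^[m] p
    rw [Polynomial.splits_iff_card_roots] at ih ⊢
    have h1 := Polynomial.card_roots_le_derivative q
    have h2 := Polynomial.card_roots' (Polynomial.derivative q)
    have h3 := Polynomial.natDegree_derivative_le q
    by_cases h0 : q.natDegree = 0
    · rw [Polynomial.eq_C_of_natDegree_eq_zero h0]; simp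
    · omega

lemma splits_hasseDeriv (p : Polynomial ℝ) (hp : p.Splits) (m : ℕ) :
    (Polynomial.hasseDeriv m p).Splits := by
  have h := splits_iterate_derivative p hp m
  rw [← Polynomial.factorial_smul_hasseDeriv] at h
  have h2 : Polynomial.hasseDeriv m p =
      Polynomial.C ((m.factorial : ℝ)⁻¹) * ((m.factorial • Polynomial.hasseDeriv m) p) := by
    rw [LinearMap.smul_apply, nsmul_eq_mul, ← Polynomial.C_eq_natCast, ← mul_assoc,
      ← Polynomial.C_mul]
    rw [inv_mul_cancel₀ (by exact_mod_cast m.factorial_ne_zero)]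
    simp
  rw [h2]
  exact (Polynomial.Splits.C _).mul h

/-- complexification -/
abbrev cx {n : ℕ} (A : Matrix (Fin n) (Fin n) ℝ) : Matrix (Fin n) (Fin n) ℂ :=
  A.map Complex.ofRealHom

lemma hasseDeriv_natDegree {n k : ℕ} (hk : k ≤ n) (A : Matrix (Fin n) (Fin n) ℝ) :
    (Polynomial.hasseDeriv (n - k) (-A).charpoly).coeff k ≠ 0 := by
  rw [Polynomial.hasseDeriv_coeff]
  have : k + (n - k) = n := by omega
  rw [this]
  have h2 : (-A).charpoly.coeff n = 1 := by
    have := Matrix.charpoly_monic (-A)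
    rw [Polynomial.Monic, Polynomial.leadingCoeff, Matrix.charpoly_natDegree_eq_dim] at this
    simpa using this
  rw [h2]
  have := Nat.choose_pos (n := n) (k := n - k) (by omega)
  simp [this.ne']

/-- hyperbolicity with respect to the identity. -/
lemma sg_hyperbolic {n k : ℕ} (hk : k ≤ n) (A : Matrix (Fin n) (Fin n) ℝ) (hA : A.IsSymm) (z : ℂ)
    (hz : sg k (cx A + z • (1 : Matrix (Fin n) (Fin n) ℂ)) = 0) : z.im = 0 := by
  rw [sg_add_scalar hk] at hz
  have hneg : -(cx A) = (-A).map Complex.ofRealHom := by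
    ext i j; simp [cx]
  rw [hneg, Matrix.charpoly_map] at hz
  have hmap : Polynomial.hasseDeriv (n - k) ((-A).charpoly.map Complex.ofRealHom) =
      (Polynomial.hasseDeriv (n - k) (-A).charpoly).map Complex.ofRealHom := by
    ext i
    simp [Polynomial.hasseDeriv_coeff]
  rw [hmap] at hz
  have hsp : (Polynomial.hasseDeriv (n - k) (-A).charpoly).Splits := by
    apply splits_hasseDeriv
    apply Matrix.IsHermitian.splits_charpoly
    rw [Matrix.IsHermitian, Matrix.conjTranspose_eq_transpose_of_trivial, Matrix.transpose_neg, hA]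
  set H := Polynomial.hasseDeriv (n - k) (-A).charpoly with hH
  have hH0 : H ≠ 0 := by
    intro h
    have := hasseDeriv_natDegree hk A
    rw [← hH, h] at this
    simp at this
  have hroot : z ∈ (H.map Complex.ofRealHom).roots := by
    rw [Polynomial.mem_roots']
    exact ⟨by simpa [Polynomial.map_eq_zero] using hH0, hz⟩
  rw [hsp.roots_map] at hroot
  obtain ⟨a, _, rfl⟩ := Multiset.mem_map.mp hroot
  simp

lemma sg_add_real {n k : ℕ} (hk : k ≤ n) (A : Matrix (Fin n) (Fin n) ℝ) (z : ℝ) :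
    sg k (A + z • (1 : Matrix (Fin n) (Fin n) ℝ)) =
      ∑ j ∈ Finset.range (k + 1), ((j + (n - k)).choose (n - k) : ℝ) * sg (k - j) A * z ^ j := by
  rw [sg_add_scalar hk, Polynomial.eval_eq_sum_range' (n := k + 1)]
  · refine Finset.sum_congr rfl fun j hj => ?_
    have hj' : j ≤ k := by simpa [Nat.lt_succ_iff] using hj
    rw [Polynomial.hasseDeriv_coeff, ← charpoly_neg_coeff (k := k - j) (by omega)]
    congr 4
    omega
  · have := Polynomial.natDegree_hasseDeriv_le (-A).charpoly (n - k)
    rw [Matrix.charpoly_natDegree_eq_dim, Fintype.card_fin] at this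
    omega

lemma sg_pos_of_gamma {n k : ℕ} (hk : k ≤ n) (A : Matrix (Fin n) (Fin n) ℝ)
    (hA : ∀ j, 1 ≤ j → j ≤ k → 0 < sg j A) (z : ℝ) (hz : 0 ≤ z) :
    0 < sg k (A + z • (1 : Matrix (Fin n) (Fin n) ℝ)) := by
  have hA' : ∀ j, j ≤ k → 0 < sg j A := by
    intro j hj
    rcases Nat.eq_zero_or_pos j with rfl | h
    · rw [sg_zero]; norm_num
    · exact hA j h hj
  rw [sg_add_real hk]
  rw [Finset.sum_range_succ']
  have h1 := Nat.choose_pos (n := 0 + (n - k)) (k := n - k) (by omega)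
  have h2 := hA' (k - 0) (by omega)
  have : 0 ≤ ∑ j ∈ Finset.range k,
      ((j + 1 + (n - k)).choose (n - k) : ℝ) * sg (k - (j + 1)) A * z ^ (j + 1) := by
    refine Finset.sum_nonneg fun j hj => ?_
    have := hA' (k - (j + 1)) (by omega)
    positivity
  have h3 : (0:ℝ) < ((0 + (n - k)).choose (n - k) : ℝ) * sg (k - 0) A * z ^ 0 := by
    rw [pow_zero, mul_one]
    have : (0:ℝ) < ((0 + (n - k)).choose (n - k) : ℝ) := by exact_mod_cast h1
    positivity
  linarith

end SGsec
open MeasureTheory Metric Set Matrix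

noncomputable section HypSec

lemma prod_lower (ℓ : ℂ →ₗ[ℝ] ℝ) (hℓ : ∀ w, |ℓ w| ≤ ‖w‖) (t : ℂ) (ht : 0 ≤ ℓ t) (m : Multiset ℂ)
    (hm : ∀ a ∈ m, ℓ a < 0) : (ℓ t) ^ (Multiset.card m) ≤ ‖(m.map (t - ·)).prod‖ := by
  induction m using Multiset.induction_on with
  | empty => simp
  | cons a m ih =>
    have h1 := ih (fun b hb => hm b (Multiset.mem_cons_of_mem hb))
    have h2 := hm a (Multiset.mem_cons_self a m)
    have h3 : ℓ t ≤ ‖t - a‖ := by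
      have := (le_abs_self _).trans (hℓ (t - a))
      rw [map_sub] at this
      linarith
    rw [Multiset.card_cons, Multiset.map_cons, Multiset.prod_cons, norm_mul, pow_succ, mul_comm]
    exact mul_le_mul h3 h1 (by positivity) (norm_nonneg _)

lemma poly_lower (k : ℕ) (c : ℂ) (hc : c ≠ 0) (q : Polynomial ℂ) (hdeg : q.natDegree ≤ k)
    (hco : q.coeff k = c) (ℓ : ℂ →ₗ[ℝ] ℝ) (hℓ : ∀ w, |ℓ w| ≤ ‖w‖)
    (hr : ∀ t, 0 ≤ ℓ t → q.eval t ≠ 0) (t : ℂ) (ht : 0 ≤ ℓ t) :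
    ‖c‖ * (ℓ t) ^ k ≤ ‖q.eval t‖ := by
  have hd : q.natDegree = k :=
    le_antisymm hdeg (Polynomial.le_natDegree_of_ne_zero (by rw [hco]; exact hc))
  have hs : q.Splits := IsAlgClosed.splits q
  rw [hs.eval_eq_prod_roots, norm_mul, Polynomial.leadingCoeff, hd, hco]
  refine mul_le_mul_of_nonneg_left ?_ (norm_nonneg _)
  have hcard : q.roots.card = k := by rw [← hd]; exact Polynomial.splits_iff_card_roots.mp hs
  rw [← hcard]
  refine prod_lower ℓ hℓ t ht _ fun a ha => ?_
  by_contra h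
  exact hr a (not_lt.mp h) (Polynomial.isRoot_of_mem_roots ha)

lemma homotopy_roots (k : ℕ) (c : ℂ) (hc : c ≠ 0) (q : ℝ → Polynomial ℂ)
    (hdeg : ∀ s, (q s).natDegree ≤ k) (hco : ∀ s, (q s).coeff k = c)
    (hcont : Continuous fun x : ℝ × ℂ => (q x.1).eval x.2)
    (ℓ : ℂ →ₗ[ℝ] ℝ) (hℓ : ∀ w, |ℓ w| ≤ ‖w‖) (ρ : ℝ)
    (hρ : ∀ s ∈ Icc (0:ℝ) 1, ∀ t, (q s).eval t = 0 → ‖t‖ ≤ ρ)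
    (hbd : ∀ s ∈ Icc (0:ℝ) 1, ∀ t, ℓ t = 0 → (q s).eval t ≠ 0)
    (h0 : ∀ t, 0 ≤ ℓ t → (q 0).eval t ≠ 0) :
    ∀ t, 0 ≤ ℓ t → (q 1).eval t ≠ 0 := by
  have hℓc : Continuous ℓ := LinearMap.continuous_of_finiteDimensional ℓ
  let G : Set ℝ := {s | ∀ t, 0 ≤ ℓ t → ‖c‖ * (ℓ t) ^ k ≤ ‖(q s).eval t‖}
  let Bd : Set ℝ := {s | s ∈ Icc (0:ℝ) 1 ∧ ∃ t, 0 ≤ ℓ t ∧ (q s).eval t = 0}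
  have hGc : IsClosed G := by
    have : G = ⋂ t : ℂ, ⋂ _ : 0 ≤ ℓ t, {s | ‖c‖ * (ℓ t) ^ k ≤ ‖(q s).eval t‖} := by
      ext s; simp [G]
    rw [this]
    refine isClosed_iInter fun t => isClosed_iInter fun _ => ?_
    refine isClosed_le continuous_const ?_
    exact (hcont.comp (Continuous.prodMk continuous_id continuous_const)).norm
  have hBc : IsClosed Bd := by
    have : Bd = Prod.fst '' ((Icc (0:ℝ) 1 ×ˢ closedBall (0:ℂ) ρ) ∩
        ({x | 0 ≤ ℓ x.2} ∩ {x | (q x.1).eval x.2 = 0})) := by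
      ext s
      constructor
      · rintro ⟨hs, t, ht, hq⟩
        exact ⟨(s, t), ⟨⟨hs, by simpa using hρ s hs t hq⟩, ht, hq⟩, rfl⟩
      · rintro ⟨⟨s', t⟩, ⟨⟨hs, _⟩, ht, hq⟩, rfl⟩
        exact ⟨hs, t, ht, hq⟩
    rw [this]
    refine IsCompact.isClosed (IsCompact.image ?_ continuous_fst)
    refine IsCompact.inter_right (isCompact_Icc.prod (isCompact_closedBall _ _)) ?_
    refine IsClosed.inter ?_ ?_
    · exact isClosed_le continuous_const (hℓc.comp continuous_snd)
    · exact isClosed_eq hcont continuous_const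
  have hGgood : ∀ s ∈ Icc (0:ℝ) 1, s ∈ G → ∀ t, 0 ≤ ℓ t → (q s).eval t ≠ 0 := by
    intro s hs hsG t ht hq
    rcases ht.eq_or_lt with h | h
    · exact hbd s hs t h.symm hq
    · have := hsG t ht
      rw [hq, norm_zero] at this
      have h2 : 0 < ‖c‖ * (ℓ t) ^ k := mul_pos (norm_pos_iff.mpr hc) (pow_pos h k)
      linarith
  have hpre := (isPreconnected_closed_iff.mp (isPreconnected_Icc (a := (0:ℝ)) (b := 1))) G Bd hGc hBc
  have hcover : Icc (0:ℝ) 1 ⊆ G ∪ Bd := by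
    intro s hs
    by_cases h : ∃ t, 0 ≤ ℓ t ∧ (q s).eval t = 0
    · exact Or.inr ⟨hs, h⟩
    · push Not at h
      exact Or.inl fun t ht => poly_lower k c hc (q s) (hdeg s) (hco s) ℓ hℓ h t ht
  have h0G : (0:ℝ) ∈ G := fun t ht => poly_lower k c hc (q 0) (hdeg 0) (hco 0) ℓ hℓ h0 t ht
  intro t ht hq
  obtain ⟨s, hs, hsG, hsB⟩ := hpre hcover ⟨0, by simp, h0G⟩ ⟨1, by simp, ⟨by simp, t, ht, hq⟩⟩
  obtain ⟨_, t', ht', hq'⟩ := hsB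
  exact hGgood s hs hsG t' ht' hq'

lemma root_bound {n k : ℕ} (A : Matrix (Fin n) (Fin n) ℂ) (hA : sg k A ≠ 0)
    (E : ℝ → Matrix (Fin n) (Fin n) ℂ) (hE : Continuous E) :
    ∃ ρ : ℝ, ∀ s ∈ Icc (0:ℝ) 1, ∀ t : ℂ, sg k (t • A + E s) = 0 → ‖t‖ ≤ ρ := by
  have hc : Continuous fun x : ℂ × ℝ => sg k (A + x.1 • E x.2) :=
    (continuous_sg k).comp (by fun_prop)
  have hev : ∀ᶠ w in nhds (0:ℂ), ∀ s ∈ Icc (0:ℝ) 1, sg k (A + w • E s) ≠ 0 := by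
    refine isCompact_Icc.eventually_forall_of_forall_eventually fun s _ => ?_
    refine hc.continuousAt.eventually_ne ?_
    simpa using hA
  obtain ⟨δ, hδ, hball⟩ := Metric.eventually_nhds_iff.mp hev
  refine ⟨δ⁻¹, fun s hs t ht => ?_⟩
  by_contra hlt
  push Not at hlt
  have ht0 : t ≠ 0 := by
    rintro rfl
    rw [norm_zero] at hlt
    exact absurd hlt (not_lt.mpr (by positivity))
  refine hball (y := t⁻¹) ?_ s hs ?_
  · rw [dist_zero_right, norm_inv]
    exact inv_lt_of_inv_lt₀ hδ hlt
  · have : t • A + E s = t • (A + t⁻¹ • E s) := by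
      rw [smul_add, smul_smul, mul_inv_cancel₀ ht0, one_smul]
    rw [this, sg_smul] at ht
    rcases mul_eq_zero.mp ht with h | h
    · exact absurd h (pow_ne_zero _ ht0)
    · exact h

/-- the Gårding cone -/
def HCone {n : ℕ} (k : ℕ) (A : Matrix (Fin n) (Fin n) ℝ) : Prop :=
  A.IsSymm ∧ ∀ z : ℝ, 0 ≤ z → 0 < sg k (A + z • (1 : Matrix (Fin n) (Fin n) ℝ))

lemma HCone.pos {n k : ℕ} {A : Matrix (Fin n) (Fin n) ℝ} (h : HCone k A) : 0 < sg k A := by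
  simpa using h.2 0 le_rfl

lemma sg_cx {n k : ℕ} (A : Matrix (Fin n) (Fin n) ℝ) : sg k (cx A) = ((sg k A : ℝ) : ℂ) :=
  sg_map Complex.ofRealHom k A

lemma sg_one_ne {n k : ℕ} (hk : k ≤ n) : sg k (1 : Matrix (Fin n) (Fin n) ℝ) ≠ 0 := by
  intro h
  have h0 : (0 : Matrix (Fin n) (Fin n) ℝ).IsSymm := by simp [Matrix.IsSymm]
  have h1 : (1 : Matrix (Fin n) (Fin n) ℂ) = cx (1 : Matrix (Fin n) (Fin n) ℝ) := by
    ext i j; simp [Matrix.one_apply]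
  have := sg_hyperbolic hk 0 h0 Complex.I (by
    have e : cx (0 : Matrix (Fin n) (Fin n) ℝ) = 0 := by ext i j; simp
    rw [e, zero_add, sg_smul, h1, sg_cx, h]; simp)
  simp at this

lemma cx_lin {n : ℕ} (a b : ℝ) (A B : Matrix (Fin n) (Fin n) ℝ) :
    (a : ℂ) • cx A + (b : ℂ) • cx B = cx (a • A + b • B) := by
  ext i j; simp

lemma sg_scale_zero {n k : ℕ} (A : Matrix (Fin n) (Fin n) ℂ) (E : Matrix (Fin n) (Fin n) ℂ) (t : ℂ)
    (ht : t ≠ 0) (h : sg k (t • A + E) = 0) : sg k (A + t⁻¹ • E) = 0 := by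
  have : t • A + E = t • (A + t⁻¹ • E) := by
    rw [smul_add, smul_smul, mul_inv_cancel₀ ht, one_smul]
  rw [this, sg_smul] at h
  exact (mul_eq_zero.mp h).resolve_left (pow_ne_zero _ ht)

lemma one_eq_cx {n : ℕ} : (1 : Matrix (Fin n) (Fin n) ℂ) = cx (1 : Matrix (Fin n) (Fin n) ℝ) := by
  ext i j; simp [Matrix.one_apply]

lemma stab1 {n k : ℕ} (hk : k ≤ n) (A B : Matrix (Fin n) (Fin n) ℝ) (hA : HCone k A)
    (hB : B.IsSymm) (α : ℝ) (hα : 0 < α) (t : ℂ) (ht : 0 ≤ t.im) :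
    sg k (t • cx A + (cx B + (α * Complex.I) • (1 : Matrix (Fin n) (Fin n) ℂ))) ≠ 0 := by
  have hA0 : sg k (cx A) ≠ 0 := by rw [sg_cx]; exact_mod_cast hA.pos.ne'
  let E : ℝ → Matrix (Fin n) (Fin n) ℂ := fun s =>
    ((s : ℂ) • cx B + (α * Complex.I) • (1 : Matrix (Fin n) (Fin n) ℂ))
  have hE : Continuous E := by
    refine Continuous.add ?_ continuous_const
    exact (Complex.continuous_ofReal).smul continuous_const
  obtain ⟨ρ, hρ⟩ := root_bound (k := k) (cx A) hA0 E hE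
  have key := homotopy_roots k _ hA0 (fun s => sgP k (cx A) (E s))
    (fun s => sgP_natDegree_le k _ _) (fun s => sgP_coeff k _ _)
    (by
      simp only [sgP_eval]
      exact (continuous_sg k).comp (by fun_prop))
    Complex.imLm (fun w => Complex.abs_im_le_norm w) ρ
    (fun s hs t h => hρ s hs t (by rwa [sgP_eval] at h))
    (by
      intro s hs t ht h
      rw [sgP_eval] at h
      have htr : t = (t.re : ℂ) := by
        apply Complex.ext
        · simp
        · simpa using ht
      rw [htr] at h
      simp only [E] at h
      rw [← add_assoc, cx_lin] at h
      have := sg_hyperbolic hk _ ?_ _ h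
      · simp at this; exact hα.ne' this
      · exact (hA.1.smul _).add (hB.smul _))
    (by
      intro t ht h
      rw [sgP_eval] at h
      simp only [E, Complex.ofReal_zero, zero_smul, zero_add] at h
      by_cases ht0 : t = 0
      · rw [ht0, zero_smul, zero_add, sg_smul, one_eq_cx, sg_cx] at h
        rcases mul_eq_zero.mp h with h | h
        · refine absurd h (pow_ne_zero _ ?_)
          simp [hα.ne']
        · exact sg_one_ne hk (by exact_mod_cast h)
      · have h2 := sg_scale_zero _ _ t ht0 h
        rw [smul_smul] at h2
        have h3 := sg_hyperbolic hk A hA.1 _ h2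
        set r : ℂ := t⁻¹ * (α * Complex.I) with hr
        have hrr : r = (r.re : ℂ) := by
          apply Complex.ext
          · simp
          · simpa using h3
        rw [hrr] at h2
        have h4 : sg k (A + r.re • (1 : Matrix (Fin n) (Fin n) ℝ)) = 0 := by
          have e := cx_lin 1 r.re A 1
          rw [← one_eq_cx] at e
          simp only [Complex.ofReal_one, one_smul] at e
          rw [e, sg_cx] at h2
          exact_mod_cast h2
        have h5 : r.re < 0 := by
          by_contra hh
          exact (hA.2 r.re (not_lt.mp hh)).ne' h4
        have h6 : t * r = α * Complex.I := by
          rw [hr, ← mul_assoc, mul_inv_cancel₀ ht0, one_mul]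
        rw [hrr] at h6
        have h7 := congrArg Complex.im h6
        simp at h7
        have ht' : 0 ≤ t.im := ht
        nlinarith)
  have := key t ht
  rw [sgP_eval] at this
  simpa [E] using this

lemma stab2_aux {n k : ℕ} (hk : k ≤ n) (A B : Matrix (Fin n) (Fin n) ℝ) (hA : HCone k A)
    (hB : B.IsSymm) (t : ℂ) (ht : sg k (t • cx A + cx B) = 0) : t.im ≤ 0 := by
  by_contra hlt
  push Not at hlt
  have hA0 : sg k (cx A) ≠ 0 := by rw [sg_cx]; exact_mod_cast hA.pos.ne'
  have hc : Continuous fun α : ℝ =>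
      ‖sg k (t • cx A + (cx B + (α * Complex.I) • (1 : Matrix (Fin n) (Fin n) ℂ)))‖ :=
    ((continuous_sg k).comp (by fun_prop)).norm
  have h1 : ∀ α ∈ Ioi (0:ℝ), ‖sg k (cx A)‖ * t.im ^ k ≤
      ‖sg k (t • cx A + (cx B + (α * Complex.I) • (1 : Matrix (Fin n) (Fin n) ℂ)))‖ := by
    intro α hα
    have := poly_lower k _ hA0 (sgP k (cx A) (cx B + (α * Complex.I) • 1)) (sgP_natDegree_le k _ _)
      (sgP_coeff k _ _) Complex.imLm (fun w => Complex.abs_im_le_norm w)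
      (fun t ht => by rw [sgP_eval]; exact stab1 hk A B hA hB α hα t ht) t hlt.le
    rwa [sgP_eval] at this
  have h2 : ‖sg k (cx A)‖ * t.im ^ k ≤
      ‖sg k (t • cx A + (cx B + ((0:ℝ) * Complex.I) • (1 : Matrix (Fin n) (Fin n) ℂ)))‖ := by
    have hten : Filter.Tendsto (fun α : ℝ =>
        ‖sg k (t • cx A + (cx B + (α * Complex.I) • (1 : Matrix (Fin n) (Fin n) ℂ)))‖)
        (nhdsWithin (0:ℝ) (Ioi 0)) (nhds _) := (hc.tendsto 0).mono_left nhdsWithin_le_nhds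
    refine ge_of_tendsto hten ?_
    filter_upwards [self_mem_nhdsWithin] with α hα using h1 α hα
  simp only [Complex.ofReal_zero, zero_mul, zero_smul, add_zero, ht, norm_zero] at h2
  have : 0 < ‖sg k (cx A)‖ * t.im ^ k := mul_pos (norm_pos_iff.mpr hA0) (pow_pos hlt k)
  linarith

lemma stab2 {n k : ℕ} (hk : k ≤ n) (A B : Matrix (Fin n) (Fin n) ℝ) (hA : HCone k A)
    (hB : B.IsSymm) (t : ℂ) (ht : sg k (t • cx A + cx B) = 0) : t.im = 0 := by
  refine le_antisymm (stab2_aux hk A B hA hB t ht) ?_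
  have h := sg_map (starRingEnd ℂ) k (t • cx A + cx B)
  rw [ht, map_zero] at h
  have e : (t • cx A + cx B).map (starRingEnd ℂ) = (starRingEnd ℂ t) • cx A + cx B := by
    ext i j; simp
  rw [e] at h
  have := stab2_aux hk A B hA hB _ h
  simpa using this

lemma stab3 {n k : ℕ} (hk : k ≤ n) (A B : Matrix (Fin n) (Fin n) ℝ) (hA : HCone k A)
    (hB : HCone k B) (t : ℂ) (ht : sg k (t • cx A + cx B) = 0) : t.im = 0 ∧ t.re < 0 := by
  refine ⟨stab2 hk A B hA hB.1 t ht, ?_⟩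
  have hA0 : sg k (cx A) ≠ 0 := by rw [sg_cx]; exact_mod_cast hA.pos.ne'
  let F : ℝ → Matrix (Fin n) (Fin n) ℝ := fun s => s • B + (1 - s) • 1
  have hF : ∀ s, (F s).IsSymm := fun s => (hB.1.smul _).add (Matrix.isSymm_one.smul _)
  have hFc : Continuous fun s => cx (F s) := by
    have : (fun s => cx (F s)) = fun s : ℝ => (s:ℂ) • cx B + ((1 - s : ℝ) : ℂ) • cx 1 := by
      ext1 s; rw [cx_lin]
    rw [this]
    exact ((Complex.continuous_ofReal).smul continuous_const).add
      ((Complex.continuous_ofReal.comp (by fun_prop)).smul continuous_const)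
  obtain ⟨ρ, hρ⟩ := root_bound (k := k) (cx A) hA0 (fun s => cx (F s)) hFc
  have key := homotopy_roots k _ hA0 (fun s => sgP k (cx A) (cx (F s)))
    (fun s => sgP_natDegree_le k _ _) (fun s => sgP_coeff k _ _)
    (by
      simp only [sgP_eval]
      refine (continuous_sg k).comp ?_
      exact (continuous_snd.smul continuous_const).add (hFc.comp continuous_fst))
    Complex.reLm (fun w => Complex.abs_re_le_norm w) ρ
    (fun s hs t h => hρ s hs t (by rwa [sgP_eval] at h))
    (by
      intro s hs t ht h
      rw [sgP_eval] at h
      have h1 := stab2 hk A (F s) hA (hF s) t h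
      have h2 : t = 0 := Complex.ext ht h1
      rw [h2, zero_smul, zero_add, sg_cx] at h
      have h3 : sg k (F s) = 0 := by exact_mod_cast h
      rcases hs.1.eq_or_lt with h0 | h0
      · rw [← h0] at h3
        simp only [F, zero_smul, sub_zero, one_smul, zero_add] at h3
        exact sg_one_ne hk h3
      · have e : F s = s • (B + ((1 - s) / s) • 1) := by
          simp only [F]
          rw [smul_add, smul_smul, mul_div_cancel₀ _ h0.ne']
        rw [e, sg_smul] at h3
        have := hB.2 ((1 - s) / s) (div_nonneg (by linarith [hs.2]) h0.le)
        exact (mul_pos (pow_pos h0 k) this).ne' h3)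
    (by
      intro t ht h
      rw [sgP_eval] at h
      have hF0 : F 0 = 1 := by simp [F]
      rw [hF0] at h
      have h1 := stab2 hk A 1 hA Matrix.isSymm_one t h
      have htr : t = (t.re : ℂ) := by
        apply Complex.ext
        · simp
        · simpa using h1
      have ht' : 0 ≤ t.re := ht
      rcases ht'.eq_or_lt with h0 | h0
      · rw [htr, ← h0, Complex.ofReal_zero, zero_smul, zero_add, sg_cx] at h
        exact sg_one_ne hk (by exact_mod_cast h)
      · rw [htr] at h
        have e := cx_lin t.re 1 A 1
        simp only [Complex.ofReal_one, one_smul] at e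
        rw [e, sg_cx] at h
        have h3 : sg k (t.re • A + 1) = 0 := by exact_mod_cast h
        have e2 : t.re • A + 1 = t.re • (A + (t.re)⁻¹ • 1) := by
          rw [smul_add, smul_smul, mul_inv_cancel₀ h0.ne', one_smul]
        rw [e2, sg_smul] at h3
        have := hA.2 (t.re)⁻¹ (by positivity)
        exact (mul_pos (pow_pos h0 k) this).ne' h3)
  by_contra hlt
  have hF1 : F 1 = B := by simp [F]
  have := key t (not_lt.mp hlt)
  rw [sgP_eval, hF1] at this
  exact this ht

/-- AM-GM on multisets in additive form -/
lemma multiset_amgm (m : Multiset ℝ) (hm : ∀ x ∈ m, 0 < x) :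
    (Multiset.card m : ℝ) + Real.log m.prod ≤ m.sum := by
  induction m using Multiset.induction_on with
  | empty => simp
  | cons a m ih =>
    have h1 := ih (fun b hb => hm b (Multiset.mem_cons_of_mem hb))
    have h2 := hm a (Multiset.mem_cons_self a m)
    have h3 : 0 < m.prod := Multiset.prod_pos fun b hb => hm b (Multiset.mem_cons_of_mem hb)
    rw [Multiset.card_cons, Multiset.prod_cons, Multiset.sum_cons, Real.log_mul h2.ne' h3.ne']
    have := Real.log_le_sub_one_of_pos h2
    push_cast
    linarith

lemma garding_poly {n k : ℕ} (hk : k ≤ n) (A B : Matrix (Fin n) (Fin n) ℝ)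
    (hA : HCone k A) (hB : HCone k B) (a b : ℝ) (ha : 0 < a) (hb : 0 < b)
    (hAa : sg k A = a ^ k) (hBb : sg k B = b ^ k) (hk1 : 1 ≤ k) :
    k * a ^ (k - 1) * b ≤ (sgP k B A).derivative.eval 0 := by
  set r := (sgP k B A).map Complex.ofRealHom with hr
  have hrP : r = sgP k (cx B) (cx A) := by
    apply Polynomial.funext
    intro t
    rw [sgP_eval, hr]
    have : ((sgP k B A).map Complex.ofRealHom) = sgP k (cx B) (cx A) := by
      rw [sgP, sgP, Polynomial.map_sum]
      refine Finset.sum_congr rfl fun s hs => ?_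
      rw [← Polynomial.coe_mapRingHom, RingHom.map_det]
      congr 1
      ext1 i j
      simp
    rw [this, sgP_eval]
  have hco : r.coeff k = ((b ^ k : ℝ) : ℂ) := by
    rw [hrP, sgP_coeff, sg_cx, hBb]
  have hd : r.natDegree = k := by
    refine le_antisymm (hrP ▸ sgP_natDegree_le k _ _) (Polynomial.le_natDegree_of_ne_zero ?_)
    rw [hco]; exact_mod_cast (pow_pos hb k).ne'
  have hs : r.Splits := IsAlgClosed.splits r
  have hcard : r.roots.card = k := by rw [← hd]; exact Polynomial.splits_iff_card_roots.mp hs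
  have hroot : ∀ z ∈ r.roots, z.im = 0 ∧ z.re < 0 := by
    intro z hz
    have h := Polynomial.isRoot_of_mem_roots hz
    rw [Polynomial.IsRoot, hrP, sgP_eval] at h
    exact stab3 hk B A hB hA z h
  have hr0 : r.eval 0 = ((a ^ k : ℝ) : ℂ) := by
    rw [hrP, sgP_eval, zero_smul, zero_add, sg_cx, hAa]
  have hr0' : r.eval 0 ≠ 0 := by rw [hr0]; exact_mod_cast (pow_pos ha k).ne'
  let m : Multiset ℝ := r.roots.map fun z => 1 / (-z.re)
  have hm : ∀ x ∈ m, 0 < x := by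
    intro x hx
    obtain ⟨z, hz, rfl⟩ := Multiset.mem_map.mp hx
    have := (hroot z hz).2
    exact one_div_pos.mpr (by linarith)
  have hdz : ∀ z ∈ r.roots, 1 / (0 - z) = ((1 / (-z.re) : ℝ) : ℂ) := by
    intro z hz
    have : z = (z.re : ℂ) := by
      apply Complex.ext
      · simp
      · simpa using (hroot z hz).1
    rw [zero_sub]
    conv_lhs => rw [this]
    push_cast
    rfl
  have hder := hs.eval_derivative_eq_eval_mul_sum hr0'
  have hsum : (r.roots.map fun z ↦ 1 / (0 - z)).sum = ((m.sum : ℝ) : ℂ) := by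
    rw [Multiset.map_congr rfl hdz, ← Complex.ofRealHom_eq_coe, map_multiset_sum, Multiset.map_map]
    rfl
  rw [hsum, hr0] at hder
  have hder2 : (sgP k B A).derivative.eval 0 = a ^ k * m.sum := by
    have e : r.derivative.eval 0 = (((sgP k B A).derivative.eval 0 : ℝ) : ℂ) := by
      rw [hr, Polynomial.derivative_map]
      have := Polynomial.eval_map_apply (f := Complex.ofRealHom) (p := (sgP k B A).derivative) 0
      simpa using this
    rw [e] at hder
    exact_mod_cast hder
  have hprod : m.prod = b ^ k / a ^ k := by
    have h1 := hs.eval_eq_prod_roots 0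
    rw [hr0, Polynomial.leadingCoeff, hd, hco] at h1
    have h2 : ((r.roots.map (fun z => 0 - z)).prod) * ((m.prod : ℝ) : ℂ) = 1 := by
      have e : ((m.prod : ℝ) : ℂ) = (r.roots.map fun z ↦ 1 / (0 - z)).prod := by
        rw [Multiset.map_congr rfl hdz, ← Complex.ofRealHom_eq_coe, map_multiset_prod,
          Multiset.map_map]
        rfl
      rw [e, ← Multiset.prod_map_mul]
      apply Multiset.prod_eq_one
      intro x hx
      obtain ⟨z, hz, rfl⟩ := Multiset.mem_map.mp hx
      have : z ≠ 0 := by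
        rintro rfl
        have := (hroot 0 hz).2
        simp at this
      have h0 : (0 : ℂ) - z ≠ 0 := by simpa using this
      field_simp
    have h3 : ((a ^ k : ℝ) : ℂ) * ((m.prod : ℝ) : ℂ) = ((b ^ k : ℝ) : ℂ) := by
      rw [h1, mul_assoc, h2, mul_one]
    have h4 : a ^ k * m.prod = b ^ k := by exact_mod_cast h3
    rw [eq_div_iff (pow_pos ha k).ne']
    linarith
  have hamgm := multiset_amgm (m.map fun x => x * (a / b)) (by
    intro x hx
    obtain ⟨y, hy, rfl⟩ := Multiset.mem_map.mp hx
    exact mul_pos (hm y hy) (div_pos ha hb))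
  have hmc : Multiset.card m = k := by simp [m, hcard]
  rw [Multiset.prod_map_mul, Multiset.sum_map_mul_right, Multiset.map_id', Multiset.map_const',
    Multiset.prod_replicate, Multiset.card_map, hmc, hprod] at hamgm
  have e1 : b ^ k / a ^ k * (a / b) ^ k = 1 := by
    rw [div_pow]; field_simp
  rw [e1, Real.log_one, add_zero] at hamgm
  rw [hder2]
  have e2 : a ^ k = a ^ (k - 1) * a := by rw [← pow_succ]; congr 1; omega
  have e3 : k * b / a ≤ m.sum := by
    rw [div_le_iff₀ ha]
    have : k * b ≤ m.sum * (a / b) * b := mul_le_mul_of_nonneg_right hamgm hb.le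
    have e4 : m.sum * (a / b) * b = m.sum * a := by field_simp
    linarith
  calc k * a ^ (k - 1) * b = a ^ k * (k * b / a) := by rw [e2]; field_simp
    _ ≤ a ^ k * m.sum := mul_le_mul_of_nonneg_left e3 (pow_pos ha k).le

lemma sg_segment {n k : ℕ} (hk : k ≤ n) (A E : Matrix (Fin n) (Fin n) ℝ) (hA : HCone k A)
    (hE : E.IsSymm) (hseg : ∀ s ∈ Icc (0:ℝ) 1, sg k (A + s • E) ≠ 0) (z : ℂ) (hz : 0 ≤ z.re) :
    sg k (z • (1 : Matrix (Fin n) (Fin n) ℂ) + cx (A + E)) ≠ 0 := by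
  have hI0 : sg k (1 : Matrix (Fin n) (Fin n) ℂ) ≠ 0 := by
    rw [one_eq_cx, sg_cx]; exact_mod_cast sg_one_ne hk
  let F : ℝ → Matrix (Fin n) (Fin n) ℝ := fun s => A + s • E
  have hF : ∀ s, (F s).IsSymm := fun s => hA.1.add (hE.smul _)
  have hFc : Continuous fun s => cx (F s) := by
    have : (fun s => cx (F s)) = fun s : ℝ => cx A + (s:ℂ) • cx E := by
      ext1 s
      ext i j; simp [F]
    rw [this]
    exact continuous_const.add ((Complex.continuous_ofReal).smul continuous_const)
  obtain ⟨ρ, hρ⟩ := root_bound (k := k) 1 hI0 (fun s => cx (F s)) hFc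
  have key := homotopy_roots k _ hI0 (fun s => sgP k 1 (cx (F s)))
    (fun s => sgP_natDegree_le k _ _) (fun s => sgP_coeff k _ _)
    (by
      simp only [sgP_eval]
      refine (continuous_sg k).comp ?_
      exact (continuous_snd.smul continuous_const).add (hFc.comp continuous_fst))
    Complex.reLm (fun w => Complex.abs_re_le_norm w) ρ
    (fun s hs t h => hρ s hs t (by rwa [sgP_eval] at h))
    (by
      intro s hs t ht h
      rw [sgP_eval] at h
      have h1 := sg_hyperbolic hk (F s) (hF s) t (by rwa [add_comm])
      have h2 : t = 0 := Complex.ext ht h1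
      rw [h2, zero_smul, zero_add, sg_cx] at h
      exact hseg s hs (by exact_mod_cast h))
    (by
      intro t ht h
      rw [sgP_eval] at h
      have hF0 : F 0 = A := by simp [F]
      rw [hF0] at h
      have h1 := sg_hyperbolic hk A hA.1 t (by rwa [add_comm])
      have htr : t = (t.re : ℂ) := by
        apply Complex.ext
        · simp
        · simpa using h1
      rw [htr, one_eq_cx] at h
      have e := cx_lin t.re 1 1 A
      simp only [Complex.ofReal_one, one_smul] at e
      rw [e, sg_cx, add_comm] at h
      exact (hA.2 t.re ht).ne' (by exact_mod_cast h))
  have := key z hz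
  rw [sgP_eval] at this
  simpa [F] using this

lemma sg_one_pos_of_segment {n k : ℕ} (hk : k ≤ n) (hk1 : 1 ≤ k) (D : Matrix (Fin n) (Fin n) ℝ)
    (h : ∀ z : ℂ, 0 ≤ z.re → sg k (z • (1 : Matrix (Fin n) (Fin n) ℂ) + cx D) ≠ 0) :
    0 < sg 1 D := by
  set H := Polynomial.hasseDeriv (n - k) (-D).charpoly with hH
  set r := H.map Complex.ofRealHom with hr
  have hck : H.coeff k ≠ 0 := hasseDeriv_natDegree hk D
  have hHd : H.natDegree = k := by
    refine le_antisymm ?_ (Polynomial.le_natDegree_of_ne_zero hck)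
    have := Polynomial.natDegree_hasseDeriv_le (-D).charpoly (n - k)
    rw [Matrix.charpoly_natDegree_eq_dim, Fintype.card_fin, ← hH] at this
    omega
  have hd : r.natDegree = k := by rw [hr, Polynomial.natDegree_map, hHd]
  have hs : r.Splits := IsAlgClosed.splits r
  have hcard : r.roots.card = k := by rw [← hd]; exact Polynomial.splits_iff_card_roots.mp hs
  have hroot : ∀ z ∈ r.roots, z.re < 0 := by
    intro z hz
    by_contra hlt
    refine h z (not_lt.mp hlt) ?_
    have h1 := Polynomial.isRoot_of_mem_roots hz
    rw [add_comm, sg_add_scalar hk]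
    have hneg : -(cx D) = (-D).map Complex.ofRealHom := by
      ext i j; simp [cx]
    rw [hneg, Matrix.charpoly_map]
    have hmap : Polynomial.hasseDeriv (n - k) ((-D).charpoly.map Complex.ofRealHom) = r := by
      ext i
      simp [Polynomial.hasseDeriv_coeff, hr, hH]
    rw [hmap]; exact h1
  have hnext := hs.nextCoeff_eq_neg_sum_roots_mul_leadingCoeff
  rw [Polynomial.nextCoeff_of_natDegree_pos (by omega), hd, Polynomial.leadingCoeff, hd, hr,
    Polynomial.coeff_map, Polynomial.coeff_map, ← hr] at hnext
  have hre := congrArg Complex.re hnext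
  have hsum : (r.roots.sum).re = (r.roots.map Complex.re).sum := by
    have := map_multiset_sum Complex.reAddGroupHom r.roots
    simpa using this
  have hneg : (r.roots.map Complex.re).sum < 0 := by
    have hpos : ∀ m : Multiset ℂ, (∀ z ∈ m, z.re < 0) → 1 ≤ Multiset.card m →
        (m.map Complex.re).sum < 0 := by
      intro m
      induction m using Multiset.induction_on with
      | empty => intro _ h; simp at h
      | cons a m ih =>
        intro hm _
        have h2 := hm a (Multiset.mem_cons_self a m)
        rw [Multiset.map_cons, Multiset.sum_cons]
        rcases Nat.eq_zero_or_pos (Multiset.card m) with h0 | h0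
        · rw [Multiset.card_eq_zero.mp h0]; simpa using h2
        · have := ih (fun b hb => hm b (Multiset.mem_cons_of_mem hb)) h0
          linarith
    exact hpos _ hroot (by omega)
  have c1 : H.coeff (k - 1) = ((k - 1 + (n - k)).choose (n - k) : ℝ) * sg 1 D := by
    rw [hH, Polynomial.hasseDeriv_coeff, ← charpoly_neg_coeff (k := 1) (by omega)]
    congr 2
    omega
  have c2 : 0 < H.coeff k := by
    rw [hH, Polynomial.hasseDeriv_coeff]
    have : k + (n - k) = n := by omega
    rw [this]
    have h2 : (-D).charpoly.coeff n = 1 := by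
      have := Matrix.charpoly_monic (-D)
      rw [Polynomial.Monic, Polynomial.leadingCoeff, Matrix.charpoly_natDegree_eq_dim] at this
      simpa using this
    rw [h2, mul_one]
    exact_mod_cast Nat.choose_pos (n := n) (k := n - k) (by omega)
  have h3 : 0 < ((k - 1 + (n - k)).choose (n - k) : ℝ) * sg 1 D := by
    rw [← c1]
    simp only [Complex.ofRealHom_eq_coe, Complex.ofReal_re] at hre
    rw [hre]
    simp only [Complex.neg_re, Complex.mul_re, Complex.ofReal_re, Complex.ofReal_im, zero_mul,
      sub_zero, hsum, Complex.neg_im, neg_zero]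
    nlinarith
  have h4 : (0:ℝ) ≤ ((k - 1 + (n - k)).choose (n - k) : ℝ) := by positivity
  by_contra h5
  have := mul_nonpos_of_nonneg_of_nonpos h4 (not_lt.mp h5)
  linarith

end HypSec
open MeasureTheory Metric Set Matrix

noncomputable section NTsec

lemma det_lin {n : ℕ} (A : Matrix (Fin n) (Fin n) ℝ) (y : ℝ) :
    (y • (1 : Matrix (Fin n) (Fin n) ℝ) + A).det =
      ∑ j ∈ Finset.range (n + 1), sg j A * y ^ (n - j) := by
  have h := Matrix.eval_charpoly (-A) y
  have h2 : (Matrix.scalar (Fin n)) y - -A = y • (1 : Matrix (Fin n) (Fin n) ℝ) + A := by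
    rw [sub_neg_eq_add, Matrix.scalar_apply, Matrix.smul_one_eq_diagonal]
  rw [h2] at h
  rw [← h, Polynomial.eval_eq_sum_range, Matrix.charpoly_natDegree_eq_dim, Fintype.card_fin,
    ← Finset.sum_range_reflect]
  refine Finset.sum_congr rfl fun j hj => ?_
  have hj' : j ≤ n := by simpa [Nat.lt_succ_iff] using hj
  rw [← charpoly_neg_coeff hj']
  simp

lemma newtonT_eq {n : ℕ} (A : Matrix (Fin n) (Fin n) ℝ) (m : ℕ) (hm : m ≤ n) :
    newtonT m A = ∑ j ∈ Finset.range (m + 1), sg j A • (-A) ^ (m - j) := by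
  induction m with
  | zero => simp [newtonT, sg_zero]
  | succ m ih =>
    rw [newtonT, ih (by omega), esymmMat_eq_sg hm, Finset.sum_range_succ _ (m + 1), Nat.sub_self,
      pow_zero, sub_eq_add_neg, add_comm (sg (m + 1) A • (1 : Matrix (Fin n) (Fin n) ℝ)),
      Finset.sum_mul, ← Finset.sum_neg_distrib]
    congr 1
    refine Finset.sum_congr rfl fun j hj => ?_
    have hj' : j ≤ m := by simpa [Nat.lt_succ_iff] using hj
    rw [show m + 1 - j = m - j + 1 by omega]
    simp [pow_succ]

lemma newtonT_top {n : ℕ} (A : Matrix (Fin n) (Fin n) ℝ) : newtonT n A = 0 := by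
  have h := Matrix.aeval_self_charpoly (-A)
  rw [Polynomial.aeval_eq_sum_range, Matrix.charpoly_natDegree_eq_dim, Fintype.card_fin,
    ← Finset.sum_range_reflect] at h
  rw [newtonT_eq A n le_rfl, ← h]
  refine Finset.sum_congr rfl fun j hj => ?_
  have hj' : j ≤ n := by simpa [Nat.lt_succ_iff] using hj
  rw [← charpoly_neg_coeff hj']
  simp

lemma newtonT_comm {n : ℕ} (A : Matrix (Fin n) (Fin n) ℝ) (m : ℕ) (hm : m ≤ n) :
    newtonT m A * A = A * newtonT m A := by
  induction m with
  | zero => simp [newtonT]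
  | succ m ih =>
    have := ih (by omega)
    simp only [newtonT]
    rw [sub_mul, mul_sub, this, mul_assoc, this]
    simp

lemma newtonT_symm {n : ℕ} (A : Matrix (Fin n) (Fin n) ℝ) (hA : A.IsSymm) (m : ℕ) (hm : m ≤ n) :
    (newtonT m A).IsSymm := by
  induction m with
  | zero => simp [newtonT]
  | succ m ih =>
    have h := ih (by omega)
    have h1 := newtonT_comm A m (by omega)
    simp only [newtonT, Matrix.IsSymm] at *
    rw [Matrix.transpose_sub, Matrix.transpose_mul, hA, h, h1]
    simp

lemma newtonT_partial {n : ℕ} (A : Matrix (Fin n) (Fin n) ℝ) (y : ℝ) (m : ℕ) (hm : m ≤ n) :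
    (∑ j ∈ Finset.range m, y ^ (n - 1 - j) • newtonT j A) *
      (y • (1 : Matrix (Fin n) (Fin n) ℝ) + A) =
    (∑ j ∈ Finset.range (m + 1), sg j A * y ^ (n - j)) • (1 : Matrix (Fin n) (Fin n) ℝ) -
      y ^ (n - m) • newtonT m A := by
  induction m with
  | zero => simp [newtonT, sg_zero]
  | succ m ih =>
    rw [Finset.sum_range_succ, add_mul, ih (by omega), Finset.sum_range_succ _ (m + 1),
      newtonT, esymmMat_eq_sg hm, show n - 1 - m = n - (m + 1) by omega,
      show n - m = n - (m + 1) + 1 by omega, pow_succ]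
    simp only [mul_add, smul_mul_assoc, mul_one, Matrix.mul_smul]
    module

lemma newtonT_adj {n : ℕ} (A : Matrix (Fin n) (Fin n) ℝ) (y : ℝ) :
    (∑ j ∈ Finset.range n, y ^ (n - 1 - j) • newtonT j A) *
      (y • (1 : Matrix (Fin n) (Fin n) ℝ) + A) =
    (y • (1 : Matrix (Fin n) (Fin n) ℝ) + A).det • (1 : Matrix (Fin n) (Fin n) ℝ) := by
  rw [newtonT_partial A y n le_rfl, newtonT_top, det_lin]
  simp

lemma hasDerivAt_sg_line {n : ℕ} (j : ℕ) (A B : Matrix (Fin n) (Fin n) ℝ) :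
    HasDerivAt (fun s : ℝ => sg j (s • B + A)) ((sgP j B A).derivative.eval 0) 0 := by
  have := (sgP j B A).hasDerivAt 0
  simpa only [sgP_eval] using this

lemma hasDerivAt_det_line {n : ℕ} (M B P : Matrix (Fin n) (Fin n) ℝ) (hM : M.det ≠ 0)
    (hP : P * M = M.det • (1 : Matrix (Fin n) (Fin n) ℝ)) :
    HasDerivAt (fun s : ℝ => (M + s • B).det) (Matrix.trace (P * B)) 0 := by
  have h1 := ((1 + (Polynomial.X : Polynomial ℝ) •
    (M⁻¹ * B).map Polynomial.C).det).hasDerivAt 0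
  rw [Matrix.derivative_det_one_add_X_smul] at h1
  have h2 := h1.const_mul M.det
  have hu : IsUnit M.det := isUnit_iff_ne_zero.mpr hM
  have hP' : P = M.det • M⁻¹ := by
    have : P * M * M⁻¹ = P := by rw [mul_assoc, Matrix.mul_nonsing_inv _ hu, mul_one]
    rw [← this, hP]; simp
  rw [hP', Matrix.smul_mul, Matrix.trace_smul, smul_eq_mul]
  refine h2.congr_of_eventuallyEq (Filter.Eventually.of_forall fun s => ?_)
  dsimp only
  rw [← Polynomial.coe_evalRingHom, RingHom.map_det, ← Matrix.det_mul]
  congr 1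
  have : (Polynomial.evalRingHom s).mapMatrix
      (1 + (Polynomial.X : Polynomial ℝ) • (M⁻¹ * B).map Polynomial.C) = 1 + s • (M⁻¹ * B) := by
    generalize M⁻¹ * B = N
    ext i j
    by_cases hij : i = j
    · subst hij; simp; ring
    · simp [hij]; ring
  rw [this, mul_add, mul_one, Matrix.mul_smul, ← mul_assoc, Matrix.mul_nonsing_inv _ hu, one_mul]

lemma coeff_compare {n : ℕ} (A : Matrix (Fin n) (Fin n) ℝ) (a b : ℕ → ℝ)
    (h : ∀ y : ℝ, (y • (1 : Matrix (Fin n) (Fin n) ℝ) + A).det ≠ 0 →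
      ∑ i ∈ Finset.range (n + 1), a i * y ^ (n - i) = ∑ i ∈ Finset.range n, b i * y ^ (n - 1 - i))
    (j : ℕ) (hj : j + 1 ≤ n) : a (j + 1) = b j := by
  set L : Polynomial ℝ := ∑ i ∈ Finset.range (n + 1),
    Polynomial.C (a i) * Polynomial.X ^ (n - i) with hL
  set Q : Polynomial ℝ := ∑ i ∈ Finset.range n,
    Polynomial.C (b i) * Polynomial.X ^ (n - 1 - i) with hQ
  have hLQ : L = Q := by
    refine Polynomial.eq_of_infinite_eval_eq L Q ?_
    have hfin : {y : ℝ | (-A).charpoly.IsRoot y}.Finite :=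
      Polynomial.finite_setOfPred_isRoot (Matrix.charpoly_monic (-A)).ne_zero
    refine (hfin.infinite_compl).mono fun y hy => ?_
    simp only [mem_compl_iff, mem_ofPred_eq, Polynomial.IsRoot.def] at hy
    rw [Matrix.eval_charpoly] at hy
    have h2 : (Matrix.scalar (Fin n)) y - -A = y • (1 : Matrix (Fin n) (Fin n) ℝ) + A := by
      rw [sub_neg_eq_add, Matrix.scalar_apply, Matrix.smul_one_eq_diagonal]
    rw [h2] at hy
    have h3 := h y hy
    simp only [mem_ofPred_eq, hL, hQ, Polynomial.eval_finsetSum, Polynomial.eval_mul,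
      Polynomial.eval_C, Polynomial.eval_pow, Polynomial.eval_X]
    exact h3
  have hc := congrArg (fun q => Polynomial.coeff q (n - 1 - j)) hLQ
  simp only [hL, hQ, Polynomial.finsetSum_coeff, Polynomial.coeff_C_mul_X_pow] at hc
  rw [Finset.sum_eq_single (j + 1), Finset.sum_eq_single j] at hc
  · simpa [show n - 1 - j = n - (j + 1) by omega] using hc
  · intro b hb hbj
    rw [if_neg]
    have := Finset.mem_range.mp hb
    omega
  · intro h; exact absurd (Finset.mem_range.mpr (by omega)) h
  · intro b hb hbj
    rw [if_neg]
    have := Finset.mem_range.mp hb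
    omega
  · intro h; exact absurd (Finset.mem_range.mpr (by omega)) h

lemma jacobi_sgP {n : ℕ} (j : ℕ) (hj : j + 1 ≤ n) (A B : Matrix (Fin n) (Fin n) ℝ) :
    (sgP (j + 1) B A).derivative.eval 0 = Matrix.trace (newtonT j A * B) := by
  refine coeff_compare A (fun i => (sgP i B A).derivative.eval 0)
    (fun i => Matrix.trace (newtonT i A * B)) ?_ j hj
  intro y hy
  have d1 := hasDerivAt_det_line _ B _ hy (newtonT_adj A y)
  have d2 : HasDerivAt (fun s : ℝ => ∑ i ∈ Finset.range (n + 1), sg i (s • B + A) * y ^ (n - i))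
      (∑ i ∈ Finset.range (n + 1), (sgP i B A).derivative.eval 0 * y ^ (n - i)) 0 :=
    HasDerivAt.fun_sum fun i _ => (hasDerivAt_sg_line i A B).mul_const _
  have e : (fun s : ℝ => (y • (1 : Matrix (Fin n) (Fin n) ℝ) + A + s • B).det) =
      (fun s : ℝ => ∑ i ∈ Finset.range (n + 1), sg i (s • B + A) * y ^ (n - i)) := by
    funext s
    rw [← det_lin, add_assoc, add_comm (s • B)]
  rw [e] at d1
  have h3 := d2.unique d1
  rw [h3, Finset.sum_mul, Matrix.trace_sum]
  refine Finset.sum_congr rfl fun i _ => ?_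
  rw [smul_mul_assoc, Matrix.trace_smul, smul_eq_mul, mul_comm]

lemma trace_newtonT {n : ℕ} (j : ℕ) (hj : j ≤ n) (A : Matrix (Fin n) (Fin n) ℝ) :
    Matrix.trace (newtonT j A) = (n - j : ℝ) * sg j A := by
  rcases Nat.eq_or_lt_of_le hj with rfl | h
  · simp [newtonT_top]
  have h1 := jacobi_sgP j h A 1
  rw [mul_one] at h1
  rw [← h1]
  have h2 := hasDerivAt_sg_line (j + 1) A 1
  have h3 : (fun s : ℝ => sg (j + 1) (s • (1 : Matrix (Fin n) (Fin n) ℝ) + A)) =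
      fun s => (Polynomial.hasseDeriv (n - (j + 1)) (-A).charpoly).eval s := by
    funext s
    rw [add_comm (s • (1 : Matrix (Fin n) (Fin n) ℝ)), sg_add_scalar h]
  rw [h3] at h2
  rw [h2.unique (Polynomial.hasDerivAt _ 0), ← Polynomial.coeff_zero_eq_eval_zero,
    Polynomial.coeff_derivative, Polynomial.hasseDeriv_coeff, ← charpoly_neg_coeff hj]
  rw [show 0 + 1 + (n - (j + 1)) = n - j by omega, show n - j = n - (j + 1) + 1 by omega,
    Nat.choose_succ_self_right, show n - (j + 1) + 1 = n - j by omega, Nat.cast_sub hj]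
  simp

lemma trace_newtonT_mul {n : ℕ} (j : ℕ) (hj : j + 1 ≤ n) (A : Matrix (Fin n) (Fin n) ℝ) :
    Matrix.trace (newtonT j A * A) = (j + 1 : ℝ) * sg (j + 1) A := by
  have h := trace_newtonT (j + 1) hj A
  rw [newtonT, Matrix.trace_sub, Matrix.trace_smul, Matrix.trace_one, esymmMat_eq_sg hj] at h
  simp at h
  linarith

end NTsec
open MeasureTheory Metric Set Matrix

noncomputable section NT2sec

lemma sg_one_eq_trace {n : ℕ} (hn : 1 ≤ n) (A : Matrix (Fin n) (Fin n) ℝ) :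
    sg 1 A = Matrix.trace A := by
  have := trace_newtonT_mul 0 hn A
  simp [newtonT] at this
  exact this.symm

lemma det_rank_one {n : ℕ} (M P : Matrix (Fin n) (Fin n) ℝ) (hM : M.det ≠ 0)
    (hP : P * M = M.det • (1 : Matrix (Fin n) (Fin n) ℝ)) (t : ℝ) (ξ : Fin n → ℝ) :
    (M + t • Matrix.vecMulVec ξ ξ).det = M.det + t * (ξ ⬝ᵥ (P *ᵥ ξ)) := by
  have hu : IsUnit M.det := isUnit_iff_ne_zero.mpr hM
  have hP' : P = M.det • M⁻¹ := by
    have : P * M * M⁻¹ = P := by rw [mul_assoc, Matrix.mul_nonsing_inv _ hu, mul_one]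
    rw [← this, hP]; simp
  have h1 : M + t • Matrix.vecMulVec ξ ξ =
      M * (1 + Matrix.replicateCol Unit (t • M⁻¹ *ᵥ ξ) * Matrix.replicateRow Unit ξ) := by
    rw [← Matrix.vecMulVec_eq, mul_add, mul_one, Matrix.mul_vecMulVec,
      Matrix.mulVec_smul, Matrix.mulVec_mulVec, Matrix.mul_nonsing_inv _ hu, Matrix.one_mulVec,
      Matrix.smul_vecMulVec]
  rw [h1, Matrix.det_mul, Matrix.det_one_add_replicateCol_mul_replicateRow, hP', Matrix.smul_mulVec,
    dotProduct_smul, dotProduct_smul, smul_eq_mul, smul_eq_mul]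
  ring

lemma sg_rank_one {n : ℕ} (j : ℕ) (hj : j + 1 ≤ n) (A : Matrix (Fin n) (Fin n) ℝ) (t : ℝ)
    (ξ : Fin n → ℝ) :
    sg (j + 1) (A + t • Matrix.vecMulVec ξ ξ) =
      sg (j + 1) A + t * (ξ ⬝ᵥ (newtonT j A *ᵥ ξ)) := by
  have := coeff_compare A (fun i => sg i (A + t • Matrix.vecMulVec ξ ξ) - sg i A)
    (fun i => t * (ξ ⬝ᵥ (newtonT i A *ᵥ ξ))) ?_ j hj
  · linarith
  intro y hy
  have h1 := det_rank_one _ _ hy (newtonT_adj A y) t ξ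
  rw [add_assoc, det_lin, det_lin] at h1
  simp only [sub_mul]
  rw [Finset.sum_sub_distrib, h1, add_sub_cancel_left, Matrix.sum_mulVec, dotProduct_sum,
    Finset.mul_sum]
  refine Finset.sum_congr rfl fun i _ => ?_
  rw [Matrix.smul_mulVec, dotProduct_smul, smul_eq_mul]
  ring

lemma HCone.sg_one_pos {n k : ℕ} (hk : k ≤ n) (hk1 : 1 ≤ k) {A : Matrix (Fin n) (Fin n) ℝ}
    (hA : HCone k A) : 0 < sg 1 A := by
  have := sg_one_pos_of_segment hk hk1 (A + 0)
    (sg_segment hk A 0 hA (by simp) (fun s _ => by simpa using hA.pos.ne'))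
  simpa using this

lemma newton_lower {n k : ℕ} (hk : k ≤ n) (hk1 : 1 ≤ k) {A : Matrix (Fin n) (Fin n) ℝ}
    (hA : HCone k A) (ξ : Fin n → ℝ) :
    normSq ξ * sg k A ≤ sg 1 A * (ξ ⬝ᵥ (newtonT (k - 1) A *ᵥ ξ)) := by
  have hs1 := hA.sg_one_pos hk hk1
  have hsk := hA.pos
  obtain ⟨j, rfl⟩ : ∃ j, k = j + 1 := ⟨k - 1, by omega⟩
  simp only [Nat.add_sub_cancel]
  set q := ξ ⬝ᵥ (newtonT j A *ᵥ ξ) with hq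
  by_contra hcon
  push Not at hcon
  have hN0 : 0 ≤ normSq ξ := Finset.sum_nonneg fun i _ => sq_nonneg _
  have hN : 0 < normSq ξ := by
    rcases hN0.lt_or_eq with h | h
    · exact h
    · exfalso
      have hz : ξ = 0 := by
        funext i
        have := (Finset.sum_eq_zero_iff_of_nonneg (fun i _ => sq_nonneg (ξ i))).mp h.symm i
          (Finset.mem_univ i)
        simpa using this
      rw [hz] at hcon hq
      simp [hq, hz, normSq] at hcon
  set E : Matrix (Fin n) (Fin n) ℝ := (-(sg 1 A / normSq ξ)) • Matrix.vecMulVec ξ ξ with hE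
  have hEs : E.IsSymm := by
    rw [hE]; apply Matrix.IsSymm.smul
    ext i l; simp [Matrix.vecMulVec_apply, mul_comm]
  have hc' : sg 1 A / normSq ξ * q < sg (j + 1) A := by
    rw [div_mul_eq_mul_div, div_lt_iff₀ hN]; linarith
  have hseg : ∀ s ∈ Icc (0:ℝ) 1, sg (j + 1) (A + s • E) ≠ 0 := by
    intro s hs
    rw [hE, smul_smul, sg_rank_one j hk, ← hq]
    have : s * (sg 1 A / normSq ξ * q) < sg (j + 1) A := by
      rcases le_or_gt 0 (sg 1 A / normSq ξ * q) with h | h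
      · nlinarith [hs.1, hs.2]
      · nlinarith [hs.1, hs.2]
    nlinarith
  have h1 := sg_one_pos_of_segment hk hk1 (A + E) (sg_segment hk A E hA hEs hseg)
  have hn1 : 1 ≤ n := by omega
  rw [sg_one_eq_trace hn1, Matrix.trace_add, hE, Matrix.trace_smul, Matrix.trace_vecMulVec,
    ← sg_one_eq_trace hn1] at h1
  have : ξ ⬝ᵥ ξ = normSq ξ := by simp [dotProduct, normSq, sq]
  rw [this, smul_eq_mul] at h1
  field_simp at h1
  simp at h1

lemma newton_bound (n : ℕ) (j : ℕ) (hj : j ≤ n) : ∃ C : ℝ, 0 ≤ C ∧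
    ∀ (A : Matrix (Fin n) (Fin n) ℝ) (τ : ℝ), 0 ≤ τ → (∀ i l, |A i l| ≤ τ) →
      ∀ i l, |newtonT j A i l| ≤ C * τ ^ j := by
  induction j with
  | zero =>
    refine ⟨1, zero_le_one, fun A τ _ _ i l => ?_⟩
    by_cases h : i = l
    · subst h; simp [newtonT]
    · simp [newtonT, Matrix.one_apply_ne h]
  | succ j ih =>
    obtain ⟨C, hC0, hC⟩ := ih (by omega)
    refine ⟨n * (n * C) + n * C, by positivity, fun A τ hτ hA i l => ?_⟩
    have h1 : ∀ i l, |(newtonT j A * A) i l| ≤ n * C * τ ^ (j + 1) := by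
      intro i l
      rw [Matrix.mul_apply]
      refine (Finset.abs_sum_le_sum_abs _ _).trans ?_
      refine (Finset.sum_le_card_nsmul _ _ (C * τ ^ j * τ) fun m _ => ?_).trans ?_
      · rw [abs_mul]
        exact mul_le_mul (hC A τ hτ hA i m) (hA m l) (abs_nonneg _) (by positivity)
      · simp; apply le_of_eq; ring
    have h2 : |sg (j + 1) A| ≤ n * (n * C) * τ ^ (j + 1) := by
      have h3 := trace_newtonT_mul j hj A
      have h4 : |Matrix.trace (newtonT j A * A)| ≤ n * (n * C) * τ ^ (j + 1) := by
        rw [Matrix.trace]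
        refine (Finset.abs_sum_le_sum_abs _ _).trans ?_
        refine (Finset.sum_le_card_nsmul _ _ (n * C * τ ^ (j + 1)) fun m _ => h1 m m).trans ?_
        simp; apply le_of_eq; ring
      rw [h3, abs_mul] at h4
      have : (1:ℝ) ≤ |(j + 1 : ℝ)| := by
        rw [abs_of_nonneg (by positivity)]; linarith [Nat.cast_nonneg (α := ℝ) j]
      nlinarith [abs_nonneg (sg (j + 1) A)]
    rw [newtonT, esymmMat_eq_sg hj, Matrix.sub_apply, add_mul]
    refine (abs_sub _ _).trans (add_le_add ?_ (h1 i l))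
    refine le_trans ?_ h2
    by_cases h : i = l
    · simp [h]
    · simp [h]

lemma gamma_entry {n : ℕ} (hn : 2 ≤ n) (A : Matrix (Fin n) (Fin n) ℝ) (hA : A.IsSymm)
    (h1 : 0 < sg 1 A) (h2 : 0 < sg 2 A) : ∑ i, ∑ l, A i l ^ 2 ≤ sg 1 A ^ 2 := by
  have h := trace_newtonT_mul 1 hn A
  rw [newtonT, newtonT, esymmMat_eq_sg (by omega), sub_mul, Matrix.trace_sub, smul_mul_assoc,
    one_mul, Matrix.trace_smul, ← sg_one_eq_trace (by omega), smul_eq_mul] at h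
  have e : Matrix.trace (A * A) = ∑ i, ∑ l, A i l ^ 2 := by
    rw [Matrix.trace]
    refine Finset.sum_congr rfl fun i _ => ?_
    rw [Matrix.diag_apply, Matrix.mul_apply]
    refine Finset.sum_congr rfl fun l _ => ?_
    rw [hA.apply i l, sq]
  rw [← e]
  norm_num at h
  nlinarith

lemma gamma_entry' {n : ℕ} (hn : 2 ≤ n) (A : Matrix (Fin n) (Fin n) ℝ) (hA : A.IsSymm)
    (h1 : 0 < sg 1 A) (h2 : 0 < sg 2 A) (i l : Fin n) : |A i l| ≤ sg 1 A := by
  have h := gamma_entry hn A hA h1 h2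
  refine abs_le_of_sq_le_sq ?_ h1.le
  refine le_trans ?_ h
  refine le_trans ?_ (Finset.single_le_sum (f := fun i => ∑ l, A i l ^ 2)
    (fun i _ => Finset.sum_nonneg fun l _ => sq_nonneg _) (Finset.mem_univ i))
  exact Finset.single_le_sum (f := fun l => A i l ^ 2) (fun l _ => sq_nonneg _) (Finset.mem_univ l)

/-- cone membership from `GammaPlus`. -/
lemma hcone_of_gamma {n k : ℕ} (hk : k ≤ n) {A : Matrix (Fin n) (Fin n) ℝ} (hs : A.IsSymm)
    (hA : GammaPlus k A) : HCone k A :=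
  ⟨hs, fun z hz => sg_pos_of_gamma hk A
    (fun j h1 h2 => by rw [← esymmMat_eq_sg (h2.trans hk)]; exact hA j h1 h2) z hz⟩

lemma garding {n k : ℕ} (hk : k ≤ n) (hk1 : 1 ≤ k) (A B : Matrix (Fin n) (Fin n) ℝ)
    (hA : HCone k A) (hB : HCone k B) (a b : ℝ) (ha : 0 < a) (hb : 0 < b)
    (hAa : sg k A = a ^ k) (hBb : sg k B = b ^ k) :
    k * a ^ (k - 1) * b ≤ Matrix.trace (newtonT (k - 1) A * B) := by
  have h := garding_poly hk A B hA hB a b ha hb hAa hBb hk1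
  obtain ⟨j, rfl⟩ : ∃ j, k = j + 1 := ⟨k - 1, by omega⟩
  rwa [jacobi_sgP j hk] at h

end NT2sec
open MeasureTheory Metric Set Matrix

noncomputable section DIVsec

variable {n : ℕ}

lemma contDiff_sg (j : ℕ) (N : WithTop ℕ∞) :
    ContDiff ℝ N (fun m : Fin n → Fin n → ℝ => sg j (Matrix.of m)) := by
  unfold sg
  refine ContDiff.sum fun s _ => ?_
  simp only [Matrix.det_apply]
  refine ContDiff.sum fun σ _ => ?_
  refine ContDiff.const_smul _ (contDiff_prod fun i _ => ?_)
  simp only [Matrix.submatrix_apply, Matrix.of_apply]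
  fun_prop

lemma contDiff_newtonT (j : ℕ) (hj : j ≤ n) (N : WithTop ℕ∞) (a b : Fin n) :
    ContDiff ℝ N (fun m : Fin n → Fin n → ℝ => newtonT j (Matrix.of m) a b) := by
  induction j generalizing a b with
  | zero => simp only [newtonT]; fun_prop
  | succ j ih =>
    simp only [newtonT, Matrix.sub_apply, Matrix.smul_apply, smul_eq_mul, Matrix.mul_apply,
      esymmMat_eq_sg hj]
    refine ((contDiff_sg (j + 1) N).mul contDiff_const).sub (ContDiff.sum fun c _ => ?_)
    refine (ih (by omega) a c).mul ?_
    simp only [Matrix.of_apply]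
    fun_prop

lemma fderiv_sg (j : ℕ) (hj : j + 1 ≤ n) (m B : Fin n → Fin n → ℝ) :
    fderiv ℝ (fun m : Fin n → Fin n → ℝ => sg (j + 1) (Matrix.of m)) m B =
      Matrix.trace (newtonT j (Matrix.of m) * Matrix.of B) := by
  have hd : DifferentiableAt ℝ (fun m : Fin n → Fin n → ℝ => sg (j + 1) (Matrix.of m)) m :=
    (contDiff_sg (j + 1) 1).differentiable one_ne_zero m
  have h1 : HasDerivAt (fun s : ℝ => s • B + m) B 0 := by
    simpa using ((hasDerivAt_id (0:ℝ)).smul_const B).add_const m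
  have hd' : HasFDerivAt (fun m : Fin n → Fin n → ℝ => sg (j + 1) (Matrix.of m))
      (fderiv ℝ (fun m : Fin n → Fin n → ℝ => sg (j + 1) (Matrix.of m)) m) ((0:ℝ) • B + m) := by
    simpa using hd.hasFDerivAt
  have h2 := hd'.comp_hasDerivAt (0:ℝ) h1
  have h3 := hasDerivAt_sg_line (j + 1) (Matrix.of m) (Matrix.of B)
  rw [jacobi_sgP j hj] at h3
  exact h2.unique h3

/-- chain rule -/
lemma pd_sg (j : ℕ) (hj : j + 1 ≤ n) (W : (Fin n → ℝ) → Matrix (Fin n) (Fin n) ℝ) (x : Fin n → ℝ)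
    (hW : ∀ a b, DifferentiableAt ℝ (fun y => W y a b) x) (c : Fin n) :
    pd c (fun y => sg (j + 1) (W y)) x =
      ∑ a, ∑ b, newtonT j (W x) a b * pd c (fun y => W y b a) x := by
  have hW1 : HasFDerivAt (fun y => (fun a b => W y a b : Fin n → Fin n → ℝ))
      (ContinuousLinearMap.pi fun a => ContinuousLinearMap.pi fun b =>
        fderiv ℝ (fun y => W y a b) x) x := by
    refine hasFDerivAt_pi.mpr fun a => hasFDerivAt_pi.mpr fun b => (hW a b).hasFDerivAt
  have hd : DifferentiableAt ℝ (fun m : Fin n → Fin n → ℝ => sg (j + 1) (Matrix.of m))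
      (fun a b => W x a b) :=
    (contDiff_sg (j + 1) 1).differentiable one_ne_zero _
  have h := hd.hasFDerivAt.comp x hW1
  have h' : HasFDerivAt (fun y => sg (j + 1) (W y)) _ x := h
  rw [pd, h'.fderiv, ContinuousLinearMap.comp_apply, fderiv_sg j hj, Matrix.trace]
  refine Finset.sum_congr rfl fun a _ => ?_
  rw [Matrix.diag_apply, Matrix.mul_apply]
  rfl

lemma differentiableAt_newtonT (j : ℕ) (hj : j ≤ n) (W : (Fin n → ℝ) → Matrix (Fin n) (Fin n) ℝ)
    (x : Fin n → ℝ) (hW : ∀ a b, DifferentiableAt ℝ (fun y => W y a b) x) (a b : Fin n) :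
    DifferentiableAt ℝ (fun y => newtonT j (W y) a b) x := by
  have hW1 : DifferentiableAt ℝ (fun y => (fun a b => W y a b : Fin n → Fin n → ℝ)) x :=
    differentiableAt_pi.mpr fun a => differentiableAt_pi.mpr fun b => hW a b
  exact ((contDiff_newtonT j hj 1 a b).differentiable one_ne_zero _).comp x hW1

lemma contDiff_newtonT_comp (j : ℕ) (hj : j ≤ n) (N : WithTop ℕ∞)
    (W : (Fin n → ℝ) → Matrix (Fin n) (Fin n) ℝ)
    (hW : ∀ a b, ContDiff ℝ N (fun y => W y a b)) (a b : Fin n) :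
    ContDiff ℝ N (fun y => newtonT j (W y) a b) := by
  have hW1 : ContDiff ℝ N (fun y => (fun a b => W y a b : Fin n → Fin n → ℝ)) :=
    contDiff_pi.mpr fun a => contDiff_pi.mpr fun b => hW a b
  exact (contDiff_newtonT j hj N a b).comp hW1

lemma differentiableAt_sg (j : ℕ) (W : (Fin n → ℝ) → Matrix (Fin n) (Fin n) ℝ)
    (x : Fin n → ℝ) (hW : ∀ a b, DifferentiableAt ℝ (fun y => W y a b) x) :
    DifferentiableAt ℝ (fun y => sg j (W y)) x := by
  have hW1 : DifferentiableAt ℝ (fun y => (fun a b => W y a b : Fin n → Fin n → ℝ)) x :=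
    differentiableAt_pi.mpr fun a => differentiableAt_pi.mpr fun b => hW a b
  exact ((contDiff_sg j 1).differentiable one_ne_zero _).comp x hW1

lemma pd_newtonT_succ (j : ℕ) (hj : j + 1 ≤ n) (W : (Fin n → ℝ) → Matrix (Fin n) (Fin n) ℝ)
    (x : Fin n → ℝ) (hW : ∀ a b, DifferentiableAt ℝ (fun y => W y a b) x) (a c d : Fin n) :
    pd d (fun y => newtonT (j + 1) (W y) a c) x =
      (if a = c then pd d (fun y => sg (j + 1) (W y)) x else 0)
      - ∑ b, (pd d (fun y => newtonT j (W y) a b) x * W x b c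
          + newtonT j (W x) a b * pd d (fun y => W y b c) x) := by
  have h1 : (fun y => newtonT (j + 1) (W y) a c) = fun y =>
      sg (j + 1) (W y) * (1 : Matrix (Fin n) (Fin n) ℝ) a c
        - ∑ b, newtonT j (W y) a b * W y b c := by
    funext y
    simp only [newtonT, Matrix.sub_apply, Matrix.smul_apply, smul_eq_mul, Matrix.mul_apply,
      esymmMat_eq_sg hj]
  have hs := (differentiableAt_sg (j + 1) W x hW).hasFDerivAt.mul_const
    ((1 : Matrix (Fin n) (Fin n) ℝ) a c)
  have hT : ∀ b, HasFDerivAt (fun y => newtonT j (W y) a b * W y b c) _ x := fun b =>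
    (differentiableAt_newtonT j (by omega) W x hW a b).hasFDerivAt.mul (hW b c).hasFDerivAt
  have h2 := hs.sub (HasFDerivAt.fun_sum (u := Finset.univ) fun b _ => hT b)
  rw [pd, h1]
  erw [h2.fderiv]
  simp only [_root_.sub_apply, _root_.sum_apply,
    _root_.add_apply, _root_.smul_apply, smul_eq_mul, pd]
  congr 1
  · by_cases h : a = c
    · subst h; simp
    · simp [h, Matrix.one_apply_ne h]
  · refine Finset.sum_congr rfl fun b _ => by ring

lemma div_newton (W : (Fin n → ℝ) → Matrix (Fin n) (Fin n) ℝ) (s : (Fin n → ℝ) → ℝ)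
    (x : Fin n → ℝ) (hW : ∀ a b, DifferentiableAt ℝ (fun y => W y a b) x)
    (hsym : (W x).IsSymm)
    (hcod : ∀ a b c, pd a (fun y => W y b c) x - pd c (fun y => W y b a) x =
      (if b = c then pd a s x else 0) - (if b = a then pd c s x else 0))
    (j : ℕ) (hj : j + 1 ≤ n) :
    ∀ c, ∑ a, pd a (fun y => newtonT (j + 1) (W y) a c) x =
      (n - (j + 1) : ℝ) * ∑ b, newtonT j (W x) c b * pd b s x := by
  have step : ∀ j, j + 1 ≤ n →
      (∀ c, ∑ a, ∑ b, pd a (fun y => newtonT j (W y) a b) x * W x b c =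
        (n - j : ℝ) * (sg j (W x) * pd c s x - ∑ b, newtonT j (W x) c b * pd b s x)) →
      ∀ c, ∑ a, pd a (fun y => newtonT (j + 1) (W y) a c) x =
        (n - (j + 1) : ℝ) * ∑ b, newtonT j (W x) c b * pd b s x := by
    intro j hj ih c
    have hT := newtonT_symm (W x) hsym j (by omega)
    have h1 : ∑ a, pd a (fun y => newtonT (j + 1) (W y) a c) x =
        ∑ a, (if a = c then pd a (fun y => sg (j + 1) (W y)) x else 0)
        - ∑ a, ∑ b, pd a (fun y => newtonT j (W y) a b) x * W x b c
        - ∑ a, ∑ b, newtonT j (W x) a b * pd a (fun y => W y b c) x := by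
      rw [← Finset.sum_sub_distrib, ← Finset.sum_sub_distrib]
      refine Finset.sum_congr rfl fun a _ => ?_
      rw [pd_newtonT_succ j hj W x hW, Finset.sum_add_distrib]
      ring
    rw [h1, ih c, Finset.sum_ite_eq' Finset.univ c, if_pos (Finset.mem_univ _), pd_sg j hj W x hW c]
    have h2 : ∑ a, ∑ b, newtonT j (W x) a b * pd a (fun y => W y b c) x =
        ∑ a, ∑ b, newtonT j (W x) a b * pd c (fun y => W y b a) x +
          (∑ b, newtonT j (W x) c b * pd b s x - Matrix.trace (newtonT j (W x)) * pd c s x) := by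
      have e1 : ∀ a b, newtonT j (W x) a b * pd a (fun y => W y b c) x =
          newtonT j (W x) a b * pd c (fun y => W y b a) x +
          ((if b = c then newtonT j (W x) a b * pd a s x else 0) -
            (if b = a then newtonT j (W x) a b * pd c s x else 0)) := by
        intro a b
        have := hcod a b c
        have h3 : pd a (fun y => W y b c) x = pd c (fun y => W y b a) x +
          ((if b = c then pd a s x else 0) - (if b = a then pd c s x else 0)) := by linarith
        rw [h3]
        split_ifs <;> ring
      simp only [e1, Finset.sum_add_distrib, Finset.sum_sub_distrib, Finset.sum_ite_eq',
        Finset.mem_univ, if_true]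
      congr 2
      · refine Finset.sum_congr rfl fun b _ => ?_
        rw [hT.apply]
      · rw [Matrix.trace, Finset.sum_mul]; rfl
    rw [h2, trace_newtonT j (by omega)]
    ring
  have hP : ∀ j, j + 1 ≤ n →
      (∀ c, ∑ a, ∑ b, pd a (fun y => newtonT j (W y) a b) x * W x b c =
        (n - j : ℝ) * (sg j (W x) * pd c s x - ∑ b, newtonT j (W x) c b * pd b s x)) := by
    intro j
    induction j with
    | zero =>
      intro _ c
      have : ∀ a b, pd a (fun y => newtonT 0 (W y) a b) x = 0 := by
        intro a b; simp [newtonT, pd]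
      simp only [this, zero_mul, Finset.sum_const_zero]
      simp [sg_zero, newtonT, Matrix.one_apply]
    | succ j ih =>
      intro hj c
      have h1 := step j (by omega) (ih (by omega))
      rw [Finset.sum_comm]
      simp only [← Finset.sum_mul, h1]
      push_cast
      simp only [mul_assoc]
      rw [← Finset.mul_sum]
      congr 1
      have h3 : ∀ b, newtonT (j + 1) (W x) c b = sg (j + 1) (W x) * (if c = b then 1 else 0) -
          ∑ d, W x d c * newtonT j (W x) d b := by
        intro b
        rw [newtonT, newtonT_comm _ _ (by omega), esymmMat_eq_sg (by omega)]
        simp only [Matrix.sub_apply, Matrix.smul_apply, smul_eq_mul, Matrix.mul_apply,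
          Matrix.one_apply]
        congr 1
        refine Finset.sum_congr rfl fun d _ => ?_
        rw [hsym.apply]
      simp only [h3, sub_mul, Finset.sum_sub_distrib, mul_assoc, ite_mul, one_mul, zero_mul,
        mul_ite, mul_zero, Finset.sum_ite_eq, Finset.mem_univ, if_true, sub_sub_cancel]
      simp only [Finset.sum_mul]
      rw [Finset.sum_comm]
      refine Finset.sum_congr rfl fun b _ => Finset.sum_congr rfl fun d _ => ?_
      ring
  exact step j hj (hP j hj)

end DIVsec
open MeasureTheory Metric Set Matrix

noncomputable section DIV2sec

variable {n : ℕ}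

lemma contDiff_pd {v : (Fin n → ℝ) → ℝ} {N M : WithTop ℕ∞} (hv : ContDiff ℝ M v) (h : N + 1 ≤ M)
    (i : Fin n) : ContDiff ℝ N (pd i v) := by
  have := hv.fderiv_right h
  exact this.clm_apply contDiff_const

lemma continuous_pd {v : (Fin n → ℝ) → ℝ} (hv : ContDiff ℝ 1 v) (i : Fin n) :
    Continuous (pd i v) :=
  (contDiff_pd (N := 0) hv (by norm_num) i).continuous

lemma pd_pd_eq {v : (Fin n → ℝ) → ℝ} {x : Fin n → ℝ} (hv : ContDiffAt ℝ 2 v x) (i j : Fin n) :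
    pd i (pd j v) x = fderiv ℝ (fderiv ℝ v) x (Pi.single i 1) (Pi.single j 1) := by
  have h1 : DifferentiableAt ℝ (fderiv ℝ v) x :=
    (hv.fderiv_right (m := 1) (by norm_num)).differentiableAt one_ne_zero
  have h2 : HasFDerivAt (pd j v)
      ((ContinuousLinearMap.apply ℝ ℝ (Pi.single j (1:ℝ) : Fin n → ℝ)).comp
        (fderiv ℝ (fderiv ℝ v) x)) x :=
    (ContinuousLinearMap.hasFDerivAt
      (ContinuousLinearMap.apply ℝ ℝ (Pi.single j (1:ℝ) : Fin n → ℝ))).comp x h1.hasFDerivAt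
  rw [pd, h2.fderiv]
  rfl

lemma pd_pd_comm {v : (Fin n → ℝ) → ℝ} {x : Fin n → ℝ} (hv : ContDiffAt ℝ 2 v x) (i j : Fin n) :
    pd i (pd j v) x = pd j (pd i v) x := by
  rw [pd_pd_eq hv, pd_pd_eq hv]
  exact hv.isSymmSndFDerivAt (by simp) _ _

lemma hess_symm {v : (Fin n → ℝ) → ℝ} {x : Fin n → ℝ} (hv : ContDiffAt ℝ 2 v x) :
    (hess v x).IsSymm := by
  ext i j
  simp only [hess, Matrix.transpose_apply, Matrix.of_apply]
  exact pd_pd_comm hv j i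

lemma compact_pd {g : (Fin n → ℝ) → ℝ} (hg : HasCompactSupport g) (i : Fin n) :
    HasCompactSupport (pd i g) := hg.fderiv_apply (𝕜 := ℝ) _

lemma ibp {f g : (Fin n → ℝ) → ℝ} (hf : ContDiff ℝ 1 f) (hg : ContDiff ℝ 1 g)
    (hgc : HasCompactSupport g) (i : Fin n) :
    ∫ x, f x * pd i g x = - ∫ x, pd i f x * g x := by
  refine integral_mul_fderiv_eq_neg_fderiv_mul_of_integrable ?_ ?_ ?_
    (fun x _ => hf.differentiable one_ne_zero x) (fun x _ => hg.differentiable one_ne_zero x)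
  · exact ((continuous_pd hf i).mul hg.continuous).integrable_of_hasCompactSupport hgc.mul_left
  · exact (hf.continuous.mul (continuous_pd hg i)).integrable_of_hasCompactSupport
      (compact_pd hgc i).mul_left
  · exact (hf.continuous.mul hg.continuous).integrable_of_hasCompactSupport hgc.mul_left

lemma div_smooth (v s : (Fin n → ℝ) → ℝ) (hv : ContDiff ℝ 3 v) (hs : ContDiff ℝ 1 s)
    (ψ : Fin n → (Fin n → ℝ) → ℝ) (hψ : ∀ b, ContDiff ℝ 1 (ψ b))
    (hψc : ∀ b, HasCompactSupport (ψ b)) (j : ℕ) (hj : j + 1 ≤ n) :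
    ∑ b, ∑ a, ∫ x, newtonT (j + 1) (hess v x + s x • (1 : Matrix (Fin n) (Fin n) ℝ)) a b *
        pd a (ψ b) x =
      - (n - (j + 1) : ℝ) * ∑ b, ∑ a, ∫ x,
        newtonT j (hess v x + s x • (1 : Matrix (Fin n) (Fin n) ℝ)) b a * (pd a s x * ψ b x) := by
  set W : (Fin n → ℝ) → Matrix (Fin n) (Fin n) ℝ := fun x =>
    hess v x + s x • (1 : Matrix (Fin n) (Fin n) ℝ) with hWdef
  have hv1 : ∀ i, ContDiff ℝ 2 (pd i v) := fun i => contDiff_pd hv (by norm_num) i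
  have hv2 : ∀ i l, ContDiff ℝ 1 (pd i (pd l v)) := fun i l => contDiff_pd (hv1 l) (by norm_num) i
  have hWe : ∀ a b, (fun y => W y a b) = fun y => pd a (pd b v) y + s y * (if a = b then 1 else 0) := by
    intro a b; funext y
    simp [hWdef, hess, Matrix.one_apply]
  have hW : ∀ a b, ContDiff ℝ 1 (fun y => W y a b) := by
    intro a b
    rw [hWe]
    exact (hv2 a b).add (hs.mul contDiff_const)
  have hv' : ContDiff ℝ 2 v := hv.of_le (by norm_num)
  have hpdW : ∀ a b c x, pd a (fun y => W y b c) x =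
      pd a (pd b (pd c v)) x + (if b = c then pd a s x else 0) := by
    intro a b c x
    rw [hWe, pd]
    have h1 : HasFDerivAt (pd b (pd c v)) _ x :=
      ((hv2 b c).differentiable one_ne_zero x).hasFDerivAt
    have h2 : HasFDerivAt s _ x := (hs.differentiable one_ne_zero x).hasFDerivAt
    have h3 := h1.add (h2.mul_const (if b = c then (1:ℝ) else 0))
    erw [h3.fderiv]
    by_cases h : b = c
    · simp [h, pd]
    · simp [h, pd]
  have hcod : ∀ x a b c, pd a (fun y => W y b c) x - pd c (fun y => W y b a) x =
      (if b = c then pd a s x else 0) - (if b = a then pd c s x else 0) := by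
    intro x a b c
    rw [hpdW, hpdW]
    have e1 : pd b (pd c v) = pd c (pd b v) := funext fun y => pd_pd_comm hv'.contDiffAt b c
    have e2 : pd a (pd b v) = pd b (pd a v) := funext fun y => pd_pd_comm hv'.contDiffAt a b
    rw [e1, pd_pd_comm (hv1 b).contDiffAt a c, e2]
    ring
  have hsym : ∀ x, (W x).IsSymm := fun x =>
    (hess_symm hv'.contDiffAt).add (by simp [Matrix.IsSymm])
  have hT : ∀ i, i ≤ n → ∀ a b, ContDiff ℝ 1 (fun y => newtonT i (W y) a b) := fun i hi a b =>
    contDiff_newtonT_comp i hi 1 W hW a b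
  have h1 : ∀ b, ∑ a, ∫ x, newtonT (j + 1) (W x) a b * pd a (ψ b) x =
      - (n - (j + 1) : ℝ) * ∑ a, ∫ x, newtonT j (W x) b a * (pd a s x * ψ b x) := by
    intro b
    have i1 : ∀ a, Integrable (fun x => pd a (fun y => newtonT (j + 1) (W y) a b) x * ψ b x) :=
      fun a => ((continuous_pd (hT _ hj a b) a).mul (hψ b).continuous).integrable_of_hasCompactSupport
        (hψc b).mul_left
    have i2 : ∀ a, Integrable (fun x => newtonT j (W x) b a * (pd a s x * ψ b x)) :=
      fun a => ((hT j (by omega) b a).continuous.mul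
        ((continuous_pd hs a).mul (hψ b).continuous)).integrable_of_hasCompactSupport
        (hψc b).mul_left.mul_left
    have h2 : ∀ a, ∫ x, newtonT (j + 1) (W x) a b * pd a (ψ b) x =
        - ∫ x, pd a (fun y => newtonT (j + 1) (W y) a b) x * ψ b x := fun a =>
      ibp (hT _ hj a b) (hψ b) (hψc b) a
    simp only [h2]
    rw [Finset.sum_neg_distrib, ← integral_finsetSum _ (fun a _ => i1 a),
      ← integral_finsetSum _ (fun a _ => i2 a), neg_mul, ← integral_const_mul]
    congr 1
    refine integral_congr_ae (Filter.Eventually.of_forall fun x => ?_)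
    dsimp only
    rw [← Finset.sum_mul, div_newton W s x (fun a b => (hW a b).differentiable one_ne_zero x) (hsym x)
      (hcod x) j hj b, mul_assoc, Finset.sum_mul]
    congr 1
    refine Finset.sum_congr rfl fun a _ => ?_
    ring
  rw [Finset.mul_sum]
  exact Finset.sum_congr rfl fun b _ => h1 b

open scoped Convolution in
lemma pd_conv (φ : ContDiffBump (0 : Fin n → ℝ)) {g : (Fin n → ℝ) → ℝ} (hg : ContDiff ℝ 1 g)
    (hgc : HasCompactSupport g) (i : Fin n) :
    pd i (φ.normed volume ⋆[ContinuousLinearMap.lsmul ℝ ℝ, volume] g) =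
      (φ.normed volume ⋆[ContinuousLinearMap.lsmul ℝ ℝ, volume] pd i g) := by
  funext x
  have hli : LocallyIntegrable (φ.normed (volume : Measure (Fin n → ℝ))) :=
    φ.continuous_normed.locallyIntegrable
  have h := hgc.hasFDerivAt_convolution_right (ContinuousLinearMap.lsmul ℝ ℝ) hli hg x
  rw [pd, h.fderiv]
  exact convolution_precompR_apply _ hli (hgc.fderiv (𝕜 := ℝ)) (hg.continuous_fderiv one_ne_zero) _ _

open scoped Convolution in
lemma mollify (v : (Fin n → ℝ) → ℝ) (hv : ContDiff ℝ 2 v) (hvc : HasCompactSupport v)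
    (ε : ℝ) (hε : 0 < ε) : ∃ v' : (Fin n → ℝ) → ℝ, ContDiff ℝ 3 v' ∧
      ∀ x a b, |hess v' x a b - hess v x a b| ≤ ε := by
  have hc : ∀ a b, UniformContinuous (pd a (pd b v)) := fun a b =>
    HasCompactSupport.uniformContinuous_of_continuous (compact_pd (compact_pd hvc b) a)
      (continuous_pd (contDiff_pd hv (by norm_num) b) a)
  have hδ : ∀ a b, ∃ δ > 0, ∀ x y, dist x y < δ → dist (pd a (pd b v) x) (pd a (pd b v) y) < ε :=
    fun a b => by
      obtain ⟨δ, h1, h2⟩ := Metric.uniformContinuous_iff.mp (hc a b) ε hε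
      exact ⟨δ, h1, fun x y h => h2 h⟩
  choose δ hδ0 hδ using hδ
  obtain ⟨d, hd0, hd⟩ : ∃ d > 0, ∀ a b, d ≤ δ a b := by
    have : ∀ᶠ d in nhdsWithin (0:ℝ) (Ioi 0), ∀ a b, d ≤ δ a b := by
      rw [Filter.eventually_all]; intro a
      rw [Filter.eventually_all]; intro b
      filter_upwards [Ioo_mem_nhdsGT (hδ0 a b)] with d hd using hd.2.le
    obtain ⟨d, h1, h2⟩ := (this.and self_mem_nhdsWithin).exists
    exact ⟨d, h2, h1⟩
  let φ : ContDiffBump (0 : Fin n → ℝ) := ⟨d / 2, d, by positivity, by linarith⟩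
  have hφ : ContDiff ℝ 3 (φ.normed (volume : Measure (Fin n → ℝ))) := φ.contDiff_normed
  refine ⟨(φ.normed volume ⋆[ContinuousLinearMap.lsmul ℝ ℝ, volume] v), ?_, ?_⟩
  · exact φ.hasCompactSupport_normed.contDiff_convolution_left _ hφ hv.continuous.locallyIntegrable
  · intro x a b
    simp only [hess, Matrix.of_apply]
    rw [pd_conv φ (hv.of_le (by norm_num)) hvc b,
      pd_conv φ (contDiff_pd hv (by norm_num) b) (compact_pd hvc b) a, ← Real.dist_eq]
    refine φ.dist_normed_convolution_le
      (continuous_pd (contDiff_pd hv (by norm_num) b) a).aestronglyMeasurable ?_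
    intro y hy
    exact (hδ a b y x (lt_of_lt_of_le (mem_ball.mp hy) (hd a b))).le

lemma newton_tendsto (j : ℕ) (hj : j ≤ n) (W : (Fin n → ℝ) → Matrix (Fin n) (Fin n) ℝ)
    (hW : ∀ a b, Continuous fun x => W x a b) (Wm : ℕ → (Fin n → ℝ) → Matrix (Fin n) (Fin n) ℝ)
    (hWm : ∀ m a b, Continuous fun x => Wm m x a b)
    (hd : ∀ m x a b, |Wm m x a b - W x a b| ≤ 1 / ((m : ℝ) + 1))
    (φ : (Fin n → ℝ) → ℝ) (hφ : Continuous φ) (hφc : HasCompactSupport φ) (a b : Fin n) :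
    Filter.Tendsto (fun m => ∫ x, newtonT j (Wm m x) a b * φ x) Filter.atTop
      (nhds (∫ x, newtonT j (W x) a b * φ x)) := by
  have hWpi : Continuous (fun x => (fun a b => W x a b : Fin n → Fin n → ℝ)) :=
    continuous_pi fun a => continuous_pi fun b => hW a b
  obtain ⟨K, hK⟩ := (hφc.isCompact).exists_bound_of_continuousOn hWpi.continuousOn
  obtain ⟨C, hC0, hC⟩ := newton_bound n j hj
  have hTc := (contDiff_newtonT (n := n) j hj 0 a b).continuous
  refine tendsto_integral_of_dominated_convergence (fun x => C * (|K| + 1) ^ j * |φ x|) ?_ ?_ ?_ ?_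
  · intro m
    have hWmpi : Continuous (fun x => (fun a b => Wm m x a b : Fin n → Fin n → ℝ)) :=
      continuous_pi fun a => continuous_pi fun b => hWm m a b
    exact ((hTc.comp hWmpi).mul hφ).aestronglyMeasurable
  · exact ((hφ.integrable_of_hasCompactSupport hφc).abs).const_mul _
  · intro m
    refine Filter.Eventually.of_forall fun x => ?_
    rw [norm_mul, Real.norm_eq_abs, Real.norm_eq_abs]
    by_cases hx : φ x = 0
    · simp [hx]
    · refine mul_le_mul_of_nonneg_right ?_ (abs_nonneg _)
      refine hC _ _ (by positivity) (fun i l => ?_) a b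
      have h1 := hK x (subset_tsupport _ hx)
      have h2 : |W x i l| ≤ K := ((norm_le_pi_norm (W x i) l).trans
        (norm_le_pi_norm (fun a b => W x a b : Fin n → Fin n → ℝ) i)).trans h1
      have h3 := hd m x i l
      have h4 : 1 / ((m:ℝ) + 1) ≤ 1 := by
        rw [div_le_one (by positivity)]; linarith [Nat.cast_nonneg (α := ℝ) m]
      calc |Wm m x i l| = |W x i l + (Wm m x i l - W x i l)| := by ring_nf
        _ ≤ |W x i l| + |Wm m x i l - W x i l| := abs_add_le _ _
        _ ≤ |K| + 1 := add_le_add (h2.trans (le_abs_self K)) (h3.trans h4)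
  · refine Filter.Eventually.of_forall fun x => ?_
    refine Filter.Tendsto.mul_const _ ?_
    have : Filter.Tendsto (fun m => (fun a b => Wm m x a b : Fin n → Fin n → ℝ)) Filter.atTop
        (nhds (fun a b => W x a b)) := by
      refine tendsto_pi_nhds.mpr fun i => tendsto_pi_nhds.mpr fun l => ?_
      rw [tendsto_iff_dist_tendsto_zero]
      refine squeeze_zero (fun _ => dist_nonneg) (fun m => ?_) tendsto_one_div_add_atTop_nhds_zero_nat
      rw [Real.dist_eq]; exact hd m x i l
    exact (hTc.tendsto _).comp this

lemma div_weak (v s : (Fin n → ℝ) → ℝ) (hv : ContDiff ℝ 2 v) (hvc : HasCompactSupport v)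
    (hs : ContDiff ℝ 1 s)
    (ψ : Fin n → (Fin n → ℝ) → ℝ) (hψ : ∀ b, ContDiff ℝ 1 (ψ b))
    (hψc : ∀ b, HasCompactSupport (ψ b)) (j : ℕ) (hj : j + 1 ≤ n) :
    ∑ b, ∑ a, ∫ x, newtonT (j + 1) (hess v x + s x • (1 : Matrix (Fin n) (Fin n) ℝ)) a b *
        pd a (ψ b) x =
      - (n - (j + 1) : ℝ) * ∑ b, ∑ a, ∫ x,
        newtonT j (hess v x + s x • (1 : Matrix (Fin n) (Fin n) ℝ)) b a * (pd a s x * ψ b x) := by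
  have hm := fun m : ℕ => mollify v hv hvc (1 / ((m:ℝ) + 1)) (by positivity)
  choose vm hvm hvd using hm
  have hcont : ∀ w : (Fin n → ℝ) → ℝ, ContDiff ℝ 2 w → ∀ a b, Continuous fun x =>
      (hess w x + s x • (1 : Matrix (Fin n) (Fin n) ℝ)) a b := by
    intro w hw a b
    simp only [hess, Matrix.add_apply, Matrix.of_apply, Matrix.smul_apply, smul_eq_mul]
    exact (continuous_pd (contDiff_pd hw (by norm_num) b) a).add (hs.continuous.mul continuous_const)
  have hd : ∀ (m : ℕ) x a b, |(hess (vm m) x + s x • (1 : Matrix (Fin n) (Fin n) ℝ)) a b -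
      (hess v x + s x • (1 : Matrix (Fin n) (Fin n) ℝ)) a b| ≤ 1 / ((m:ℝ) + 1) := by
    intro m x a b
    simpa [Matrix.add_apply] using hvd m x a b
  have hL := tendsto_finsetSum Finset.univ fun b _ => tendsto_finsetSum Finset.univ fun a _ =>
    newton_tendsto (j + 1) hj _ (hcont v hv) _ (fun m => hcont _ ((hvm m).of_le (by norm_num))) hd
      (pd a (ψ b)) (continuous_pd (hψ b) a) (compact_pd (hψc b) a) a b
  have hR := (tendsto_finsetSum Finset.univ fun b _ => tendsto_finsetSum Finset.univ fun a _ =>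
    newton_tendsto j (by omega) _ (hcont v hv) _ (fun m => hcont _ ((hvm m).of_le (by norm_num))) hd
      (fun x => pd a s x * ψ b x) ((continuous_pd hs a).mul (hψ b).continuous)
      (hψc b).mul_left b a).const_mul (- (n - (j + 1) : ℝ))
  refine tendsto_nhds_unique hL (hR.congr fun m => ?_)
  exact (div_smooth (vm m) s (hvm m) hs ψ hψ hψc j hj).symm

end DIV2sec
open MeasureTheory Metric Set Matrix

noncomputable section WEAKsec

variable {n : ℕ}

lemma pd_mul {f g : (Fin n → ℝ) → ℝ} {x : Fin n → ℝ} (hf : DifferentiableAt ℝ f x)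
    (hg : DifferentiableAt ℝ g x) (a : Fin n) :
    pd a (fun y => f y * g y) x = pd a f x * g x + f x * pd a g x := by
  have := hf.hasFDerivAt.mul hg.hasFDerivAt
  rw [pd]
  erw [this.fderiv]
  simp [pd]; ring

lemma pd_sum {ι : Type*} (t : Finset ι) {f : ι → (Fin n → ℝ) → ℝ} {x : Fin n → ℝ}
    (hf : ∀ i ∈ t, DifferentiableAt ℝ (f i) x) (a : Fin n) :
    pd a (fun y => ∑ i ∈ t, f i y) x = ∑ i ∈ t, pd a (f i) x := by
  have := HasFDerivAt.fun_sum (fun i hi => (hf i hi).hasFDerivAt)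
  rw [pd, this.fderiv]
  simp [pd]

lemma pd_comp {f : (Fin n → ℝ) → ℝ} {x : Fin n → ℝ} (hf : DifferentiableAt ℝ f x)
    {F : ℝ → ℝ} {F' : ℝ} (hF : HasDerivAt F F' (f x)) (a : Fin n) :
    pd a (fun y => F (f y)) x = F' * pd a f x := by
  have := hF.comp_hasFDerivAt x hf.hasFDerivAt
  rw [pd]
  erw [this.fderiv]
  simp [pd]

lemma pd_rho {U : (Fin n → ℝ) → ℝ} {x : Fin n → ℝ} (hU : DifferentiableAt ℝ U x) (h0 : 0 < U x)
    (N : ℕ) (a : Fin n) :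
    pd a (fun y => (U y ^ N)⁻¹) x = - (N * (U x ^ N)⁻¹ / U x) * pd a U x := by
  have h1 : HasDerivAt (fun t : ℝ => (t ^ N)⁻¹) _ (U x) :=
    (hasDerivAt_pow N (U x)).inv (pow_ne_zero _ h0.ne')
  rw [pd_comp hU h1]
  congr 1
  rcases N with _ | m
  · simp
  · simp only [Nat.add_sub_cancel]
    field_simp
    try ring

/-- the function `|∇U|²/(2U)`. -/
def sfun (U : (Fin n → ℝ) → ℝ) (x : Fin n → ℝ) : ℝ := normSq (grad U x) / (2 * U x)

/-- the matrix `-A_U`. -/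
def Wmat (U : (Fin n → ℝ) → ℝ) (x : Fin n → ℝ) : Matrix (Fin n) (Fin n) ℝ :=
  -(hess U x - sfun U x • (1 : Matrix (Fin n) (Fin n) ℝ))

lemma contDiff_sfun {U : (Fin n → ℝ) → ℝ} (hU : ContDiff ℝ 2 U) (h0 : ∀ x, 0 < U x) :
    ContDiff ℝ 1 (sfun U) := by
  unfold sfun normSq grad
  refine ContDiff.div ?_ (contDiff_const.mul (hU.of_le (by norm_num)))
    (fun x => by have := h0 x; positivity)
  exact ContDiff.sum fun i _ => (contDiff_pd hU (by norm_num) i).pow 2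

lemma pd_sfun {U : (Fin n → ℝ) → ℝ} (hU : ContDiff ℝ 2 U) (h0 : ∀ x, 0 < U x) (x : Fin n → ℝ)
    (a : Fin n) : pd a (sfun U) x = - (∑ b, Wmat U x a b * pd b U x) / U x := by
  have hd : ∀ b, DifferentiableAt ℝ (pd b U) x := fun b =>
    (contDiff_pd hU (N := 1) (by norm_num) b).differentiable one_ne_zero x
  have hUd : DifferentiableAt ℝ U x := hU.differentiable (by norm_num) x
  have hx := h0 x
  have e : sfun U = fun y => (∑ b, pd b U y * pd b U y) * ((1 / 2) * (U y ^ 1)⁻¹) := by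
    funext y; simp only [sfun, normSq, grad, sq, pow_one]
    have := h0 y; field_simp
  have h1 : DifferentiableAt ℝ (fun y => ∑ b, pd b U y * pd b U y) x :=
    DifferentiableAt.fun_sum fun b _ => (hd b).mul (hd b)
  have h2 : DifferentiableAt ℝ (fun y => (U y ^ 1)⁻¹) x :=
    (hUd.pow 1).inv (pow_ne_zero _ hx.ne')
  have h2' : DifferentiableAt ℝ (fun y => (1 / 2 : ℝ) * (U y ^ 1)⁻¹) x := h2.const_mul _
  have h2c : DifferentiableAt ℝ (fun _ : Fin n → ℝ => (1 / 2 : ℝ)) x := differentiableAt_const _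
  rw [e, pd_mul h1 h2', pd_sum _ (fun b _ => (hd b).fun_mul (hd b)),
    pd_mul h2c h2, pd_rho hUd hx]
  have h3 : ∀ b, pd a (fun y => pd b U y * pd b U y) x = 2 * (pd a (pd b U) x * pd b U x) := by
    intro b; rw [pd_mul (hd b) (hd b)]; ring
  have h4 : ∑ b, Wmat U x a b * pd b U x =
      - ∑ b, pd a (pd b U) x * pd b U x + sfun U x * pd a U x := by
    simp only [Wmat, Matrix.neg_apply, Matrix.sub_apply, Matrix.smul_apply, smul_eq_mul, hess,
      Matrix.of_apply, Matrix.one_apply, neg_sub, sub_mul, mul_ite, mul_one, mul_zero, ite_mul,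
      zero_mul, Finset.sum_sub_distrib, Finset.sum_ite_eq, Finset.mem_univ, if_true]
    ring
  have h5 : sfun U x = (∑ b, pd b U x * pd b U x) / (2 * U x) := by
    simp only [sfun, normSq, grad, sq]
  simp only [h3]
  rw [h4, h5, ← Finset.mul_sum]
  have : pd a (fun _ : Fin n → ℝ => (1 / 2 : ℝ)) x = 0 := by simp [pd]
  rw [this]
  field_simp
  ring

lemma Wmat_symm {U : (Fin n → ℝ) → ℝ} {x : Fin n → ℝ} (hU : ContDiffAt ℝ 2 U x) :
    (Wmat U x).IsSymm := by
  unfold Wmat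
  refine Matrix.IsSymm.neg (Matrix.IsSymm.sub (hess_symm hU) ?_)
  simp [Matrix.IsSymm]

lemma hess_one_sub (U : (Fin n → ℝ) → ℝ) (x : Fin n → ℝ) :
    hess (fun y => 1 - U y) x = - hess U x := by
  ext a b
  have h1 : pd b (fun y => 1 - U y) = fun y => - pd b U y := by
    funext y; simp only [pd]; rw [fderiv_const_sub]; rfl
  simp only [hess, Matrix.of_apply, Matrix.neg_apply, h1]
  simp only [pd]
  rw [fderiv_fun_neg]; rfl

lemma Wmat_entry_cont {U : (Fin n → ℝ) → ℝ} (hU : ContDiff ℝ 2 U) (h0 : ∀ x, 0 < U x) (a b : Fin n) :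
    Continuous fun x => Wmat U x a b := by
  simp only [Wmat, hess, Matrix.neg_apply, Matrix.sub_apply, Matrix.of_apply, Matrix.smul_apply,
    smul_eq_mul]
  exact ((continuous_pd (contDiff_pd hU (by norm_num) b) a).sub
    ((contDiff_sfun hU h0).continuous.mul continuous_const)).neg

lemma newton_W_cont {U : (Fin n → ℝ) → ℝ} (hU : ContDiff ℝ 2 U) (h0 : ∀ x, 0 < U x) (j : ℕ)
    (hj : j ≤ n) (a b : Fin n) : Continuous fun x => newtonT j (Wmat U x) a b := by
  have hWpi : Continuous (fun x => (fun a b => Wmat U x a b : Fin n → Fin n → ℝ)) :=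
    continuous_pi fun a => continuous_pi fun b => Wmat_entry_cont hU h0 a b
  exact (contDiff_newtonT (n := n) j hj 0 a b).continuous.comp hWpi

lemma lin_aux (S1 S2 S3 P q : Fin n → ℝ) (ρ ζ u N s : ℝ) :
    ∑ b, (ρ * S1 b + ρ * ζ * S2 b - ρ * (N / u) * (ζ * q b) * S3 b) -
      -N * ∑ b, ρ * (ζ * q b) * (-(1 / u) * (s * P b - S3 b)) =
    ρ * ∑ b, S1 b + ρ * (ζ * (∑ b, S2 b - N * s / u * ∑ b, P b * q b)) := by
  have e1 : ∑ b, (ρ * S1 b + ρ * ζ * S2 b - ρ * (N / u) * (ζ * q b) * S3 b) =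
      ρ * ∑ b, S1 b + ρ * ζ * ∑ b, S2 b - ρ * (N / u) * ζ * ∑ b, q b * S3 b := by
    rw [Finset.sum_sub_distrib, Finset.sum_add_distrib, Finset.mul_sum, Finset.mul_sum,
      Finset.mul_sum]
    congr 1
    exact Finset.sum_congr rfl fun b _ => by ring
  have e2 : ∑ b, ρ * (ζ * q b) * (-(1 / u) * (s * P b - S3 b)) =
      -(ρ * ζ / u * s) * ∑ b, P b * q b + ρ * ζ / u * ∑ b, q b * S3 b := by
    rw [Finset.mul_sum, Finset.mul_sum, ← Finset.sum_add_distrib]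
    exact Finset.sum_congr rfl fun b _ => by ring
  rw [e1, e2]; ring

lemma weak_id (k : ℕ) (hk2 : 2 ≤ k) (hkn : k ≤ n) {U : (Fin n → ℝ) → ℝ} (hU : ContDiff ℝ 2 U)
    (h0 : ∀ x, 0 < U x) (hUc : HasCompactSupport fun x => 1 - U x)
    {z ζ : (Fin n → ℝ) → ℝ} (hz : ContDiff ℝ 2 z) (hζ : ContDiff ℝ 1 ζ) (hζc : HasCompactSupport ζ) :
    ∫ x, (U x ^ (n - k + 1))⁻¹ *
        ∑ b, ∑ a, newtonT (k - 1) (Wmat U x) a b * (pd a ζ x * pd b z x) =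
    - ∫ x, (U x ^ (n - k + 1))⁻¹ * (ζ x *
        (∑ b, ∑ a, newtonT (k - 1) (Wmat U x) a b * pd a (pd b z) x -
          Matrix.trace (newtonT (k - 1) (Wmat U x)) / U x * ∑ b, pd b U x * pd b z x)) := by
  obtain ⟨j, rfl⟩ : ∃ j, k = j + 2 := ⟨k - 2, by omega⟩
  simp only [show j + 2 - 1 = j + 1 by omega]
  set N := n - (j + 2) + 1 with hN
  have hNr : (N : ℝ) = n - (j + 1) := by
    rw [hN, Nat.cast_add, Nat.cast_sub hkn]; push_cast; ring
  have hUd : ∀ x, DifferentiableAt ℝ U x := hU.differentiable (by norm_num)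
  have hs := contDiff_sfun hU h0
  have hρ : ContDiff ℝ 1 fun x => (U x ^ N)⁻¹ :=
    ((hU.of_le (by norm_num)).pow N).inv fun x => pow_ne_zero _ (h0 x).ne'
  have hz1 : ∀ b, ContDiff ℝ 1 (pd b z) := fun b => contDiff_pd hz (by norm_num) b
  let ψ : Fin n → (Fin n → ℝ) → ℝ := fun b x => (U x ^ N)⁻¹ * (ζ x * pd b z x)
  have hψ : ∀ b, ContDiff ℝ 1 (ψ b) := fun b => hρ.mul (hζ.mul (hz1 b))
  have hψc : ∀ b, HasCompactSupport (ψ b) := fun b => (hζc.mul_right).mul_left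
  have key := div_weak (fun y => 1 - U y) (sfun U) (contDiff_const.sub hU) hUc hs ψ hψ hψc j
    (by omega)
  have hWe : ∀ x, hess (fun y => 1 - U y) x + sfun U x • (1 : Matrix (Fin n) (Fin n) ℝ) =
      Wmat U x := by
    intro x; rw [hess_one_sub, Wmat]; abel
  simp only [hWe] at key
  have hT := newton_W_cont hU h0 (j + 1) (by omega)
  have hTj := newton_W_cont hU h0 j (by omega)
  have i1 : ∀ b a, Integrable fun x => newtonT (j + 1) (Wmat U x) a b * pd a (ψ b) x := fun b a =>
    ((hT a b).mul (continuous_pd (hψ b) a)).integrable_of_hasCompactSupport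
      (compact_pd (hψc b) a).mul_left
  have i2 : ∀ b a, Integrable fun x => newtonT j (Wmat U x) b a * (pd a (sfun U) x * ψ b x) :=
    fun b a => ((hTj b a).mul ((continuous_pd hs a).mul
      (hψ b).continuous)).integrable_of_hasCompactSupport (hψc b).mul_left.mul_left
  have s1 : ∑ b, ∑ a, ∫ x, newtonT (j + 1) (Wmat U x) a b * pd a (ψ b) x =
      ∫ x, ∑ b, ∑ a, newtonT (j + 1) (Wmat U x) a b * pd a (ψ b) x := by
    rw [integral_finsetSum _ fun b _ => integrable_finsetSum _ fun a _ => i1 b a]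
    exact Finset.sum_congr rfl fun b _ => (integral_finsetSum _ fun a _ => i1 b a).symm
  have s2 : ∑ b, ∑ a, ∫ x, newtonT j (Wmat U x) b a * (pd a (sfun U) x * ψ b x) =
      ∫ x, ∑ b, ∑ a, newtonT j (Wmat U x) b a * (pd a (sfun U) x * ψ b x) := by
    rw [integral_finsetSum _ fun b _ => integrable_finsetSum _ fun a _ => i2 b a]
    exact Finset.sum_congr rfl fun b _ => (integral_finsetSum _ fun a _ => i2 b a).symm
  rw [s1, s2, ← integral_const_mul] at key
  have i1' : Integrable fun x => ∑ b, ∑ a, newtonT (j + 1) (Wmat U x) a b * pd a (ψ b) x :=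
    integrable_finsetSum _ fun b _ => integrable_finsetSum _ fun a _ => i1 b a
  have i2' : Integrable fun x =>
      -(n - (j + 1) : ℝ) * ∑ b, ∑ a, newtonT j (Wmat U x) b a * (pd a (sfun U) x * ψ b x) :=
    (integrable_finsetSum _ fun b _ => integrable_finsetSum _ fun a _ => i2 b a).const_mul _
  have i3 : Integrable fun x => (U x ^ N)⁻¹ *
        ∑ b, ∑ a, newtonT (j + 1) (Wmat U x) a b * (pd a ζ x * pd b z x) := by
    have e : (fun x => (U x ^ N)⁻¹ *
        ∑ b, ∑ a, newtonT (j + 1) (Wmat U x) a b * (pd a ζ x * pd b z x)) = fun x =>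
        ∑ b, ∑ a, (U x ^ N)⁻¹ * (newtonT (j + 1) (Wmat U x) a b * (pd a ζ x * pd b z x)) := by
      funext x; simp only [Finset.mul_sum]
    rw [e]
    refine integrable_finsetSum _ fun b _ => integrable_finsetSum _ fun a _ => ?_
    exact (hρ.continuous.mul ((hT a b).mul
      ((continuous_pd hζ a).mul (hz1 b).continuous))).integrable_of_hasCompactSupport
      ((compact_pd hζc a).mul_right.mul_left).mul_left
  have key2 : ∫ x, ((∑ b, ∑ a, newtonT (j + 1) (Wmat U x) a b * pd a (ψ b) x) -
      (-(n - (j + 1) : ℝ) * ∑ b, ∑ a, newtonT j (Wmat U x) b a * (pd a (sfun U) x * ψ b x))) = 0 := by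
    rw [integral_sub i1' i2', key, sub_self]
  have pt : ∀ x, (∑ b, ∑ a, newtonT (j + 1) (Wmat U x) a b * pd a (ψ b) x) -
      (-(n - (j + 1) : ℝ) * ∑ b, ∑ a, newtonT j (Wmat U x) b a * (pd a (sfun U) x * ψ b x)) =
      (U x ^ N)⁻¹ * ∑ b, ∑ a, newtonT (j + 1) (Wmat U x) a b * (pd a ζ x * pd b z x) +
      (U x ^ N)⁻¹ * (ζ x *
        (∑ b, ∑ a, newtonT (j + 1) (Wmat U x) a b * pd a (pd b z) x -
          Matrix.trace (newtonT (j + 1) (Wmat U x)) / U x * ∑ b, pd b U x * pd b z x)) := by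
    intro x
    have hx := h0 x
    have p1 : ∀ a b, pd a (ψ b) x = (U x ^ N)⁻¹ * (pd a ζ x * pd b z x + ζ x * pd a (pd b z) x
        - N / U x * pd a U x * (ζ x * pd b z x)) := by
      intro a b
      have d1 : DifferentiableAt ℝ ζ x := hζ.differentiable one_ne_zero x
      have d2 : DifferentiableAt ℝ (pd b z) x := (hz1 b).differentiable one_ne_zero x
      have d3 : DifferentiableAt ℝ (fun y => ζ y * pd b z y) x := d1.fun_mul d2
      show pd a (fun y => (U y ^ N)⁻¹ * (ζ y * pd b z y)) x = _
      rw [pd_mul (hρ.differentiable one_ne_zero x) d3, pd_rho (hUd x) hx, pd_mul d1 d2]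
      ring
    have p2 : ∀ b, ∑ a, newtonT j (Wmat U x) b a * (pd a (sfun U) x * ψ b x) =
        (U x ^ N)⁻¹ * (ζ x * pd b z x) * (- (1 / U x) *
          (sg (j + 1) (Wmat U x) * pd b U x -
            ∑ a, newtonT (j + 1) (Wmat U x) a b * pd a U x)) := by
      intro b
      have q1 : ∑ a, newtonT j (Wmat U x) b a * pd a (sfun U) x =
          - (1 / U x) * ∑ c, (newtonT j (Wmat U x) * Wmat U x) b c * pd c U x := by
        simp only [pd_sfun hU h0, Matrix.mul_apply, Finset.sum_mul, Finset.mul_sum]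
        rw [Finset.sum_comm]
        refine Finset.sum_congr rfl fun a _ => ?_
        rw [← Finset.sum_neg_distrib, Finset.sum_div, Finset.mul_sum]
        refine Finset.sum_congr rfl fun c _ => ?_
        ring
      have q2 : ∀ c, (newtonT j (Wmat U x) * Wmat U x) b c =
          sg (j + 1) (Wmat U x) * (if b = c then 1 else 0) - newtonT (j + 1) (Wmat U x) c b := by
        intro c
        have hsy : newtonT (j + 1) (Wmat U x) c b = newtonT (j + 1) (Wmat U x) b c :=
          (newtonT_symm _ (Wmat_symm hU.contDiffAt) (j + 1) (by omega)).apply b c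
        rw [hsy, newtonT, esymmMat_eq_sg (by omega)]
        simp only [Matrix.sub_apply, Matrix.smul_apply, smul_eq_mul, Matrix.one_apply]
        ring
      have q3 : ∑ a, newtonT j (Wmat U x) b a * (pd a (sfun U) x * ψ b x) =
          (∑ a, newtonT j (Wmat U x) b a * pd a (sfun U) x) * ψ b x := by
        rw [Finset.sum_mul]; exact Finset.sum_congr rfl fun a _ => by ring
      rw [q3, q1]
      simp only [q2, sub_mul, Finset.sum_sub_distrib, mul_ite, mul_one, mul_zero, ite_mul, zero_mul,
        Finset.sum_ite_eq, Finset.mem_univ, if_true]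
      simp only [ψ]
      ring
    rw [trace_newtonT (j + 1) (by omega)]
    push_cast
    simp only [p2, p1, ← hNr]
    have e1 : ∀ b, ∑ a, newtonT (j + 1) (Wmat U x) a b * ((U x ^ N)⁻¹ * (pd a ζ x * pd b z x
        + ζ x * pd a (pd b z) x - N / U x * pd a U x * (ζ x * pd b z x))) =
        (U x ^ N)⁻¹ * ∑ a, newtonT (j + 1) (Wmat U x) a b * (pd a ζ x * pd b z x) +
        (U x ^ N)⁻¹ * ζ x * ∑ a, newtonT (j + 1) (Wmat U x) a b * pd a (pd b z) x -
        (U x ^ N)⁻¹ * (N / U x) * (ζ x * pd b z x) *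
          ∑ a, newtonT (j + 1) (Wmat U x) a b * pd a U x := by
      intro b
      simp only [Finset.mul_sum, ← Finset.sum_add_distrib, ← Finset.sum_sub_distrib]
      exact Finset.sum_congr rfl fun a _ => by ring
    simp only [e1]
    refine lin_aux _ _ _ _ _ _ _ _ _ _
  simp only [pt] at key2
  have i4 : Integrable fun x => (U x ^ N)⁻¹ * (ζ x *
        (∑ b, ∑ a, newtonT (j + 1) (Wmat U x) a b * pd a (pd b z) x -
          Matrix.trace (newtonT (j + 1) (Wmat U x)) / U x * ∑ b, pd b U x * pd b z x)) := by
    have := (i1'.sub i2').sub i3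
    refine this.congr (Filter.Eventually.of_forall fun x => ?_)
    have := pt x
    simp only [Pi.sub_apply]
    linarith
  rw [integral_add i3 i4] at key2
  linarith

end WEAKsec
open MeasureTheory Metric Set Matrix

noncomputable section MORREYsec

variable {n : ℕ}

lemma fderiv_eq_sum (g : (Fin n → ℝ) → ℝ) (x v : Fin n → ℝ) :
    fderiv ℝ g x v = ∑ i, v i * pd i g x := by
  conv_lhs => rw [pi_eq_sum_univ' v]
  simp [pd, map_sum]

lemma integrableOn_ball {F : (Fin n → ℝ) → ℝ} {x₀ : Fin n → ℝ} {ρ : ℝ}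
    (hF : ContinuousOn F (closedBall x₀ ρ)) : IntegrableOn F (ball x₀ ρ) :=
  (hF.integrableOn_compact (isCompact_closedBall x₀ ρ)).mono_set ball_subset_closedBall

lemma dilate_int (x x₀ : Fin n → ℝ) (ρ s : ℝ) (hx : x ∈ ball x₀ ρ) (hs0 : 0 < s) (hs1 : s ≤ 1)
    (F : (Fin n → ℝ) → ℝ) (hF : Continuous F) (hF0 : ∀ y, 0 ≤ F y) :
    ∫ y in ball x₀ ρ, F (x + s • (y - x)) ≤ (s ^ n)⁻¹ * ∫ y in ball x₀ ρ, F y := by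
  have e1 : ∫ y, (ball x₀ ρ).indicator F (x + s • (y - x)) =
      (s ^ n)⁻¹ * ∫ y in ball x₀ ρ, F y := by
    rw [integral_sub_right_eq_self (fun y => (ball x₀ ρ).indicator F (x + s • y)) x]
    rw [Measure.integral_comp_smul volume (fun y => (ball x₀ ρ).indicator F (x + y)) s]
    rw [integral_add_left_eq_self (fun y => (ball x₀ ρ).indicator F y) x,
      integral_indicator measurableSet_ball]
    simp [abs_of_pos hs0]
  rw [← e1, ← integral_indicator measurableSet_ball]
  have hI : Integrable ((ball x₀ ρ).indicator F) :=
    (integrable_indicator_iff measurableSet_ball).2 (integrableOn_ball hF.continuousOn)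
  have hI2 : Integrable fun y => (ball x₀ ρ).indicator F (x + s • (y - x)) := by
    have h1 : Integrable fun y => (ball x₀ ρ).indicator F (x + y) := hI.comp_add_left x
    have h2 : Integrable fun y => (ball x₀ ρ).indicator F (x + s • y) := h1.comp_smul hs0.ne'
    exact h2.comp_sub_right x
  refine integral_mono ?_ hI2 ?_
  · refine (integrable_indicator_iff measurableSet_ball).2 (integrableOn_ball ?_)
    exact (hF.comp (by fun_prop)).continuousOn
  · intro y
    by_cases hy : y ∈ ball x₀ ρ
    · have : x + s • (y - x) ∈ ball x₀ ρ :=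
        (convex_ball x₀ ρ).add_smul_sub_mem hx hy ⟨hs0.le, hs1⟩
      simp [indicator_of_mem hy, indicator_of_mem this]
    · simp only [indicator_of_notMem hy]
      exact indicator_nonneg (fun y _ => hF0 y) _

lemma young_split (t s p : ℝ) (ht : 0 ≤ t) (hs : 0 < s) (hp : 1 < p) :
    t ≤ s ^ (-(n / (p - 1)) : ℝ) + s ^ n * t ^ p := by
  have hsn : 0 < s ^ n := by positivity
  rcases le_total t (s ^ (-(n / (p - 1)) : ℝ)) with h | h
  · have : 0 ≤ s ^ n * t ^ p := by positivity
    linarith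
  · have h0 : 0 < s ^ (-(n / (p - 1)) : ℝ) := Real.rpow_pos_of_pos hs _
    have htp : 0 < t := lt_of_lt_of_le h0 h
    have h1 := Real.rpow_le_rpow h0.le h (show 0 ≤ p - 1 by linarith)
    rw [← Real.rpow_mul hs.le, neg_mul, div_mul_cancel₀ _ (by linarith), Real.rpow_neg hs.le,
      Real.rpow_natCast] at h1
    have h2 : t ^ p = t ^ (p - 1) * t := by
      rw [← Real.rpow_add_one htp.ne']; ring_nf
    have h3 : 1 ≤ s ^ n * t ^ (p - 1) := by
      calc (1 : ℝ) = s ^ n * (s ^ n)⁻¹ := by field_simp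
        _ ≤ _ := by gcongr
    rw [h2]
    nlinarith

lemma morrey (x₀ : Fin n → ℝ) (ρ p A : ℝ) (hρ : 0 < ρ) (hp : (n : ℝ) < p - 1) :
    ∃ C, ∀ g H : (Fin n → ℝ) → ℝ, ContDiff ℝ 1 g → Continuous H → (∀ i x, |pd i g x| ≤ H x) →
      (∀ x, 0 ≤ H x) →
      ∫ x in ball x₀ ρ, H x ^ p ≤ A → ∫ x in ball x₀ ρ, |g x| ^ p ≤ A →
      ∀ x ∈ ball x₀ ρ, |g x| ≤ C := by
  have hn0 : (0 : ℝ) ≤ n := Nat.cast_nonneg n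
  have hp1 : 1 < p := by linarith
  set V : ℝ := volume.real (ball x₀ ρ) with hV
  have hVpos : 0 < V := by
    rw [hV, Measure.real]
    exact ENNReal.toReal_pos (measure_ball_pos volume x₀ hρ).ne' measure_ball_lt_top.ne
  set α : ℝ := n / (p - 1) with hα
  have hα1 : α < 1 := by rw [hα, div_lt_one (by linarith)]; exact hp
  let B : ℝ → ℝ := fun s => n * (2 * ρ) * (V * s ^ (-α) + A)
  refine ⟨((∫ s in (0:ℝ)..1, B s) + (V + A)) / V, ?_⟩
  intro g H hg hH hgH hH0 hHA hgA x hx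
  rw [le_div_iff₀ hVpos]
  have hgc := hg.continuous
  let Φ : ℝ → ℝ := fun s => ∫ y in ball x₀ ρ, g (x + s • (y - x))
  have hmem : ∀ s ∈ Icc (0 : ℝ) 1, ∀ y ∈ ball x₀ ρ, x + s • (y - x) ∈ ball x₀ ρ := fun s hs y hy =>
    (convex_ball x₀ ρ).add_smul_sub_mem hx hy hs
  have hyx : ∀ y ∈ ball x₀ ρ, ‖y - x‖ ≤ 2 * ρ := by
    intro y hy
    rw [← dist_eq_norm]
    have := dist_triangle_right y x x₀
    rw [mem_ball] at hx hy
    linarith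
  obtain ⟨Cg, hCg⟩ := (isCompact_closedBall x₀ ρ).exists_bound_of_continuousOn hgc.continuousOn
  obtain ⟨Cd, hCd⟩ := (isCompact_closedBall x₀ ρ).exists_bound_of_continuousOn
    hH.continuousOn
  have hfin : volume (ball x₀ ρ) ≠ ⊤ := measure_ball_lt_top.ne
  have : IsFiniteMeasure (volume.restrict (ball x₀ ρ)) := ⟨by simpa using measure_ball_lt_top⟩
  have hfd : ∀ y ∈ ball x₀ ρ, ∀ w, |fderiv ℝ g w (y - x)| ≤ n * (2 * ρ) * H w := by
    intro y hy w
    rw [fderiv_eq_sum]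
    calc |∑ i, (y - x) i * pd i g w| ≤ ∑ i, |(y - x) i * pd i g w| := Finset.abs_sum_le_sum_abs _ _
      _ ≤ ∑ _i : Fin n, (2 * ρ) * H w := by
        refine Finset.sum_le_sum fun i _ => ?_
        rw [abs_mul]
        refine mul_le_mul ?_ (hgH i w) (abs_nonneg _) (by positivity)
        have := norm_le_pi_norm (y - x) i
        exact le_trans this (hyx y hy)
      _ = _ := by simp; ring
  have hder : ∀ s ∈ Ioo (0 : ℝ) 1, HasDerivAt Φ
      (∫ y in ball x₀ ρ, fderiv ℝ g (x + s • (y - x)) (y - x)) s := by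
    intro s hs
    refine (hasDerivAt_integral_of_dominated_loc_of_deriv_le (μ := volume.restrict (ball x₀ ρ))
      (F := fun s y => g (x + s • (y - x)))
      (F' := fun s y => fderiv ℝ g (x + s • (y - x)) (y - x))
      (bound := fun _ => n * (2 * ρ) * Cd) (isOpen_Ioo.mem_nhds hs) ?_ ?_ ?_ ?_ ?_ ?_).2
    · exact Filter.Eventually.of_forall fun s =>
        (hgc.comp (by fun_prop)).aestronglyMeasurable
    · exact integrableOn_ball (hgc.comp (by fun_prop)).continuousOn
    · refine Continuous.aestronglyMeasurable ?_
      exact ((hg.continuous_fderiv one_ne_zero).comp (by fun_prop)).clm_apply (by fun_prop)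
    · refine (ae_restrict_iff' measurableSet_ball).2 (Filter.Eventually.of_forall fun y hy s hs => ?_)
      refine (hfd y hy _).trans ?_
      have := hCd _ (ball_subset_closedBall (hmem s ⟨hs.1.le, hs.2.le⟩ y hy))
      have := (le_abs_self _).trans this
      gcongr
    · exact integrable_const _
    · refine Filter.Eventually.of_forall fun y s hs => ?_
      have h1 : HasFDerivAt g (fderiv ℝ g (x + s • (y - x))) (x + s • (y - x)) :=
        (hg.differentiable one_ne_zero _).hasFDerivAt
      have h2 : HasDerivAt (fun s : ℝ => x + s • (y - x)) (y - x) s := by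
        simpa using ((hasDerivAt_id s).smul_const (y - x)).const_add x
      exact h1.comp_hasDerivAt s h2
  have hcont : ContinuousOn Φ (Icc 0 1) := by
    refine continuousOn_of_dominated (bound := fun _ => Cg) ?_ ?_ (integrable_const _) ?_
    · intro s _
      exact (hgc.comp (by fun_prop)).aestronglyMeasurable
    · intro s hs
      exact (ae_restrict_iff' measurableSet_ball).2 (Filter.Eventually.of_forall fun y hy =>
        hCg _ (ball_subset_closedBall (hmem s hs y hy)))
    · exact Filter.Eventually.of_forall fun y => (hgc.comp (by fun_prop)).continuousOn
  have hHp : Continuous fun y => H y ^ p := hH.rpow_const fun _ => Or.inr (by linarith)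
  have hbd : ∀ s ∈ Ioo (0 : ℝ) 1, ‖deriv Φ s‖ ≤ B s := by
    intro s hs
    rw [(hder s hs).deriv]
    have hint : IntegrableOn (fun y => n * (2 * ρ) * (s ^ (-α) + s ^ n * H (x + s • (y - x)) ^ p))
        (ball x₀ ρ) := by
      refine integrableOn_ball (Continuous.continuousOn ?_)
      exact continuous_const.mul (continuous_const.add (continuous_const.mul
        (hHp.comp (f := fun y => x + s • (y - x)) (by fun_prop))))
    refine (norm_integral_le_of_norm_le hint ?_).trans ?_
    · refine (ae_restrict_iff' measurableSet_ball).2 (Filter.Eventually.of_forall fun y hy => ?_)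
      refine (hfd y hy _).trans ?_
      have := young_split (n := n) (H (x + s • (y - x))) s p (hH0 _) hs.1 hp1
      gcongr
    · rw [integral_const_mul, integral_add, integral_const_mul]
      · simp only [integral_const, Measure.real, Measure.restrict_apply, MeasurableSet.univ,
          univ_inter, smul_eq_mul]
        have := dilate_int x x₀ ρ s hx hs.1 hs.2.le _ hHp (fun y => Real.rpow_nonneg (hH0 y) _)
        have hsn : 0 < s ^ n := pow_pos hs.1 n
        have h3 : s ^ n * ∫ y in ball x₀ ρ, H (x + s • (y - x)) ^ p ≤ A := by
          calc _ ≤ s ^ n * ((s ^ n)⁻¹ * ∫ y in ball x₀ ρ, H y ^ p) := by gcongr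
            _ = ∫ y in ball x₀ ρ, H y ^ p := by field_simp
            _ ≤ A := hHA
        show _ ≤ n * (2 * ρ) * (V * s ^ (-α) + A)
        rw [hV, Measure.real]
        gcongr
      · exact integrable_const _
      · exact integrableOn_ball (continuous_const.mul
          (hHp.comp (f := fun y => x + s • (y - x)) (by fun_prop))).continuousOn
  have hBint : IntervalIntegrable B volume 0 1 := by
    refine IntervalIntegrable.const_mul (IntervalIntegrable.add ?_ intervalIntegrable_const) _
    exact (intervalIntegral.intervalIntegrable_rpow' (by linarith)).const_mul _
  have key := norm_sub_le_integral_of_norm_deriv_le_of_le zero_le_one hcont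
    (fun s hs => (hder s hs).differentiableAt.differentiableWithinAt)
    (Filter.Eventually.of_forall hbd) hBint
  have h0 : Φ 0 = V * g x := by
    simp only [Φ, zero_smul, add_zero, integral_const, Measure.real, Measure.restrict_apply,
      MeasurableSet.univ, univ_inter, smul_eq_mul, hV]
  have h1 : |Φ 1| ≤ V + A := by
    have hgp : Continuous fun y => |g y| ^ p := hgc.abs.rpow_const fun _ => Or.inr (by linarith)
    have e : Φ 1 = ∫ y in ball x₀ ρ, g y := by simp [Φ]
    rw [e]
    refine (norm_integral_le_of_norm_le (f := g) (g := fun y => 1 + |g y| ^ p)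
      (integrableOn_ball (continuous_const.add hgp).continuousOn)
      (Filter.Eventually.of_forall fun y => ?_)).trans ?_
    · rw [Real.norm_eq_abs]
      rcases le_total |g y| 1 with h | h
      · have : 0 ≤ |g y| ^ p := by positivity
        linarith
      · have := Real.rpow_le_rpow_of_exponent_le h hp1.le
        rw [Real.rpow_one] at this
        linarith
    · rw [integral_add (integrable_const _) (integrableOn_ball hgp.continuousOn)]
      simp only [integral_const, Measure.real, Measure.restrict_apply, MeasurableSet.univ,
          univ_inter, smul_eq_mul, mul_one]
      rw [hV, Measure.real]
      gcongr
  rw [h0, Real.norm_eq_abs] at key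
  have h4 : |V * g x| ≤ |Φ 1| + |Φ 1 - V * g x| := by
    have := abs_sub_abs_le_abs_sub (V * g x) (Φ 1)
    rw [abs_sub_comm] at this; linarith
  rw [abs_mul, abs_of_pos hVpos] at h4
  linarith

end MORREYsec
open MeasureTheory Metric Set Matrix

noncomputable section ITERsec

variable {n : ℕ}

lemma cont_rpow {τ : (Fin n → ℝ) → ℝ} (hτ : Continuous τ) {q : ℝ} (hq : 0 ≤ q) :
    Continuous fun x => τ x ^ q := hτ.rpow_const fun _ => Or.inr hq

lemma rpow_tend (b : ℝ) (hb : 1 < b) :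
    Filter.Tendsto (fun x : ℝ => b ^ x) Filter.atTop Filter.atTop := by
  have h : (fun x : ℝ => b ^ x) = fun x => Real.exp (Real.log b * x) := by
    funext x; rw [Real.rpow_def_of_pos (by linarith)]
  rw [h]
  exact Real.tendsto_exp_atTop.comp (Filter.tendsto_id.const_mul_atTop (Real.log_pos hb))

lemma sup_of_powers (x₀ : Fin n → ℝ) (R ps δ χ K : ℝ) (hδ0 : 0 < δ) (hps0 : 0 < ps) (hχ1 : 1 < χ)
    (τ : (Fin n → ℝ) → ℝ) (hτ : Continuous τ)
    (hI : ∀ (i : ℕ) (S : Set (Fin n → ℝ)), IsOpen S → S ⊆ ball x₀ R →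
      ∫ y in S, τ y ^ (ps + δ * χ ^ i) ≤ Real.exp (K * χ ^ i)) :
    ∀ x ∈ ball x₀ R, τ x ≤ Real.exp (K / δ) := by
  intro x hx
  by_contra hlt
  push Not at hlt
  set t := Real.exp (K / δ) with ht
  obtain ⟨t', ht1, ht2⟩ := exists_between hlt
  let P : ℕ → ℝ := fun i => ps + δ * χ ^ i
  have ht0 : 0 < t := Real.exp_pos _
  have ht'0 : 0 < t' := ht0.trans ht1
  have hopen : IsOpen ({y | t' < τ y} ∩ ball x₀ R) :=
    (isOpen_lt continuous_const hτ).inter isOpen_ball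
  set S := {y | t' < τ y} ∩ ball x₀ R with hS
  have hSpos : 0 < volume S := hopen.measure_pos volume ⟨x, ht2, hx⟩
  have hSfin : volume S < ⊤ := (measure_mono inter_subset_right).trans_lt measure_ball_lt_top
  set μ := volume.real S with hμ
  have hμ0 : 0 < μ := ENNReal.toReal_pos hSpos.ne' hSfin.ne
  have hlow : ∀ i, μ * t' ^ P i ≤ Real.exp (K * χ ^ i) := by
    intro i
    have hP0 : 0 ≤ P i := by simp only [P]; positivity
    have hc := cont_rpow hτ hP0
    calc μ * t' ^ P i = ∫ y in S, t' ^ P i := by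
          simp [hμ, Measure.real]
      _ ≤ ∫ y in S, τ y ^ P i := by
          refine setIntegral_mono_on ?_ ?_ hopen.measurableSet ?_
          · exact integrableOn_const hSfin.ne
          · exact (integrableOn_ball hc.continuousOn).mono_set inter_subset_right
          · intro y hy
            exact Real.rpow_le_rpow ht'0.le (le_of_lt hy.1) hP0
      _ ≤ _ := hI i S hopen inter_subset_right
  -- contradiction
  have hq : 1 < (t' / t) ^ δ := Real.one_lt_rpow ((one_lt_div ht0).2 ht1) hδ0
  have htd : t ^ δ = Real.exp K := by
    rw [ht, ← Real.exp_mul, div_mul_cancel₀ _ hδ0.ne']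
  have hbound : ∀ i : ℕ, μ * t' ^ ps * ((t' / t) ^ δ) ^ (χ ^ i) ≤ 1 := by
    intro i
    have h1 := hlow i
    have e1 : t' ^ P i = t' ^ ps * (t' ^ δ) ^ (χ ^ i) := by
      simp only [P]
      rw [Real.rpow_add ht'0, ← Real.rpow_mul ht'0.le]
    have e2 : Real.exp (K * χ ^ i) = (t ^ δ) ^ (χ ^ i) := by rw [htd, Real.exp_mul]
    have e3 : ((t' / t) ^ δ) ^ (χ ^ i) = (t' ^ δ) ^ (χ ^ i) / (t ^ δ) ^ (χ ^ i) := by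
      rw [Real.div_rpow ht'0.le ht0.le, Real.div_rpow (by positivity) (by positivity)]
    rw [e3, ← mul_div_assoc, div_le_one (by positivity), ← e2, mul_assoc, ← e1]
    exact h1
  have hlim : Filter.Tendsto (fun i : ℕ => μ * t' ^ ps * ((t' / t) ^ δ) ^ (χ ^ i)) Filter.atTop
      Filter.atTop := by
    refine Filter.Tendsto.const_mul_atTop (by positivity) ?_
    exact (rpow_tend _ hq).comp (tendsto_pow_atTop_atTop_of_one_lt hχ1)
  obtain ⟨i, hi⟩ := (hlim.eventually_gt_atTop 1).exists
  exact absurd (hbound i) (not_le.2 hi)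

lemma coef_id (C0 p X R b : ℝ) (hR : 0 < R) (hb : 0 < b) :
    C0 * (p * X) ^ 2 / (R * b⁻¹ / 4) ^ 2 = (C0 * p ^ 2 * 16 / R ^ 2) * (X ^ 2 * b ^ 2) := by
  field_simp
  norm_num

set_option maxHeartbeats 2000000 in
lemma iterate_moser (hn : 3 ≤ n) (k : ℕ) (hk : 1 ≤ k) (p : ℝ) (hp : ((k + 1) * n : ℝ) / 2 < p)
    (x₀ : Fin n → ℝ) (R : ℝ) (hR : 0 < R) (C0 A : ℝ) (hC0 : 0 < C0) :
    ∃ C' : ℝ, ∀ τ : (Fin n → ℝ) → ℝ, Continuous τ → (∀ x ∈ ball x₀ (3 * R / 2), 1 ≤ τ x) →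
      (∀ m r r' : ℝ, 1 ≤ m → R ≤ r' → r' < r → r ≤ 3 * R / 2 →
        ∫ x in ball x₀ r', τ x ^ (m * (n / (n - 2) : ℝ)) ≤
          (C0 * m ^ 2 / (r - r') ^ 2 * ∫ x in ball x₀ r, τ x ^ (m + k + 1)) ^ (n / (n - 2) : ℝ)) →
      ∫ x in ball x₀ (3 * R / 2), τ x ^ p ≤ A →
      ∀ x ∈ ball x₀ R, τ x ≤ C' := by
  have hn3 : (3 : ℝ) ≤ n := by exact_mod_cast hn
  have hk1 : (1 : ℝ) ≤ k := by exact_mod_cast hk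
  set χ : ℝ := n / (n - 2) with hχ
  have hχ1 : 1 < χ := by rw [hχ, lt_div_iff₀ (by linarith)]; linarith
  have hχn : χ * (n - 2) = n := div_mul_cancel₀ _ (by linarith)
  set ps : ℝ := (k + 1) * n / 2 with hps
  set δ : ℝ := p - ps with hδ
  have hδ0 : 0 < δ := by rw [hδ]; linarith
  have hps0 : 0 < ps := by rw [hps]; positivity
  have hps1 : (k : ℝ) + 2 ≤ ps := by rw [hps]; nlinarith
  set c1 : ℝ := |Real.log (C0 * p ^ 2 * 16 / R ^ 2)| with hc1
  set e : ℝ := Real.log (4 * χ ^ 2) with he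
  have he0 : 0 ≤ e := Real.log_nonneg (by nlinarith)
  set α : ℝ := χ * e / (χ - 1) with hα
  set β : ℝ := (χ * c1 + α) / (χ - 1) with hβ
  have hα1 : α * (χ - 1) = χ * e := by rw [hα]; field_simp [show χ - 1 ≠ 0 by linarith]
  have hβ1 : β * (χ - 1) = χ * c1 + α := by rw [hβ]; field_simp [show χ - 1 ≠ 0 by linarith]
  have hα0 : 0 ≤ α := by rw [hα]; exact div_nonneg (by positivity) (by linarith)
  have hc10 : 0 ≤ c1 := abs_nonneg _
  have hβ0 : 0 ≤ β := by rw [hβ]; exact div_nonneg (by positivity) (by linarith)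
  set K : ℝ := Real.log (|A| + 1) + β with hK
  refine ⟨Real.exp (K / δ), ?_⟩
  intro τ hτ hτ1 hstep hA
  let P : ℕ → ℝ := fun i => ps + δ * χ ^ i
  let r : ℕ → ℝ := fun i => R * (1 + (1 / 2) ^ (i + 1))
  have hpow1 : ∀ i : ℕ, (1 : ℝ) ≤ χ ^ i := fun i => one_le_pow₀ hχ1.le
  have hrle : ∀ i, r i ≤ 3 * R / 2 := by
    intro i
    have : (1 / 2 : ℝ) ^ (i + 1) ≤ 1 / 2 := by
      rw [pow_succ]
      have : (1 / 2 : ℝ) ^ i ≤ 1 := pow_le_one₀ (by norm_num) (by norm_num)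
      linarith
    simp only [r]; nlinarith
  have hrge : ∀ i, R ≤ r i := by
    intro i
    have : (0 : ℝ) < (1 / 2) ^ (i + 1) := by positivity
    simp only [r]; nlinarith
  have hrd : ∀ i, r i - r (i + 1) = R * (1 / 2) ^ i / 4 := by
    intro i; simp only [r, pow_succ]; ring
  have hτ0 : ∀ i, ∀ x ∈ ball x₀ (r i), 0 ≤ τ x := fun i x hx =>
    zero_le_one.trans (hτ1 x (ball_subset_ball (hrle i) hx))
  have hI : ∀ i, ∫ x in ball x₀ (r i), τ x ^ P i ≤ Real.exp (K * χ ^ i - α * i - β) := by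
    intro i
    induction i with
    | zero =>
      have e1 : r 0 = 3 * R / 2 := by simp only [r]; ring
      have e2 : P 0 = p := by simp only [P, hδ]; ring
      rw [e1, e2]
      refine hA.trans ?_
      simp only [pow_zero, mul_one, Nat.cast_zero, mul_zero, sub_zero, hK, add_sub_cancel_right]
      rw [Real.exp_log (by positivity)]
      linarith [le_abs_self A]
    | succ i ih =>
      have hm1 : 1 ≤ P i - (k + 1) := by
        have := hpow1 i
        simp only [P]; nlinarith
      have h := hstep (P i - (k + 1)) (r i) (r (i + 1)) hm1 (hrge _)
        (by have := hrd i; have : 0 < R * (1 / 2) ^ i / 4 := by positivity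
            linarith) (hrle i)
      have e1 : (P i - (k + 1)) * χ = P (i + 1) := by
        simp only [P, pow_succ]
        have : (ps - (k + 1)) * χ = ps := by rw [hps]; linear_combination (k + 1) / 2 * hχn
        linear_combination this
      have e2 : P i - (k + 1) + k + 1 = P i := by ring
      rw [e1, e2, hrd] at h
      refine h.trans ?_
      have hint0 : 0 ≤ ∫ x in ball x₀ (r i), τ x ^ P i :=
        setIntegral_nonneg measurableSet_ball fun x hx => Real.rpow_nonneg (hτ0 i x hx) _
      have hmp : P i - (k + 1) ≤ p * χ ^ i := by
        have := hpow1 i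
        have : p = ps + δ := by rw [hδ]; ring
        simp only [P]; rw [this]; nlinarith
      have hco : C0 * (P i - (k + 1)) ^ 2 / (R * (1 / 2) ^ i / 4) ^ 2 ≤ Real.exp (c1 + i * e) := by
        calc C0 * (P i - (k + 1)) ^ 2 / (R * (1 / 2) ^ i / 4) ^ 2
            ≤ C0 * (p * χ ^ i) ^ 2 / (R * (1 / 2) ^ i / 4) ^ 2 := by gcongr
          _ = (C0 * p ^ 2 * 16 / R ^ 2) * (4 * χ ^ 2) ^ i := by
            have : (4 * χ ^ 2) ^ i = (χ ^ i) ^ 2 * 4 ^ i := by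
              rw [mul_pow, ← pow_mul, ← pow_mul, mul_comm 2 i]; ring
            have h4 : (4 : ℝ) ^ i = (2 ^ i) ^ 2 := by rw [← pow_mul, mul_comm, pow_mul]; norm_num
            rw [this, h4, one_div, inv_pow]
            exact coef_id _ _ _ _ _ hR (by positivity)
          _ ≤ Real.exp c1 * Real.exp e ^ i := by
            have h1 : C0 * p ^ 2 * 16 / R ^ 2 ≤ Real.exp c1 := by
              have hpp : 0 < p := by linarith
              have : 0 < C0 * p ^ 2 * 16 / R ^ 2 := by positivity
              calc _ = Real.exp (Real.log (C0 * p ^ 2 * 16 / R ^ 2)) := (Real.exp_log this).symm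
                _ ≤ _ := Real.exp_le_exp.2 (le_abs_self _)
            rw [he, Real.exp_log (by positivity)]
            gcongr
          _ = _ := by rw [Real.exp_add, Real.exp_nat_mul]
      have hm0 : 0 ≤ C0 * (P i - (k + 1)) ^ 2 / (R * (1 / 2) ^ i / 4) ^ 2 := by positivity
      calc _ ≤ (Real.exp (c1 + i * e) * Real.exp (K * χ ^ i - α * i - β)) ^ χ := by
            refine Real.rpow_le_rpow (by positivity) ?_ (by linarith)
            gcongr
        _ = Real.exp ((c1 + i * e + (K * χ ^ i - α * i - β)) * χ) := by
            rw [← Real.exp_add, ← Real.exp_mul]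
        _ ≤ _ := by
            apply Real.exp_le_exp.2
            push_cast
            rw [pow_succ]
            nlinarith [hα1, hβ1]
  refine sup_of_powers x₀ R ps δ χ K hδ0 hps0 hχ1 τ hτ fun i S hSo hSb => ?_
  have hP0 : 0 ≤ P i := by have := hpow1 i; simp only [P]; positivity
  have hc := cont_rpow hτ hP0
  calc ∫ y in S, τ y ^ P i ≤ ∫ y in ball x₀ (r i), τ y ^ P i := by
          refine setIntegral_mono_set (integrableOn_ball hc.continuousOn) ?_ ?_
          · exact (ae_restrict_iff' measurableSet_ball).2 (Filter.Eventually.of_forall fun y hy =>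
              Real.rpow_nonneg (hτ0 i y hy) _)
          · exact (hSb.trans (ball_subset_ball (hrge i))).eventuallyLE
      _ ≤ _ := hI i
      _ ≤ _ := by
          apply Real.exp_le_exp.2
          have : 0 ≤ α * i := by positivity
          linarith

end ITERsec
open MeasureTheory Metric Set Matrix

noncomputable section SOBsec

variable {n : ℕ}

lemma norm_fderiv_le_sum (g : (Fin n → ℝ) → ℝ) (x : Fin n → ℝ) :
    ‖fderiv ℝ g x‖ ≤ ∑ i, |pd i g x| := by
  refine ContinuousLinearMap.opNorm_le_bound _ (Finset.sum_nonneg fun i _ => abs_nonneg _) fun v => ?_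
  rw [fderiv_eq_sum, Finset.sum_mul]
  refine (Finset.abs_sum_le_sum_abs _ _).trans (Finset.sum_le_sum fun i _ => ?_)
  rw [abs_mul, mul_comm]
  exact mul_le_mul_of_nonneg_left (norm_le_pi_norm v i) (abs_nonneg _)

lemma hcs_sq {f : (Fin n → ℝ) → ℝ} (hf : HasCompactSupport f) :
    HasCompactSupport fun x => f x ^ 2 := by
  simp only [sq]; exact hf.mul_right

lemma int_fderiv_sq {g : (Fin n → ℝ) → ℝ} (hg : ContDiff ℝ 1 g) (hgc : HasCompactSupport g) :
    ∫ a, ‖fderiv ℝ g a‖ ^ 2 ≤ n * ∫ x, ∑ i, pd i g x ^ 2 := by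
  have hfc : HasCompactSupport (fderiv ℝ g) := hgc.fderiv ℝ
  have hfcont : Continuous (fderiv ℝ g) := hg.continuous_fderiv one_ne_zero
  have j1 : Integrable fun x => ‖fderiv ℝ g x‖ ^ 2 :=
    (hfcont.norm.pow 2).integrable_of_hasCompactSupport (hcs_sq hfc.norm)
  have j2 : Integrable fun x => ∑ i, pd i g x ^ 2 := integrable_finsetSum _ fun i _ =>
    ((continuous_pd hg i).pow 2).integrable_of_hasCompactSupport (hcs_sq (compact_pd hgc i))
  rw [← integral_const_mul]
  refine integral_mono j1 (j2.const_mul _) ?_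
  intro x
  calc ‖fderiv ℝ g x‖ ^ 2 ≤ (∑ i, |pd i g x|) ^ 2 := by
        gcongr; exact norm_fderiv_le_sum g x
    _ ≤ (Finset.univ : Finset (Fin n)).card * ∑ i, |pd i g x| ^ 2 := sq_sum_le_card_mul_sum_sq
    _ = _ := by simp

lemma sobolev (hn : 3 ≤ n) : ∃ C : ℝ, 0 < C ∧ ∀ g : (Fin n → ℝ) → ℝ, ContDiff ℝ 1 g →
    HasCompactSupport g →
    ∫ x, |g x| ^ (2 * (n / (n - 2) : ℝ)) ≤ (C * ∫ x, ∑ i, pd i g x ^ 2) ^ (n / (n - 2) : ℝ) := by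
  have hn3 : (3 : ℝ) ≤ n := by exact_mod_cast hn
  set χ : ℝ := n / (n - 2) with hχ
  have hχ0 : 0 < χ := by rw [hχ]; exact div_pos (by linarith) (by linarith)
  let q : NNReal := ⟨2 * χ, by positivity⟩
  set S : ℝ := (SNormLESNormFDerivOfEqConst ℝ (volume : Measure (Fin n → ℝ)) (2 : NNReal) : ℝ) with hS
  have hS0 : 0 ≤ S := NNReal.coe_nonneg _
  refine ⟨S ^ 2 * n + 1, by positivity, ?_⟩
  intro g hg hgc
  have hfr : Module.finrank ℝ (Fin n → ℝ) = n := by simp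
  have h := eLpNorm_le_eLpNorm_fderiv_of_eq (volume : Measure (Fin n → ℝ)) hg hgc (p := 2) (p' := q)
    (by norm_num) (by rw [hfr]; omega) (by
      rw [hfr]
      show (2 * χ)⁻¹ = ((2 : NNReal)⁻¹ : NNReal) - (n : ℝ)⁻¹
      rw [hχ]
      push_cast
      have : (n : ℝ) - 2 ≠ 0 := by linarith
      field_simp)
  have hfc : HasCompactSupport (fderiv ℝ g) := hgc.fderiv ℝ
  have hfcont : Continuous (fderiv ℝ g) := hg.continuous_fderiv one_ne_zero
  have hq0 : (q : ENNReal) ≠ 0 := by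
    simp only [ne_eq, ENNReal.coe_eq_zero]
    intro h; have : (2 * χ) = 0 := congrArg NNReal.toReal h
    linarith
  have hqr : (q : ENNReal).toReal = 2 * χ := rfl
  have m1 : MemLp g q volume := hg.continuous.memLp_of_hasCompactSupport hgc
  have m2 : MemLp (fderiv ℝ g) ((2 : NNReal) : ENNReal) volume :=
    hfcont.memLp_of_hasCompactSupport hfc
  rw [m1.eLpNorm_eq_integral_rpow_norm hq0 (by simp),
    m2.eLpNorm_eq_integral_rpow_norm (by simp) (by simp)] at h
  rw [hqr] at h
  have h2 : (((2 : NNReal) : ENNReal)).toReal = 2 := rfl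
  rw [h2, ← ENNReal.ofReal_coe_nnreal, ← ENNReal.ofReal_mul (NNReal.coe_nonneg _)] at h
  have i1 : 0 ≤ ∫ a, ‖g a‖ ^ (2 * χ) := integral_nonneg fun a => by positivity
  have i2 : 0 ≤ ∫ a, ‖fderiv ℝ g a‖ ^ (2 : ℝ) := integral_nonneg fun a => by positivity
  rw [ENNReal.ofReal_le_ofReal_iff (by positivity)] at h
  have h3 := Real.rpow_le_rpow (by positivity) h (show 0 ≤ 2 * χ by positivity)
  rw [← Real.rpow_mul i1, inv_mul_cancel₀ (by positivity), Real.rpow_one] at h3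
  simp only [Real.norm_eq_abs] at h3
  refine h3.trans ?_
  rw [Real.rpow_mul (by positivity)]
  refine Real.rpow_le_rpow (by positivity) ?_ hχ0.le
  rw [Real.rpow_two, mul_pow, ← Real.rpow_natCast (((∫ a, ‖fderiv ℝ g a‖ ^ (2 : ℝ)) ^ (2 : ℝ)⁻¹)),
    ← Real.rpow_mul i2]
  norm_num only [Nat.cast_ofNat, Real.rpow_one]
  have i3 : ∫ a, ‖fderiv ℝ g a‖ ^ (2 : ℝ) ≤ n * ∫ x, ∑ i, pd i g x ^ 2 := by
    simp only [Real.rpow_two]; exact int_fderiv_sq hg hgc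
  have i4 : 0 ≤ ∫ x, ∑ i, pd i g x ^ 2 := integral_nonneg fun x =>
    Finset.sum_nonneg fun i _ => sq_nonneg _
  calc S ^ 2 * ∫ a, ‖fderiv ℝ g a‖ ^ (2 : ℝ) ≤ S ^ 2 * (n * ∫ x, ∑ i, pd i g x ^ 2) := by gcongr
    _ ≤ _ := by nlinarith

lemma smoothTransition_deriv : ∃ L : ℝ, 0 ≤ L ∧ ∀ t, |deriv Real.smoothTransition t| ≤ L := by
  have hc : Continuous (deriv Real.smoothTransition) :=
    (Real.smoothTransition.contDiff (n := 1)).continuous_deriv (by norm_num)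
  obtain ⟨L, hL⟩ := (isCompact_Icc (a := (0 : ℝ)) (b := 1)).exists_bound_of_continuousOn
    hc.continuousOn
  refine ⟨L, (norm_nonneg _).trans (hL 0 (by simp)), fun t => ?_⟩
  have hL0 : 0 ≤ L := (norm_nonneg _).trans (hL 0 (by simp))
  by_cases ht : t ∈ Icc (0 : ℝ) 1
  · exact hL t ht
  · have : deriv Real.smoothTransition t = 0 := by
      rw [mem_Icc, not_and_or, not_le, not_le] at ht
      rcases ht with h | h
      · have : Real.smoothTransition =ᶠ[nhds t] fun _ => 0 := by
          filter_upwards [Iio_mem_nhds h] with s hs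
          exact Real.smoothTransition.zero_of_nonpos hs.le
        rw [this.deriv_eq]; simp
      · have : Real.smoothTransition =ᶠ[nhds t] fun _ => 1 := by
          filter_upwards [Ioi_mem_nhds h] with s hs
          exact Real.smoothTransition.one_of_one_le hs.le
        rw [this.deriv_eq]; simp
    rw [this]; simpa using hL0

lemma cutoff1 : ∃ L : ℝ, 0 < L ∧ ∀ r r' : ℝ, 0 < r' → r' < r → ∃ θ : ℝ → ℝ, ContDiff ℝ 2 θ ∧
    (∀ t, 0 ≤ θ t) ∧ (∀ t, θ t ≤ 1) ∧ (∀ t, |t| ≤ r' → θ t = 1) ∧ (∀ t, (r + r') / 2 ≤ |t| → θ t = 0) ∧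
    (∀ t, |deriv θ t| ≤ L / (r - r')) := by
  obtain ⟨L, hL0, hL⟩ := smoothTransition_deriv
  refine ⟨4 * L + 1, by positivity, ?_⟩
  intro r r' hr' hr
  have hd : 0 < (r - r') / 2 := by linarith
  set d := (r - r') / 2 with hdd
  let S := Real.smoothTransition
  have hS : ContDiff ℝ 2 S := Real.smoothTransition.contDiff (n := 2)
  have hSd : ∀ t, HasDerivAt S (deriv S t) t := fun t =>
    (hS.differentiable (by norm_num) t).hasDerivAt
  refine ⟨fun t => S (((r + r') / 2 - t) / d) * S (((r + r') / 2 + t) / d), ?_, ?_, ?_, ?_, ?_, ?_⟩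
  · exact (hS.comp ((contDiff_const.sub contDiff_id).div_const d)).mul
      (hS.comp ((contDiff_const.add contDiff_id).div_const d))
  · intro t
    exact mul_nonneg (Real.smoothTransition.nonneg _) (Real.smoothTransition.nonneg _)
  · intro t
    exact mul_le_one₀ (Real.smoothTransition.le_one _) (Real.smoothTransition.nonneg _)
      (Real.smoothTransition.le_one _)
  · intro t ht
    rw [abs_le] at ht
    have h1 : S (((r + r') / 2 - t) / d) = 1 :=
      Real.smoothTransition.one_of_one_le ((one_le_div hd).2 (by linarith))
    have h2 : S (((r + r') / 2 + t) / d) = 1 :=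
      Real.smoothTransition.one_of_one_le ((one_le_div hd).2 (by linarith))
    simp only [h1, h2, mul_one]
  · intro t ht
    rw [le_abs] at ht
    rcases ht with h | h
    · have h1 : S (((r + r') / 2 - t) / d) = 0 :=
        Real.smoothTransition.zero_of_nonpos (div_nonpos_of_nonpos_of_nonneg (by linarith) hd.le)
      simp only [h1, zero_mul]
    · have h1 : S (((r + r') / 2 + t) / d) = 0 :=
        Real.smoothTransition.zero_of_nonpos (div_nonpos_of_nonpos_of_nonneg (by linarith) hd.le)
      simp only [h1, mul_zero]
  · intro t
    have a1 : HasDerivAt (fun t => S (((r + r') / 2 - t) / d))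
        (deriv S (((r + r') / 2 - t) / d) * (-1 / d)) t :=
      (hSd _).comp t (((hasDerivAt_id t).const_sub _).div_const d)
    have a2 : HasDerivAt (fun t => S (((r + r') / 2 + t) / d))
        (deriv S (((r + r') / 2 + t) / d) * (1 / d)) t :=
      (hSd _).comp t (((hasDerivAt_id t).const_add _).div_const d)
    have a3 : HasDerivAt (fun t => S (((r + r') / 2 - t) / d) * S (((r + r') / 2 + t) / d)) _ t :=
      a1.mul a2
    rw [a3.deriv]
    have n1 : ∀ s, |S s| ≤ 1 := fun s => by
      rw [abs_of_nonneg (Real.smoothTransition.nonneg _)]; exact Real.smoothTransition.le_one _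
    refine (abs_add_le _ _).trans ?_
    rw [abs_mul, abs_mul, abs_mul, abs_mul]
    have e1 : |(-1 : ℝ) / d| = 1 / d := by rw [abs_div, abs_neg, abs_one, abs_of_pos hd]
    have e2 : |(1 : ℝ) / d| = 1 / d := by rw [abs_div, abs_one, abs_of_pos hd]
    rw [e1, e2]
    have b1 : |deriv S (((r + r') / 2 - t) / d)| * (1 / d) * |S (((r + r') / 2 + t) / d)| ≤
        L * (1 / d) * 1 := by
      gcongr
      · exact hL _
      · exact n1 _
    have b2 : |S (((r + r') / 2 - t) / d)| * (|deriv S (((r + r') / 2 + t) / d)| * (1 / d)) ≤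
        1 * (L * (1 / d)) := by
      gcongr
      · exact n1 _
      · exact hL _
    have b3 : L * (1 / d) * 1 + 1 * (L * (1 / d)) = 4 * L / (r - r') := by
      have : r - r' ≠ 0 := by linarith
      rw [hdd]; field_simp; ring
    have b4 : 4 * L / (r - r') ≤ (4 * L + 1) / (r - r') := by
      have : 0 < r - r' := by linarith
      gcongr; linarith
    linarith

lemma cutoff : ∃ L : ℝ, 0 < L ∧ ∀ (n : ℕ) (x₀ : Fin n → ℝ) (r r' : ℝ), 0 < r' → r' < r →
    ∃ η : (Fin n → ℝ) → ℝ, ContDiff ℝ 2 η ∧ (∀ x, 0 ≤ η x) ∧ (∀ x, η x ≤ 1) ∧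
    (∀ x ∈ ball x₀ r', η x = 1) ∧ tsupport η ⊆ closedBall x₀ ((r + r') / 2) ∧
    (∀ i x, |pd i η x| ≤ L / (r - r')) := by
  obtain ⟨L, hL0, hL⟩ := cutoff1
  refine ⟨L, hL0, fun n x₀ r r' hr' hr => ?_⟩
  obtain ⟨θ, hθ, h0, h1, hin, hout, hd⟩ := hL r r' hr' hr
  refine ⟨fun x => ∏ i, θ (x i - x₀ i), ?_, ?_, ?_, ?_, ?_, ?_⟩
  · exact contDiff_prod fun i _ => hθ.comp ((contDiff_apply ℝ ℝ i).sub contDiff_const)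
  · exact fun x => Finset.prod_nonneg fun i _ => h0 _
  · exact fun x => Finset.prod_le_one (fun i _ => h0 _) fun i _ => h1 _
  · intro x hx
    refine Finset.prod_eq_one fun i _ => hin _ ?_
    rw [mem_ball, dist_eq_norm] at hx
    exact (norm_le_pi_norm (x - x₀) i).trans hx.le
  · refine closure_minimal ?_ isClosed_closedBall
    intro x hx
    rw [mem_closedBall, dist_eq_norm, pi_norm_le_iff_of_nonneg (by linarith)]
    intro i
    by_contra hlt
    push Not at hlt
    refine hx (Finset.prod_eq_zero (Finset.mem_univ i) (hout _ hlt.le))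
  · intro i x
    have hg : ∀ j ∈ (Finset.univ : Finset (Fin n)), HasFDerivAt (fun x : Fin n → ℝ => θ (x j - x₀ j))
        (deriv θ (x j - x₀ j) • (ContinuousLinearMap.proj j : (Fin n → ℝ) →L[ℝ] ℝ)) x := by
      intro j _
      have hh := (hθ.differentiable (by norm_num) (x j - x₀ j)).hasDerivAt
      have h2 : HasFDerivAt (fun x : Fin n → ℝ => x j - x₀ j)
          (ContinuousLinearMap.proj j : (Fin n → ℝ) →L[ℝ] ℝ) x :=
        (hasFDerivAt_apply j x).sub_const _
      exact hh.comp_hasFDerivAt x h2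
    have := HasFDerivAt.finsetProd hg
    rw [pd, this.fderiv]
    have e : (∑ j, (∏ l ∈ Finset.univ.erase j, θ (x l - x₀ l)) • deriv θ (x j - x₀ j) •
        (ContinuousLinearMap.proj j : (Fin n → ℝ) →L[ℝ] ℝ)) (Pi.single i 1) =
        (∏ l ∈ Finset.univ.erase i, θ (x l - x₀ l)) * deriv θ (x i - x₀ i) := by
      rw [_root_.sum_apply, Finset.sum_eq_single i]
      · simp
      · intro j _ hj
        simp [hj]
      · simp
    rw [e, abs_mul]
    have p1 : |∏ l ∈ Finset.univ.erase i, θ (x l - x₀ l)| ≤ 1 := by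
      rw [abs_of_nonneg (Finset.prod_nonneg fun i _ => h0 _)]
      exact Finset.prod_le_one (fun i _ => h0 _) fun i _ => h1 _
    calc _ ≤ 1 * (L / (r - r')) := by
          gcongr
          exact hd _
      _ = _ := one_mul _

end SOBsec
open MeasureTheory Metric Set Matrix

noncomputable section ENERGYsec

variable {n : ℕ}

/-- bilinear form of a matrix -/
def qf (T : Matrix (Fin n) (Fin n) ℝ) (ξ ω : Fin n → ℝ) : ℝ := ∑ b, ∑ a, T a b * (ξ a * ω b)

lemma qf_comb (T : Matrix (Fin n) (Fin n) ℝ) (hT : T.IsSymm) (ξ ω : Fin n → ℝ) (s t : ℝ) :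
    qf T (fun i => s * ξ i + t * ω i) (fun i => s * ξ i + t * ω i) =
      s ^ 2 * qf T ξ ξ + 2 * s * t * qf T ω ξ + t ^ 2 * qf T ω ω := by
  have hs : qf T ξ ω = qf T ω ξ := by
    simp only [qf]; rw [Finset.sum_comm]
    refine Finset.sum_congr rfl fun a _ => Finset.sum_congr rfl fun b _ => ?_
    rw [hT.apply]; ring
  have : qf T (fun i => s * ξ i + t * ω i) (fun i => s * ξ i + t * ω i) =
      s ^ 2 * qf T ξ ξ + s * t * qf T ω ξ + s * t * qf T ξ ω + t ^ 2 * qf T ω ω := by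
    simp only [qf, Finset.mul_sum, ← Finset.sum_add_distrib]
    refine Finset.sum_congr rfl fun a _ => Finset.sum_congr rfl fun b _ => ?_
    ring
  rw [this, hs]; ring

lemma scalar_energy (k : ℕ) (hk : 2 ≤ k) (K η Z m q c e g e' J : ℝ) (hK : 1 ≤ K) (hZ : 1 / 2 ≤ Z)
    (hm : 1 ≤ m) (hq0 : 0 ≤ q)
    (hpsd : 0 ≤ η ^ 2 * q + 4 * η * Z * c + 4 * Z ^ 2 * e)
    (hq : K⁻¹ * g ^ 2 ≤ Z * q) (he : e ≤ K * Z ^ (k - 1) * e') (he' : 0 ≤ e')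
    (hJ : - K * (Z ^ (k + 1) + g) ≤ J) :
    1 / (4 * K) * (η ^ 2 * g ^ 2 / Z ^ 2) - (5 * K + K ^ 3 * 2 ^ k) * ((η ^ 2 + e') * Z ^ (k + 1)) ≤
      2 * η * c + m * η ^ 2 * q / Z + η ^ 2 * J := by
  have hZ0 : 0 < Z := by linarith
  have hK0 : 0 < K := by linarith
  have h1 : -(2 * Z * e) ≤ 2 * η * c + (1 / 2) * η ^ 2 * q / Z := by
    have : 0 ≤ (η ^ 2 * q + 4 * η * Z * c + 4 * Z ^ 2 * e) / (2 * Z) := by positivity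
    have e1 : (η ^ 2 * q + 4 * η * Z * c + 4 * Z ^ 2 * e) / (2 * Z) =
      (1 / 2) * η ^ 2 * q / Z + 2 * η * c + 2 * Z * e := by field_simp; ring
    linarith
  have h2 : (1 / 2) * η ^ 2 * q / Z ≤ (m - 1 / 2) * η ^ 2 * q / Z := by
    gcongr; linarith
  have h3 : 1 / (2 * K) * (η ^ 2 * g ^ 2 / Z ^ 2) ≤ (1 / 2) * η ^ 2 * q / Z := by
    have : 1 / 2 * (η ^ 2 / Z ^ 2) * (K⁻¹ * g ^ 2) ≤ 1 / 2 * (η ^ 2 / Z ^ 2) * (Z * q) := by gcongr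
    calc _ = 1 / 2 * (η ^ 2 / Z ^ 2) * (K⁻¹ * g ^ 2) := by field_simp
      _ ≤ _ := this
      _ = _ := by field_simp
  have hZk : Z ^ k ≤ 2 * Z ^ (k + 1) := by
    rw [pow_succ]
    have : 0 < Z ^ k := by positivity
    nlinarith
  have h4 : 2 * Z * e ≤ 4 * K * (e' * Z ^ (k + 1)) := by
    calc 2 * Z * e ≤ 2 * Z * (K * Z ^ (k - 1) * e') := by gcongr
      _ = 2 * K * e' * Z ^ k := by
        obtain ⟨j, rfl⟩ : ∃ j, k = j + 1 := ⟨k - 1, by omega⟩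
        simp only [Nat.add_sub_cancel, pow_succ]; ring
      _ ≤ 2 * K * e' * (2 * Z ^ (k + 1)) := by gcongr
      _ = _ := by ring
  have h5 : K * g ≤ 1 / (4 * K) * (g ^ 2 / Z ^ 2) + K ^ 3 * Z ^ 2 := by
    have : 0 ≤ 1 / (4 * K) * (g / Z - 2 * K ^ 2 * Z) ^ 2 := by positivity
    have e1 : 1 / (4 * K) * (g / Z - 2 * K ^ 2 * Z) ^ 2 =
        1 / (4 * K) * (g ^ 2 / Z ^ 2) + K ^ 3 * Z ^ 2 - K * g := by
      field_simp; ring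
    linarith
  have h6 : Z ^ 2 ≤ 2 ^ k * Z ^ (k + 1) := by
    obtain ⟨j, rfl⟩ : ∃ j, k = j + 2 := ⟨k - 2, by omega⟩
    have a1 : (1 : ℝ) ≤ (2 * Z) ^ (j + 1) := one_le_pow₀ (by linarith)
    have a2 : (2 : ℝ) ^ (j + 2) * Z ^ (j + 2 + 1) = 2 * Z ^ 2 * (2 * Z) ^ (j + 1) := by
      rw [mul_pow]; ring
    rw [a2]
    have : 0 < Z ^ 2 := by positivity
    nlinarith
  have h7 : η ^ 2 * (-K * (Z ^ (k + 1) + g)) ≤ η ^ 2 * J := by gcongr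
  have h8 : η ^ 2 * (K * g) ≤ η ^ 2 * (1 / (4 * K) * (g ^ 2 / Z ^ 2) + K ^ 3 * (2 ^ k * Z ^ (k + 1))) := by
    have : K ^ 3 * Z ^ 2 ≤ K ^ 3 * (2 ^ k * Z ^ (k + 1)) := by gcongr
    gcongr; linarith
  have hP : 0 < Z ^ (k + 1) := by positivity
  have h9 : 0 ≤ (5 * K + K ^ 3 * 2 ^ k) * (e' * Z ^ (k + 1)) - 4 * K * (e' * Z ^ (k + 1)) := by
    have : 0 ≤ (K + K ^ 3 * 2 ^ k) * (e' * Z ^ (k + 1)) := by positivity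
    linarith
  have h10 : 0 ≤ 4 * K * (η ^ 2 * Z ^ (k + 1)) := by positivity
  have e2 : 1 / (2 * K) * (η ^ 2 * g ^ 2 / Z ^ 2) = 2 * (1 / (4 * K) * (η ^ 2 * g ^ 2 / Z ^ 2)) := by
    field_simp; ring
  have e3 : η ^ 2 * (1 / (4 * K) * (g ^ 2 / Z ^ 2)) = 1 / (4 * K) * (η ^ 2 * g ^ 2 / Z ^ 2) := by ring
  have e4 : (m - 1 / 2) * η ^ 2 * q / Z = m * η ^ 2 * q / Z - (1 / 2) * η ^ 2 * q / Z := by ring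
  linarith [h1, h2, h3, h4, h7, h8, h9, h10, e2, e3, e4]

/-- structural pointwise conditions at `x` -/
def Pt (k : ℕ) (K : ℝ) (U z : (Fin n → ℝ) → ℝ) (x : Fin n → ℝ) : Prop :=
  K⁻¹ ≤ (U x ^ (n - k + 1))⁻¹ ∧ (U x ^ (n - k + 1))⁻¹ ≤ K ∧ 1 / 2 ≤ z x ∧
  (∀ ξ, K⁻¹ * normSq ξ ≤ z x * qf (newtonT (k - 1) (Wmat U x)) ξ ξ) ∧
  (∀ ξ, qf (newtonT (k - 1) (Wmat U x)) ξ ξ ≤ K * z x ^ (k - 1) * normSq ξ) ∧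
  - K * (z x ^ (k + 1) + vnorm (grad z x)) ≤
    ∑ b, ∑ a, newtonT (k - 1) (Wmat U x) a b * pd a (pd b z) x -
          Matrix.trace (newtonT (k - 1) (Wmat U x)) / U x * ∑ b, pd b U x * pd b z x

lemma normSq_nonneg' (ξ : Fin n → ℝ) : 0 ≤ normSq ξ := Finset.sum_nonneg fun _ _ => sq_nonneg _

lemma vnorm_sq (ξ : Fin n → ℝ) : vnorm ξ ^ 2 = normSq ξ := Real.sq_sqrt (normSq_nonneg' ξ)

lemma pd_rpow {z : (Fin n → ℝ) → ℝ} {x : Fin n → ℝ} (hz : DifferentiableAt ℝ z x) (h0 : 0 < z x)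
    (m : ℝ) (a : Fin n) : pd a (fun y => z y ^ m) x = m * z x ^ (m - 1) * pd a z x :=
  pd_comp hz (Real.hasDerivAt_rpow_const (Or.inl h0.ne')) a

lemma contDiff_rpow_pos {z : (Fin n → ℝ) → ℝ} (hz : ContDiff ℝ 1 z) (h0 : ∀ x, 0 < z x) (m : ℝ) :
    ContDiff ℝ 1 fun y => z y ^ m :=
  hz.rpow_const_of_ne fun x => (h0 x).ne'

lemma pt_energy (k : ℕ) (hk2 : 2 ≤ k) (hkn : k ≤ n) (K : ℝ) (hK : 1 ≤ K)
    {U z η : (Fin n → ℝ) → ℝ} (hU : ContDiff ℝ 2 U) (hz : ContDiff ℝ 2 z) (hη : ContDiff ℝ 1 η)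
    (m : ℝ) (hm : 1 ≤ m) (x : Fin n → ℝ) (hx : Pt k K U z x) :
    z x ^ m * (1 / (4 * K) * (η x ^ 2 * normSq (grad z x) / z x ^ 2) -
      (5 * K + K ^ 3 * 2 ^ k) * ((η x ^ 2 + normSq (grad η x)) * z x ^ (k + 1))) ≤
    ∑ b, ∑ a, newtonT (k - 1) (Wmat U x) a b * (pd a (fun y => η y ^ 2 * z y ^ m) x * pd b z x) +
      η x ^ 2 * z x ^ m * (∑ b, ∑ a, newtonT (k - 1) (Wmat U x) a b * pd a (pd b z) x -
          Matrix.trace (newtonT (k - 1) (Wmat U x)) / U x * ∑ b, pd b U x * pd b z x) := by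
  obtain ⟨h1, h2, h3, h4, h5, h6⟩ := hx
  have hz0 : 0 < z x := by linarith
  set T := newtonT (k - 1) (Wmat U x) with hT
  have hTs : T.IsSymm := newtonT_symm _ (Wmat_symm hU.contDiffAt) (k - 1) (by omega)
  have hdz : DifferentiableAt ℝ z x := hz.differentiable (by norm_num) x
  have hdη : DifferentiableAt ℝ η x := hη.differentiable (by norm_num) x
  have hp : ∀ a, pd a (fun y => η y ^ 2 * z y ^ m) x =
      z x ^ m * (2 * η x * pd a η x + m * η x ^ 2 / z x * pd a z x) := by
    intro a
    have d1 : DifferentiableAt ℝ (fun y => η y ^ 2) x := hdη.fun_pow 2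
    have d2 : DifferentiableAt ℝ (fun y => z y ^ m) x := hdz.rpow_const (Or.inl hz0.ne')
    rw [pd_mul d1 d2, pd_rpow hdz hz0, pd_comp hdη (hasDerivAt_pow 2 (η x)),
      Real.rpow_sub_one hz0.ne']
    push_cast; ring
  have hsum : ∑ b, ∑ a, T a b * (pd a (fun y => η y ^ 2 * z y ^ m) x * pd b z x) =
      z x ^ m * (2 * η x * qf T (grad η x) (grad z x) +
        m * η x ^ 2 * qf T (grad z x) (grad z x) / z x) := by
    simp only [hp, qf, grad, Finset.mul_sum, Finset.sum_div, ← Finset.sum_add_distrib]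
    refine Finset.sum_congr rfl fun b _ => Finset.sum_congr rfl fun a _ => ?_
    ring
  rw [hsum]
  have hK0 : 0 < K := by linarith
  have hpos : ∀ ξ, 0 ≤ qf T ξ ξ := by
    intro ξ
    have a1 := h4 ξ
    have a2 : 0 ≤ K⁻¹ * normSq ξ := mul_nonneg (by positivity) (normSq_nonneg' ξ)
    by_contra hneg
    push Not at hneg
    nlinarith
  have hpsd := hpos (fun i => η x * grad z x i + (2 * z x) * grad η x i)
  rw [qf_comb T hTs] at hpsd
  have key := scalar_energy k hk2 K (η x) (z x) m (qf T (grad z x) (grad z x))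
    (qf T (grad η x) (grad z x)) (qf T (grad η x) (grad η x)) (vnorm (grad z x)) (normSq (grad η x)) _
    hK h3 hm (hpos _) (by linarith) (by rw [vnorm_sq]; exact h4 _) (h5 _) (normSq_nonneg' _) h6
  rw [vnorm_sq] at key
  have := mul_le_mul_of_nonneg_left key (Real.rpow_nonneg hz0.le m)
  linarith

lemma int_of_off {f η : (Fin n → ℝ) → ℝ} (hf : Continuous f) (hηc : HasCompactSupport η)
    (h : ∀ x ∉ tsupport η, f x = 0) : Integrable f :=
  hf.integrable_of_hasCompactSupport (HasCompactSupport.intro hηc.isCompact h)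

lemma pd_off {η : (Fin n → ℝ) → ℝ} {x : Fin n → ℝ} (hx : x ∉ tsupport η) (a : Fin n) :
    pd a η x = 0 := by
  have : η =ᶠ[nhds x] 0 := notMem_tsupport_iff_eventuallyEq.1 hx
  rw [pd, this.fderiv_eq]; simp

lemma continuous_normSq_grad {z : (Fin n → ℝ) → ℝ} (hz : ContDiff ℝ 1 z) :
    Continuous fun x => normSq (grad z x) :=
  continuous_finsetSum _ fun i _ => (continuous_pd hz i).pow 2

lemma energy_int (k : ℕ) (hk2 : 2 ≤ k) (hkn : k ≤ n) (K : ℝ) (hK : 1 ≤ K)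
    {U z η : (Fin n → ℝ) → ℝ} (hU : ContDiff ℝ 2 U) (h0 : ∀ x, 0 < U x)
    (hUc : HasCompactSupport fun x => 1 - U x) (hz : ContDiff ℝ 2 z) (hz0 : ∀ x, 0 < z x)
    (hη : ContDiff ℝ 1 η) (hηc : HasCompactSupport η)
    (m : ℝ) (hm : 1 ≤ m) (hx : ∀ x ∈ tsupport η, Pt k K U z x) :
    ∫ x, z x ^ m * (η x ^ 2 * normSq (grad z x) / z x ^ 2) ≤
      4 * K ^ 3 * (5 * K + K ^ 3 * 2 ^ k) *
        ∫ x, z x ^ m * ((η x ^ 2 + normSq (grad η x)) * z x ^ (k + 1)) := by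
  have hK0 : 0 < K := by linarith
  have hz1 : ContDiff ℝ 1 z := hz.of_le (by norm_num)
  have hzm := contDiff_rpow_pos hz1 hz0 m
  have hζ : ContDiff ℝ 1 fun y => η y ^ 2 * z y ^ m := (hη.pow 2).mul hzm
  have hζc : HasCompactSupport fun y => η y ^ 2 * z y ^ m := (hcs_sq hηc).mul_right
  have hw := weak_id k hk2 hkn hU h0 hUc hz hζ hζc
  have hoff : ∀ x ∉ tsupport η, η x = 0 := fun x hx => image_eq_zero_of_notMem_tsupport hx
  have hgoff : ∀ x ∉ tsupport η, normSq (grad η x) = 0 := by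
    intro x hx
    simp only [normSq, grad, pd_off hx]; simp
  have hζoff : ∀ x ∉ tsupport η, ∀ a, pd a (fun y => η y ^ 2 * z y ^ m) x = 0 := by
    intro x hx a
    refine pd_off (fun h => hx ?_) a
    exact closure_mono (fun y hy => by
      intro h; exact hy (by simp [h])) h
  have hT := newton_W_cont hU h0 (k - 1) (by omega)
  have hρ : Continuous fun x => (U x ^ (n - k + 1))⁻¹ :=
    (hU.continuous.pow _).inv₀ fun x => pow_ne_zero _ (h0 x).ne'
  have hz1' : ∀ b, ContDiff ℝ 1 (pd b z) := fun b => contDiff_pd hz (by norm_num) b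
  let A : (Fin n → ℝ) → ℝ := fun x => (U x ^ (n - k + 1))⁻¹ *
        ∑ b, ∑ a, newtonT (k - 1) (Wmat U x) a b * (pd a (fun y => η y ^ 2 * z y ^ m) x * pd b z x)
  let B : (Fin n → ℝ) → ℝ := fun x => (U x ^ (n - k + 1))⁻¹ * (η x ^ 2 * z x ^ m *
        (∑ b, ∑ a, newtonT (k - 1) (Wmat U x) a b * pd a (pd b z) x -
          Matrix.trace (newtonT (k - 1) (Wmat U x)) / U x * ∑ b, pd b U x * pd b z x))
  have iA : Integrable A := by
    refine int_of_off (η := η) ?_ hηc ?_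
    · exact hρ.mul (continuous_finsetSum _ fun b _ => continuous_finsetSum _ fun a _ =>
        (hT a b).mul ((continuous_pd hζ a).mul (continuous_pd hz1 b)))
    · intro x hx; simp only [A, hζoff x hx]; simp
  have iB : Integrable B := by
    refine int_of_off (η := η) ?_ hηc ?_
    · refine hρ.mul (hζ.continuous.mul (Continuous.sub ?_ (Continuous.mul (Continuous.div ?_
        hU.continuous fun x => (h0 x).ne') ?_)))
      · exact continuous_finsetSum _ fun b _ => continuous_finsetSum _ fun a _ =>
          (hT a b).mul (continuous_pd (hz1' b) a)
      · simp only [Matrix.trace, Matrix.diag_apply]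
        exact continuous_finsetSum _ fun a _ => hT a a
      · exact continuous_finsetSum _ fun b _ =>
          (continuous_pd (hU.of_le (by norm_num)) b).mul (continuous_pd hz1 b)
    · intro x hx; simp only [B, hoff x hx]; simp
  have hAB : ∫ x, (A x + B x) = 0 := by
    rw [integral_add iA iB]
    have : ∫ x, A x = - ∫ x, B x := hw
    rw [this]; ring
  let a : (Fin n → ℝ) → ℝ := fun x => z x ^ m * (η x ^ 2 * normSq (grad z x) / z x ^ 2)
  let b : (Fin n → ℝ) → ℝ := fun x => z x ^ m * ((η x ^ 2 + normSq (grad η x)) * z x ^ (k + 1))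
  have ia : Integrable a := by
    refine int_of_off (η := η) ?_ hηc ?_
    · exact hzm.continuous.mul (((hη.continuous.pow 2).mul (continuous_normSq_grad hz1)).div
        (hz.continuous.pow 2) fun x => (pow_pos (hz0 x) 2).ne')
    · intro x hx; simp only [a, hoff x hx]; simp
  have ib : Integrable b := by
    refine int_of_off (η := η) ?_ hηc ?_
    · exact hzm.continuous.mul (((hη.continuous.pow 2).add (continuous_normSq_grad hη)).mul
        (hz.continuous.pow (k + 1)))
    · intro x hx; simp only [b, hoff x hx, hgoff x hx]; simp
  set C1 := 5 * K + K ^ 3 * 2 ^ k with hC1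
  have hC10 : 0 ≤ C1 := by positivity
  have hpt : ∀ x, K⁻¹ * (1 / (4 * K)) * a x - K * C1 * b x ≤ A x + B x := by
    intro x
    by_cases hxs : x ∈ tsupport η
    · have h := pt_energy k hk2 hkn K hK hU hz hη m hm x (hx x hxs)
      obtain ⟨h1, h2, -⟩ := hx x hxs
      have ha0 : 0 ≤ a x := mul_nonneg (Real.rpow_nonneg (hz0 x).le _)
        (div_nonneg (mul_nonneg (sq_nonneg _) (normSq_nonneg' _)) (sq_nonneg _))
      have hb0 : 0 ≤ b x := mul_nonneg (Real.rpow_nonneg (hz0 x).le _)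
        (mul_nonneg (add_nonneg (sq_nonneg _) (normSq_nonneg' _)) (pow_nonneg (hz0 x).le _))
      set ρ := (U x ^ (n - k + 1))⁻¹ with hρd
      have hρ0 : 0 < ρ := lt_of_lt_of_le (by positivity) h1
      have h' := mul_le_mul_of_nonneg_left h hρ0.le
      have e1 : ρ * (z x ^ m * (1 / (4 * K) * (η x ^ 2 * normSq (grad z x) / z x ^ 2) -
          C1 * ((η x ^ 2 + normSq (grad η x)) * z x ^ (k + 1)))) =
          ρ * (1 / (4 * K)) * a x - ρ * C1 * b x := by simp only [a, b]; ring
      rw [e1] at h'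
      have e2 : A x + B x = ρ * (∑ b, ∑ a, newtonT (k - 1) (Wmat U x) a b *
          (pd a (fun y => η y ^ 2 * z y ^ m) x * pd b z x) +
          η x ^ 2 * z x ^ m * (∑ b, ∑ a, newtonT (k - 1) (Wmat U x) a b * pd a (pd b z) x -
          Matrix.trace (newtonT (k - 1) (Wmat U x)) / U x * ∑ b, pd b U x * pd b z x)) := by
        simp only [A, B]; ring
      rw [e2]
      refine le_trans ?_ h'
      have q1 : K⁻¹ * (1 / (4 * K)) * a x ≤ ρ * (1 / (4 * K)) * a x := by gcongr
      have q2 : ρ * C1 * b x ≤ K * C1 * b x := by gcongr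
      linarith
    · simp only [A, B, a, b, hζoff x hxs, hoff x hxs, hgoff x hxs]; simp
  have hfin : ∫ x, (K⁻¹ * (1 / (4 * K)) * a x - K * C1 * b x) ≤ ∫ x, (A x + B x) :=
    integral_mono ((ia.const_mul _).sub (ib.const_mul _)) (iA.add iB) hpt
  rw [hAB, integral_sub (ia.const_mul _) (ib.const_mul _), integral_const_mul,
    integral_const_mul] at hfin
  have h4 : K⁻¹ * (1 / (4 * K)) * ∫ x, a x ≤ K * C1 * ∫ x, b x := by linarith
  have h5 := mul_le_mul_of_nonneg_left h4 (show 0 ≤ 4 * K ^ 2 by positivity)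
  calc ∫ x, a x = 4 * K ^ 2 * (K⁻¹ * (1 / (4 * K)) * ∫ x, a x) := by field_simp
    _ ≤ _ := h5
    _ = _ := by ring

end ENERGYsec
open MeasureTheory Metric Set Matrix

noncomputable section STEPsec

variable {n : ℕ}

lemma pt_grad_sq {η z : (Fin n → ℝ) → ℝ} {x : Fin n → ℝ} (hη : DifferentiableAt ℝ η x)
    (hz : DifferentiableAt ℝ z x) (h0 : 0 < z x) (m : ℝ) :
    ∑ i, pd i (fun y => η y * z y ^ (m / 2)) x ^ 2 ≤
      2 * (normSq (grad η x) * z x ^ m) +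
        m ^ 2 / 2 * (z x ^ m * (η x ^ 2 * normSq (grad z x) / z x ^ 2)) := by
  have hd : DifferentiableAt ℝ (fun y => z y ^ (m / 2)) x :=
    hz.rpow_const (Or.inl h0.ne')
  have e1 : z x ^ (m / 2) * z x ^ (m / 2) = z x ^ m := by
    rw [← Real.rpow_add h0]; ring_nf
  have e2 : z x ^ (m / 2 - 1) = z x ^ (m / 2) / z x := by
    rw [Real.rpow_sub_one h0.ne']
  have key : ∀ i, pd i (fun y => η y * z y ^ (m / 2)) x ^ 2 ≤
      2 * (pd i η x ^ 2 * z x ^ m) +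
        m ^ 2 / 2 * (z x ^ m * (η x ^ 2 * pd i z x ^ 2 / z x ^ 2)) := by
    intro i
    rw [pd_mul hη hd, pd_rpow hz h0, e2]
    have : ∀ a b : ℝ, (a + b) ^ 2 ≤ 2 * a ^ 2 + 2 * b ^ 2 := fun a b => by
      nlinarith [sq_nonneg (a - b)]
    refine (this _ _).trans (le_of_eq ?_)
    rw [← e1]; field_simp
  refine (Finset.sum_le_sum fun i _ => key i).trans (le_of_eq ?_)
  rw [Finset.sum_add_distrib]
  simp only [normSq, grad, Finset.mul_sum, Finset.sum_mul, Finset.sum_div]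

set_option maxHeartbeats 2000000 in
lemma step_z (hn : 3 ≤ n) (k : ℕ) (hk2 : 2 ≤ k) (hkn : k ≤ n) (K : ℝ) (hK : 1 ≤ K) (R : ℝ)
    (hR : 0 < R) : ∃ C0 : ℝ, 0 < C0 ∧ ∀ (x₀ : Fin n → ℝ) (U z : (Fin n → ℝ) → ℝ),
      ContDiff ℝ 2 U → (∀ x, 0 < U x) → (HasCompactSupport fun x => 1 - U x) → ContDiff ℝ 2 z →
      (∀ x, 0 < z x) → ∀ m r r' : ℝ, 1 ≤ m → R ≤ r' → r' < r → r ≤ 3 * R / 2 →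
      (∀ x ∈ ball x₀ r, Pt k K U z x) →
      ∫ x in ball x₀ r', z x ^ (m * ((n : ℝ) / (n - 2))) ≤
        (C0 * m ^ 2 / (r - r') ^ 2 * ∫ x in ball x₀ r, z x ^ (m + k + 1)) ^ ((n : ℝ) / (n - 2)) := by
  obtain ⟨CS, hCS0, hCS⟩ := sobolev hn
  obtain ⟨L, hL0, hL⟩ := cutoff
  set CE := 4 * K ^ 3 * (5 * K + K ^ 3 * 2 ^ k) with hCE
  have hK0 : 0 < K := by linarith
  have hCE0 : 0 < CE := by positivity
  have hn2 : (0 : ℝ) < (n : ℝ) - 2 := by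
    have : (3 : ℝ) ≤ n := by exact_mod_cast hn
    linarith
  have hχ : 0 < (n : ℝ) / (n - 2) := by positivity
  refine ⟨CS * (2 ^ (k + 2) + CE) * (R ^ 2 + n * L ^ 2), by positivity, ?_⟩
  intro x₀ U z hU h0 hUc hz hz0 m r r' hm hr' hrr hr hPt
  obtain ⟨η, hη2, hηn, hη1, hηe, hηs, hηd⟩ := hL n x₀ r r' (by linarith) hrr
  have hη : ContDiff ℝ 1 η := hη2.of_le (by norm_num)
  have hz1 : ContDiff ℝ 1 z := hz.of_le (by norm_num)
  have hzm := contDiff_rpow_pos hz1 hz0 m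
  have hzm2 := contDiff_rpow_pos hz1 hz0 (m / 2)
  have hsub : tsupport η ⊆ ball x₀ r :=
    hηs.trans (closedBall_subset_ball (by linarith))
  have hηc : HasCompactSupport η :=
    HasCompactSupport.of_support_subset_isCompact (isCompact_closedBall x₀ ((r + r') / 2))
      ((subset_tsupport η).trans hηs)
  have hen := energy_int k hk2 hkn K hK hU h0 hUc hz hz0 hη hηc m hm
    (fun x hx => hPt x (hsub hx))
  rw [← hCE] at hen
  set I := ∫ x, z x ^ m * ((η x ^ 2 + normSq (grad η x)) * z x ^ (k + 1)) with hI
  have hoff : ∀ x ∉ tsupport η, η x = 0 := fun x hx => image_eq_zero_of_notMem_tsupport hx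
  have hgoff : ∀ x ∉ tsupport η, normSq (grad η x) = 0 := by
    intro x hx
    simp only [normSq, grad, pd_off hx]; simp
  have hcη : Continuous fun x => normSq (grad η x) := continuous_normSq_grad hη
  have hcz : Continuous fun x => normSq (grad z x) := continuous_normSq_grad hz1
  have hzc := hz.continuous
  have hcont1 : Continuous fun x => z x ^ m * ((η x ^ 2 + normSq (grad η x)) * z x ^ (k + 1)) :=
    hzm.continuous.mul (((hη.continuous.pow 2).add hcη).mul (hzc.pow _))
  have hcont2 : Continuous fun x => z x ^ m * (η x ^ 2 * normSq (grad z x) / z x ^ 2) :=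
    hzm.continuous.mul (((hη.continuous.pow 2).mul hcz).div₀ (hzc.pow _)
      fun x => pow_ne_zero _ (hz0 x).ne')
  have hint1 := int_of_off hcont1 hηc (fun x hx => by simp [hoff x hx, hgoff x hx])
  have hint2 := int_of_off hcont2 hηc (fun x hx => by simp [hoff x hx])
  set g : (Fin n → ℝ) → ℝ := fun y => η y * z y ^ (m / 2) with hg
  have hg1 : ContDiff ℝ 1 g := hη.mul hzm2
  have hgc : HasCompactSupport g := hηc.mul_right
  have hS := hCS g hg1 hgc
  -- gradient bound
  have hgrad : ∫ x, ∑ i, pd i g x ^ 2 ≤ m ^ 2 * (2 ^ (k + 2) + CE) * I := by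
    have hc3 : Continuous fun x => ∑ i, pd i g x ^ 2 :=
      continuous_finsetSum _ fun i _ => (continuous_pd hg1 i).pow 2
    have hgoff' : ∀ x ∉ tsupport η, ∀ a, pd a g x = 0 := by
      intro x hx a
      refine pd_off (fun h => hx ?_) a
      exact closure_mono (fun y hy => by
        intro h; exact hy (by simp [hg, h])) h
    have hint3 := int_of_off hc3 hηc (fun x hx => by simp [hgoff' x hx])
    calc ∫ x, ∑ i, pd i g x ^ 2 ≤
        ∫ x, (2 ^ (k + 2) * (z x ^ m * ((η x ^ 2 + normSq (grad η x)) * z x ^ (k + 1))) +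
          m ^ 2 / 2 * (z x ^ m * (η x ^ 2 * normSq (grad z x) / z x ^ 2))) := by
          refine integral_mono hint3 ((hint1.const_mul _).add (hint2.const_mul _)) fun x => ?_
          refine (pt_grad_sq (hη.differentiable (by norm_num) x)
            (hz1.differentiable (by norm_num) x) (hz0 x) m).trans ?_
          refine add_le_add ?_ le_rfl
          by_cases hx : x ∈ tsupport η
          · have hzz : 1 / 2 ≤ z x := (hPt x (hsub hx)).2.2.1
            have h1 : 1 ≤ 2 ^ (k + 1) * z x ^ (k + 1) := by
              rw [← mul_pow]; exact one_le_pow₀ (by linarith)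
            have h2 : 0 ≤ z x ^ m := Real.rpow_nonneg (hz0 x).le _
            have h3 := normSq_nonneg' (grad η x)
            calc 2 * (normSq (grad η x) * z x ^ m)
                ≤ 2 * (normSq (grad η x) * z x ^ m) * (2 ^ (k + 1) * z x ^ (k + 1)) :=
                  le_mul_of_one_le_right (by positivity) h1
              _ ≤ 2 * ((η x ^ 2 + normSq (grad η x)) * z x ^ m) * (2 ^ (k + 1) * z x ^ (k + 1)) := by
                  gcongr; nlinarith [sq_nonneg (η x)]
              _ = _ := by ring
          · simp [hoff x hx, hgoff x hx]
      _ = 2 ^ (k + 2) * I + m ^ 2 / 2 * ∫ x, z x ^ m * (η x ^ 2 * normSq (grad z x) / z x ^ 2) := by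
          rw [integral_add (hint1.const_mul _) (hint2.const_mul _), integral_const_mul,
            integral_const_mul]
      _ ≤ 2 ^ (k + 2) * I + m ^ 2 / 2 * (CE * I) := by gcongr
      _ ≤ _ := by
          have hI0 : 0 ≤ I := integral_nonneg fun x => by
            have := (hz0 x).le
            have h3 := normSq_nonneg' (grad η x)
            have h2 : 0 ≤ z x ^ m := Real.rpow_nonneg (hz0 x).le _
            simp only [Pi.zero_apply]
            positivity
          have hm2 : 1 ≤ m ^ 2 := one_le_pow₀ hm
          have : 0 ≤ 2 ^ (k + 2) * I := by positivity
          have h5 : 0 ≤ m ^ 2 * (CE * I) := by positivity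
          nlinarith
  have hIb : I ≤ (R ^ 2 + n * L ^ 2) / (r - r') ^ 2 * ∫ x in ball x₀ r, z x ^ (m + k + 1) := by
    have hd : 0 < r - r' := by linarith
    have : I = ∫ x in ball x₀ r, z x ^ m * ((η x ^ 2 + normSq (grad η x)) * z x ^ (k + 1)) := by
      rw [hI]; symm
      refine setIntegral_eq_integral_of_forall_compl_eq_zero fun x hx => ?_
      have hx' : x ∉ tsupport η := fun h => hx (hsub h)
      simp [hoff x hx', hgoff x hx']
    rw [this, ← integral_const_mul]
    have hzmk := (contDiff_rpow_pos hz1 hz0 (m + k + 1)).continuous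
    refine setIntegral_mono_on hint1.integrableOn
      ((integrableOn_ball hzmk.continuousOn).const_mul _) measurableSet_ball fun x _ => ?_
    have e1 : z x ^ (m + k + 1) = z x ^ m * z x ^ (k + 1) := by
      rw [← Real.rpow_natCast, ← Real.rpow_add (hz0 x)]; push_cast; ring_nf
    rw [e1]
    have h2 : 0 ≤ z x ^ m := Real.rpow_nonneg (hz0 x).le _
    have h4 : η x ^ 2 + normSq (grad η x) ≤ (R ^ 2 + n * L ^ 2) / (r - r') ^ 2 := by
      have a1 : η x ^ 2 ≤ 1 := pow_le_one₀ (hηn x) (hη1 x)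
      have a2 : normSq (grad η x) ≤ n * (L / (r - r')) ^ 2 := by
        calc normSq (grad η x) ≤ ∑ _i : Fin n, (L / (r - r')) ^ 2 := by
              refine Finset.sum_le_sum fun i _ => ?_
              rw [← sq_abs]
              exact pow_le_pow_left₀ (abs_nonneg _) (hηd i x) 2
          _ = _ := by simp
      have a3 : 1 ≤ R ^ 2 / (r - r') ^ 2 := by
        rw [le_div_iff₀ (by positivity), one_mul]
        exact pow_le_pow_left₀ hd.le (by linarith) 2
      calc _ ≤ R ^ 2 / (r - r') ^ 2 + n * (L / (r - r')) ^ 2 := by linarith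
        _ = _ := by rw [div_pow]; ring
    have h5 : 0 ≤ z x ^ (k + 1) := pow_nonneg (hz0 x).le _
    calc _ ≤ z x ^ m * ((R ^ 2 + n * L ^ 2) / (r - r') ^ 2 * z x ^ (k + 1)) := by gcongr
      _ = _ := by ring
  have hleft : ∫ x in ball x₀ r', z x ^ (m * ((n : ℝ) / (n - 2))) ≤
      ∫ x, |g x| ^ (2 * ((n : ℝ) / (n - 2))) := by
    have hc4 : Continuous fun x => |g x| ^ (2 * ((n : ℝ) / (n - 2))) :=
      (hg1.continuous.abs).rpow_const fun x => Or.inr (by positivity)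
    have hint4 := int_of_off hc4 hηc (fun x hx => by
      simp only [hg, hoff x hx, zero_mul, abs_zero]
      exact Real.zero_rpow (by positivity))
    calc _ = ∫ x in ball x₀ r', |g x| ^ (2 * ((n : ℝ) / (n - 2))) := by
          refine setIntegral_congr_fun measurableSet_ball fun x hx => ?_
          simp only [hg, hηe x hx, one_mul]
          rw [abs_of_pos (Real.rpow_pos_of_pos (hz0 x) _), ← Real.rpow_mul (hz0 x).le]
          congr 1; ring
      _ ≤ _ := setIntegral_le_integral hint4 (Filter.Eventually.of_forall fun x => by
          exact Real.rpow_nonneg (abs_nonneg _) _)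
  refine hleft.trans (hS.trans ?_)
  have hnn : 0 ≤ ∫ x, ∑ i, pd i g x ^ 2 :=
    integral_nonneg fun x => Finset.sum_nonneg fun i _ => sq_nonneg _
  refine Real.rpow_le_rpow (by positivity) ?_ hχ.le
  calc CS * ∫ x, ∑ i, pd i g x ^ 2 ≤ CS * (m ^ 2 * (2 ^ (k + 2) + CE) * I) := by gcongr
    _ ≤ CS * (m ^ 2 * (2 ^ (k + 2) + CE) *
        ((R ^ 2 + n * L ^ 2) / (r - r') ^ 2 * ∫ x in ball x₀ r, z x ^ (m + k + 1))) := by gcongr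
    _ = _ := by ring

lemma pd_congr {u v : (Fin n → ℝ) → ℝ} {x : Fin n → ℝ} (h : u =ᶠ[nhds x] v) (i : Fin n) :
    pd i u x = pd i v x := by
  simp only [pd]; rw [h.fderiv_eq]

lemma pd_congr' {u v : (Fin n → ℝ) → ℝ} {x : Fin n → ℝ} (h : u =ᶠ[nhds x] v) (i : Fin n) :
    pd i u =ᶠ[nhds x] pd i v := by
  filter_upwards [h.eventuallyEq_nhds] with y hy using pd_congr hy i

lemma grad_congr {u v : (Fin n → ℝ) → ℝ} {x : Fin n → ℝ} (h : u =ᶠ[nhds x] v) :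
    grad u x = grad v x := by
  funext i; exact pd_congr h i

lemma hess_congr {u v : (Fin n → ℝ) → ℝ} {x : Fin n → ℝ} (h : u =ᶠ[nhds x] v) :
    hess u x = hess v x := by
  ext i j; exact pd_congr (pd_congr' h j) i

lemma Pt_congr {k : ℕ} {K : ℝ} {U z z' : (Fin n → ℝ) → ℝ} {x : Fin n → ℝ} (h : z =ᶠ[nhds x] z')
    (hz : Pt k K U z x) : Pt k K U z' x := by
  unfold Pt at *
  have e0 := h.eq_of_nhds
  have e1 := grad_congr h
  have e2 : ∀ i, pd i z x = pd i z' x := fun i => pd_congr h i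
  have e3 : ∀ i j, pd i (pd j z) x = pd i (pd j z') x := fun i j => pd_congr (pd_congr' h j) i
  simpa only [e0, e1, e2, e3] using hz

/-- positive extension -/
lemma extend_pos {z : (Fin n → ℝ) → ℝ} {V : Set (Fin n → ℝ)} (hV : IsOpen V)
    (hz : ContDiffOn ℝ 2 z V) (x₀ : Fin n → ℝ) {r r' : ℝ} (hr' : 0 < r') (hrr : r' < r)
    (hB : ball x₀ r ⊆ V) (hz0 : ∀ x ∈ ball x₀ r, 0 < z x) :
    ∃ w : (Fin n → ℝ) → ℝ, ContDiff ℝ 2 w ∧ (∀ x, 0 < w x) ∧ (HasCompactSupport fun x => 1 - w x) ∧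
      (∀ x ∈ ball x₀ r', w x = z x) := by
  obtain ⟨L, hL0, hL⟩ := cutoff
  obtain ⟨η, hη2, hηn, hη1, hηe, hηs, hηd⟩ := hL n x₀ r r' hr' hrr
  have hsub : tsupport η ⊆ ball x₀ r :=
    hηs.trans (closedBall_subset_ball (by linarith))
  have hoff : ∀ x ∉ tsupport η, η x = 0 := fun x hx => image_eq_zero_of_notMem_tsupport hx
  refine ⟨fun x => η x * z x + (1 - η x), ?_, ?_, ?_, ?_⟩
  · rw [contDiff_iff_contDiffAt]
    intro x
    refine ContDiffAt.add ?_ (contDiffAt_const.sub hη2.contDiffAt)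
    by_cases hx : x ∈ tsupport η
    · exact hη2.contDiffAt.mul (hz.contDiffAt (hV.mem_nhds (hB (hsub hx))))
    · have : (fun x => η x * z x) =ᶠ[nhds x] fun _ => 0 := by
        filter_upwards [(isClosed_tsupport η).isOpen_compl.mem_nhds hx] with y hy
        rw [hoff y hy, zero_mul]
      exact (contDiffAt_const (c := (0 : ℝ))).congr_of_eventuallyEq this
  · intro x
    by_cases hx : x ∈ tsupport η
    · have h1 := hz0 x (hsub hx)
      have h2 := hηn x
      have h3 := hη1 x
      rcases h2.eq_or_lt with h | h
      · simp [← h]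
      · have := mul_pos h h1
        simp only; linarith
    · simp [hoff x hx]
  · refine HasCompactSupport.of_support_subset_isCompact (isCompact_closedBall x₀ ((r + r') / 2))
      fun x hx => ?_
    by_contra h
    have h1 : x ∉ tsupport η := fun h' => h (hηs h')
    apply hx
    simp [hoff x h1]
  · intro x hx
    simp [hηe x hx]

lemma step_zhat (hn : 3 ≤ n) (k : ℕ) (hk2 : 2 ≤ k) (hkn : k ≤ n) (K : ℝ) (hK : 1 ≤ K) (R : ℝ)
    (hR : 0 < R) : ∃ C0 : ℝ, 0 < C0 ∧ ∀ (x₀ : Fin n → ℝ) (U z : (Fin n → ℝ) → ℝ),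
      ContDiff ℝ 2 U → (∀ x, 0 < U x) → (HasCompactSupport fun x => 1 - U x) → ContDiff ℝ 2 z →
      ∀ m r r' : ℝ, 1 ≤ m → R ≤ r' → r' < r → r ≤ 3 * R / 2 →
      (∀ x ∈ ball x₀ r, Pt k K U z x) →
      ∫ x in ball x₀ r', z x ^ (m * ((n : ℝ) / (n - 2))) ≤
        (C0 * m ^ 2 / (r - r') ^ 2 * ∫ x in ball x₀ r, z x ^ (m + k + 1)) ^ ((n : ℝ) / (n - 2)) := by
  obtain ⟨C0, hC0, hC⟩ := step_z hn k hk2 hkn K hK R hR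
  refine ⟨4 * C0, by positivity, ?_⟩
  intro x₀ U z hU h0 hUc hz m r r' hm hr' hrr hr hPt
  have hz0 : ∀ x ∈ ball x₀ r, 0 < z x := fun x hx => by
    have := (hPt x hx).2.2.1; linarith
  obtain ⟨w, hw, hw0, -, hwz⟩ := extend_pos isOpen_univ hz.contDiffOn x₀
    (r := r) (r' := (r + r') / 2) (by linarith) (by linarith) (subset_univ _) hz0
  have hs : ball x₀ ((r + r') / 2) ⊆ ball x₀ r := ball_subset_ball (by linarith)
  have hs' : ball x₀ r' ⊆ ball x₀ ((r + r') / 2) := ball_subset_ball (by linarith)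
  have := hC x₀ U w hU h0 hUc hw hw0 m ((r + r') / 2) r' hm hr' (by linarith) (by linarith)
    (fun x hx => Pt_congr (by
      filter_upwards [isOpen_ball.mem_nhds hx] with y hy using (hwz y hy).symm) (hPt x (hs hx)))
  have e1 : ∫ x in ball x₀ r', w x ^ (m * ((n : ℝ) / (n - 2))) =
      ∫ x in ball x₀ r', z x ^ (m * ((n : ℝ) / (n - 2))) :=
    setIntegral_congr_fun measurableSet_ball fun x hx => by simp only [hwz x (hs' hx)]
  have e2 : ∫ x in ball x₀ ((r + r') / 2), w x ^ (m + k + 1) =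
      ∫ x in ball x₀ ((r + r') / 2), z x ^ (m + k + 1) :=
    setIntegral_congr_fun measurableSet_ball fun x hx => by simp only [hwz x hx]
  rw [e1, e2] at this
  refine this.trans ?_
  have hn2 : (0 : ℝ) < (n : ℝ) - 2 := by
    have : (3 : ℝ) ≤ n := by exact_mod_cast hn
    linarith
  have hd : 0 < r - r' := by linarith
  have hnn : 0 ≤ ∫ x in ball x₀ ((r + r') / 2), z x ^ (m + k + 1) :=
    setIntegral_nonneg measurableSet_ball fun x hx => Real.rpow_nonneg (hz0 x (hs hx)).le _
  have hle : ∫ x in ball x₀ ((r + r') / 2), z x ^ (m + k + 1) ≤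
      ∫ x in ball x₀ r, z x ^ (m + k + 1) := by
    refine setIntegral_mono_set ?_ ?_ (Filter.Eventually.of_forall hs)
    · refine (integrableOn_ball (F := fun x => z x ^ (m + k + 1)) ?_)
      refine ContinuousOn.rpow_const hz.continuous.continuousOn fun x _ => Or.inr ?_
      positivity
    · exact (ae_restrict_iff' measurableSet_ball).2 (Filter.Eventually.of_forall fun x hx =>
        Real.rpow_nonneg (hz0 x hx).le _)
  refine Real.rpow_le_rpow (by positivity) ?_ (by positivity)
  have e3 : C0 * m ^ 2 / ((r + r') / 2 - r') ^ 2 = 4 * C0 * m ^ 2 / (r - r') ^ 2 := by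
    rw [show (r + r') / 2 - r' = (r - r') / 2 by ring]; field_simp; norm_num
  rw [e3]; gcongr

end STEPsec
open MeasureTheory Metric Set Matrix

noncomputable section DIFFsec

variable {n : ℕ}

lemma f_facts {E : Type*} [NormedAddCommGroup E] [NormedSpace ℝ E] (D Q : Set E) (hD : IsOpen D)
    (f : E → ℝ) (hpos : ∀ y ∈ D, 0 < f y) (hf : C11On f D) (hQ : IsCompact Q) (hQc : Convex ℝ Q)
    (hQD : Q ⊆ D) : ∃ c Λ : ℝ, 0 < c ∧ 0 < Λ ∧ ∀ y ∈ Q, c ≤ f y ∧ f y ≤ Λ ∧ ‖fderiv ℝ f y‖ ≤ Λ ∧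
      ∀ y' ∈ Q, f y + fderiv ℝ f y (y' - y) - Λ * ‖y' - y‖ ^ 2 ≤ f y' := by
  have hcf : ContinuousOn f Q := hf.1.continuousOn.mono hQD
  have heq : ∀ y ∈ D, fderivWithin ℝ f D y = fderiv ℝ f y := fun y hy =>
    fderivWithin_of_isOpen hD hy
  have hcd : ContinuousOn (fderiv ℝ f) Q :=
    (hf.1.continuousOn_fderiv_of_isOpen hD (by norm_num)).mono hQD
  obtain ⟨B1, hB1⟩ := hQ.exists_bound_of_continuousOn hcf
  obtain ⟨B2, hB2⟩ := hQ.exists_bound_of_continuousOn hcd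
  obtain ⟨c, hc0, hc⟩ : ∃ c : ℝ, 0 < c ∧ ∀ y ∈ Q, c ≤ f y := by
    rcases Q.eq_empty_or_nonempty with h | h
    · exact ⟨1, one_pos, by simp [h]⟩
    · obtain ⟨y, hy, hmin⟩ := hQ.exists_isMinOn h hcf
      exact ⟨f y, hpos y (hQD hy), fun w hw => hmin hw⟩
  have hll : LocallyLipschitzOn Q (fderiv ℝ f) := by
    intro x hx
    obtain ⟨K, t, ht, hK⟩ := hf.2 x (hQD hx)
    refine ⟨K, t ∩ Q, ?_, ?_⟩
    · rw [hD.nhdsWithin_eq (hQD hx)] at ht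
      exact Filter.inter_mem (mem_nhdsWithin_of_mem_nhds ht) self_mem_nhdsWithin
    · intro a ha b hb
      rw [← heq a (hQD ha.2), ← heq b (hQD hb.2)]
      exact hK ha.1 hb.1
  obtain ⟨K, hK⟩ := hll.exists_lipschitzOnWith_of_compact hQ
  refine ⟨c, |B1| + |B2| + K + 1, hc0, by positivity, fun y hy => ⟨hc y hy, ?_, ?_, ?_⟩⟩
  · have h1 := hB1 y hy
    have := le_abs_self (f y)
    have := le_abs_self B1
    have := abs_nonneg B2
    have := K.2
    rw [Real.norm_eq_abs] at h1
    simp only [NNReal.val_eq_coe] at *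
    linarith
  · have h1 := hB2 y hy
    have := le_abs_self B2
    have := abs_nonneg B1
    have := K.2
    simp only [NNReal.val_eq_coe] at *
    linarith
  · intro y' hy'
    have hseg : segment ℝ y y' ⊆ Q := hQc.segment_subset hy hy'
    have := Convex.norm_image_sub_le_of_norm_hasFDerivWithin_le' (f := f) (f' := fderiv ℝ f)
      (s := segment ℝ y y') (φ := fderiv ℝ f y) (C := K * ‖y' - y‖) (x := y) (y := y')
      (fun w hw => ((hf.1.contDiffAt (hD.mem_nhds (hQD (hseg hw)))).differentiableAt
        (by norm_num)).hasFDerivAt.hasFDerivWithinAt)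
      (fun w hw => by
        rw [← dist_eq_norm]
        refine (hK.dist_le_mul w (hseg hw) y hy).trans ?_
        gcongr
        rw [dist_comm, ← dist_eq_norm, dist_comm y' y]
        have h := dist_add_dist_of_mem_segment hw
        have := dist_nonneg (x := w) (y := y')
        linarith)
      (convex_segment y y') (left_mem_segment ℝ y y') (right_mem_segment ℝ y y')
    have h2 := (abs_le.1 ((Real.norm_eq_abs _).symm ▸ this)).1
    have h3 : (K : ℝ) * ‖y' - y‖ * ‖y' - y‖ ≤ (|B1| + |B2| + K + 1) * ‖y' - y‖ ^ 2 := by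
      have := abs_nonneg B1
      have := abs_nonneg B2
      have := sq_nonneg ‖y' - y‖
      nlinarith
    linarith

/-- signed shift vectors -/
def vv (h : ℝ) (j : Fin n × Bool) : Fin n → ℝ := Pi.single j.1 (if j.2 then h else -h)

/-- second difference operator -/
def Lh (h : ℝ) (F : (Fin n → ℝ) → ℝ) (x : Fin n → ℝ) : ℝ :=
  ∑ j : Fin n × Bool, (F (x + vv h j) - F x) / h ^ 2

lemma sum_vv (h : ℝ) : ∑ j : Fin n × Bool, vv h j = (0 : Fin n → ℝ) := by
  rw [Fintype.sum_prod_type]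
  refine Finset.sum_eq_zero fun l _ => ?_
  rw [Fintype.sum_bool]
  simp only [vv, if_true, Bool.false_eq_true, if_false]
  rw [← Pi.single_add]; simp

lemma norm_vv {h : ℝ} (hh : 0 ≤ h) (j : Fin n × Bool) : ‖vv h j‖ = h := by
  simp only [vv, Pi.norm_single]
  split_ifs <;> simp [abs_of_nonneg hh]

lemma vv_eq (h : ℝ) (j : Fin n × Bool) :
    vv h j = (if j.2 then h else -h) • (Pi.single j.1 1 : Fin n → ℝ) := by
  simp only [vv]; rw [← Pi.single_smul]; simp

lemma fderiv_vv (g : (Fin n → ℝ) → ℝ) (x : Fin n → ℝ) (h : ℝ) (j : Fin n × Bool) :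
    fderiv ℝ g x (vv h j) = (if j.2 then h else -h) * pd j.1 g x := by
  rw [vv_eq, map_smul]; rfl

lemma line_deriv {g : (Fin n → ℝ) → ℝ} (hg : Differentiable ℝ g) (x : Fin n → ℝ) (h : ℝ)
    (j : Fin n × Bool) (t : ℝ) :
    HasDerivAt (fun s : ℝ => g (x + s • vv h j)) ((if j.2 then h else -h) * pd j.1 g (x + t • vv h j)) t := by
  rw [← fderiv_vv]
  have h1 : HasDerivAt (fun s : ℝ => x + s • vv h j) (vv h j) t := by
    simpa using ((hasDerivAt_id t).smul_const (vv h j)).const_add x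
  exact (hg _).hasFDerivAt.comp_hasDerivAt t h1

lemma dist_line {h : ℝ} (hh : 0 ≤ h) (x : Fin n → ℝ) (j : Fin n × Bool) {t : ℝ} (ht0 : 0 ≤ t)
    (ht1 : t ≤ 1) : dist (x + t • vv h j) x ≤ h := by
  rw [dist_eq_norm, add_sub_cancel_left, norm_smul, norm_vv hh, Real.norm_eq_abs, abs_of_nonneg ht0]
  nlinarith

lemma abs_sgn {h : ℝ} (hh : 0 ≤ h) (b : Bool) : |(if b then h else -h)| = h := by
  split_ifs <;> simp [abs_of_nonneg hh]

lemma diff_bound {g : (Fin n → ℝ) → ℝ} (hg : Differentiable ℝ g) (x : Fin n → ℝ) {h B : ℝ}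
    (hh : 0 ≤ h) (j : Fin n × Bool) (hB : ∀ y, dist y x ≤ h → |pd j.1 g y| ≤ B) :
    |g (x + vv h j) - g x| ≤ h * B := by
  have := norm_image_sub_le_of_norm_deriv_le_segment_01'
    (f := fun s : ℝ => g (x + s • vv h j)) (C := h * B)
    (fun t _ => (line_deriv hg x h j t).hasDerivWithinAt)
    (fun t ht => by
      rw [Real.norm_eq_abs, abs_mul, abs_sgn hh]
      exact mul_le_mul_of_nonneg_left (hB _ (dist_line hh x j ht.1 ht.2.le)) hh)
  simpa using this

lemma taylor2 {U : (Fin n → ℝ) → ℝ} (hU : ContDiff ℝ 2 U) (x : Fin n → ℝ) {h δ : ℝ}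
    (hh : 0 ≤ h) (j : Fin n × Bool)
    (hB : ∀ y, dist y x ≤ h → |pd j.1 (pd j.1 U) y - pd j.1 (pd j.1 U) x| ≤ δ) :
    |U (x + vv h j) - U x - (if j.2 then h else -h) * pd j.1 U x - h ^ 2 / 2 * pd j.1 (pd j.1 U) x| ≤
      h ^ 2 * δ := by
  set ε : ℝ := if j.2 then h else -h with hε
  have hε2 : ε * ε = h ^ 2 := by rw [hε]; split_ifs <;> ring
  have hd1 : Differentiable ℝ U := hU.differentiable (by norm_num)
  have hd2 : Differentiable ℝ (pd j.1 U) :=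
    (contDiff_pd (N := 1) hU (by norm_num) j.1).differentiable (by norm_num)
  have hδ : 0 ≤ δ := (abs_nonneg _).trans (hB x (by simpa using hh))
  -- first derivative estimate
  have h1 : ∀ t ∈ Ico (0 : ℝ) 1, |ε * pd j.1 U (x + t • vv h j) - ε * pd j.1 U x -
      t * h ^ 2 * pd j.1 (pd j.1 U) x| ≤ h ^ 2 * δ := by
    intro t ht
    have := Convex.norm_image_sub_le_of_norm_hasDerivWithin_le
      (f := fun s : ℝ => ε * pd j.1 U (x + s • vv h j) - s * h ^ 2 * pd j.1 (pd j.1 U) x)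
      (f' := fun s => ε * (ε * pd j.1 (pd j.1 U) (x + s • vv h j)) - h ^ 2 * pd j.1 (pd j.1 U) x)
      (s := Icc 0 t) (C := h ^ 2 * δ) (x := 0) (y := t)
      (fun s hs => by
        refine HasDerivAt.hasDerivWithinAt (((line_deriv hd2 x h j s).const_mul ε).sub ?_)
        simpa using ((hasDerivAt_id s).mul_const (h ^ 2)).mul_const (pd j.1 (pd j.1 U) x))
      (fun s hs => by
        rw [Real.norm_eq_abs, ← mul_assoc, hε2, ← mul_sub, abs_mul, abs_of_nonneg (sq_nonneg h)]
        exact mul_le_mul_of_nonneg_left (hB _ (dist_line hh x j hs.1 (hs.2.trans ht.2.le)))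
          (sq_nonneg h))
      (convex_Icc 0 t) (by simp [ht.1]) (by simp [ht.1])
    simp only [zero_smul, add_zero, zero_mul, sub_zero, Real.norm_eq_abs] at this
    rw [abs_of_nonneg ht.1] at this
    have e : ε * pd j.1 U (x + t • vv h j) - ε * pd j.1 U x -
      t * h ^ 2 * pd j.1 (pd j.1 U) x = ε * pd j.1 U (x + t • vv h j) -
      t * h ^ 2 * pd j.1 (pd j.1 U) x - ε * pd j.1 U x := by ring
    rw [e]
    refine this.trans ?_
    have : 0 ≤ h ^ 2 * δ := by positivity
    nlinarith [ht.1, ht.2]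
  have := norm_image_sub_le_of_norm_deriv_le_segment_01'
    (f := fun s : ℝ => U (x + s • vv h j) - s * (ε * pd j.1 U x) -
      s ^ 2 * (h ^ 2 / 2 * pd j.1 (pd j.1 U) x)) (C := h ^ 2 * δ)
    (f' := fun t => ε * pd j.1 U (x + t • vv h j) - ε * pd j.1 U x -
      t * h ^ 2 * pd j.1 (pd j.1 U) x)
    (fun t _ => by
      refine HasDerivAt.hasDerivWithinAt (((line_deriv hd1 x h j t).sub ?_).sub ?_)
      · simpa using (hasDerivAt_id t).mul_const (ε * pd j.1 U x)
      · have := ((hasDerivAt_id t).pow 2).mul_const (h ^ 2 / 2 * pd j.1 (pd j.1 U) x)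
        refine this.congr_deriv ?_
        push_cast
        simp only [id_eq, Nat.add_one_sub_one, pow_one, mul_one]
        ring)
    (fun t ht => by rw [Real.norm_eq_abs]; exact h1 t ht)
  simp only [one_smul, zero_smul, add_zero, zero_mul, sub_zero, Real.norm_eq_abs, one_mul, one_pow,
    ne_eq, OfNat.ofNat_ne_zero, not_false_eq_true, zero_pow] at this
  have e : U (x + vv h j) - U x - ε * pd j.1 U x - h ^ 2 / 2 * pd j.1 (pd j.1 U) x =
    U (x + vv h j) - ε * pd j.1 U x - h ^ 2 / 2 * pd j.1 (pd j.1 U) x - U x := by ring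
  rw [e]; exact this

lemma Lh_lapl {U : (Fin n → ℝ) → ℝ} (hU : ContDiff ℝ 2 U) (x : Fin n → ℝ) {h δ : ℝ} (hh : 0 < h)
    (hB : ∀ y, dist y x ≤ h → ∀ l, |pd l (pd l U) y - pd l (pd l U) x| ≤ δ) :
    |Lh h U x - lapl U x| ≤ 2 * n * δ := by
  have e : Lh h U x - lapl U x = ∑ j : Fin n × Bool, (U (x + vv h j) - U x -
      (if j.2 then h else -h) * pd j.1 U x - h ^ 2 / 2 * pd j.1 (pd j.1 U) x) / h ^ 2 := by
    simp only [Lh, lapl]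
    rw [Fintype.sum_prod_type, Fintype.sum_prod_type, ← Finset.sum_sub_distrib]
    refine Finset.sum_congr rfl fun l _ => ?_
    rw [Fintype.sum_bool, Fintype.sum_bool]
    simp only [if_true, Bool.false_eq_true, if_false]
    field_simp; ring
  rw [e]
  refine (Finset.abs_sum_le_sum_abs _ _).trans ?_
  calc _ ≤ ∑ _j : Fin n × Bool, δ := by
        refine Finset.sum_le_sum fun j _ => ?_
        rw [abs_div, abs_of_nonneg (sq_nonneg h), div_le_iff₀ (by positivity), mul_comm δ]
        exact taylor2 hU x hh.le j fun y hy => hB y hy j.1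
    _ = _ := by
        rw [Finset.sum_const, Finset.card_univ, Fintype.card_prod, Fintype.card_bool,
          Fintype.card_fin, nsmul_eq_mul]
        push_cast; ring

lemma pd_shift (F : (Fin n → ℝ) → ℝ) (v x : Fin n → ℝ) (a : Fin n) :
    pd a (fun y => F (y + v)) x = pd a F (x + v) := by
  simp only [pd]; rw [fderiv_comp_add_right]

lemma pd_Lh {F : (Fin n → ℝ) → ℝ} (hF : Differentiable ℝ F) (h c : ℝ) (a : Fin n) (x : Fin n → ℝ) :
    pd a (fun y => -Lh h F y + c) x = -Lh h (pd a F) x := by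
  have hd : ∀ v : Fin n → ℝ, DifferentiableAt ℝ (fun y => F (y + v)) x := fun v =>
    (hF (x + v)).comp x (differentiableAt_id.add_const v)
  have hd2 : ∀ j : Fin n × Bool, DifferentiableAt ℝ (fun y => (F (y + vv h j) - F y) / h ^ 2) x :=
    fun j => by
      have := (hd (vv h j)).fun_sub (hF x)
      simp only [div_eq_mul_inv]
      exact this.mul_const _
  have e1 : pd a (fun y => -Lh h F y + c) x = - pd a (fun y => Lh h F y) x := by
    simp only [pd]
    rw [fderiv_add_const, fderiv_fun_neg]; simp
  rw [e1]
  simp only [Lh]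
  rw [pd_sum _ fun j _ => hd2 j]
  congr 1
  refine Finset.sum_congr rfl fun j _ => ?_
  rw [← pd_shift F]
  simp only [pd, div_eq_mul_inv]
  rw [fderiv_mul_const ((hd _).fun_sub (hF x)), fderiv_fun_sub (hd _) (hF x)]
  simp; ring

lemma contDiff_Lh {F : (Fin n → ℝ) → ℝ} {N : WithTop ℕ∞} (hF : ContDiff ℝ N F) (h : ℝ) :
    ContDiff ℝ N (Lh h F) := by
  unfold Lh
  refine ContDiff.sum fun j _ => ?_
  exact ((hF.comp (contDiff_id.add contDiff_const)).sub hF).div_const _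

end DIFFsec
open MeasureTheory Metric Set Matrix

noncomputable section PTsec

variable {n : ℕ}

lemma garding_sum (k : ℕ) (hk2 : 2 ≤ k) (hkn : k ≤ n) {U : (Fin n → ℝ) → ℝ} (x : Fin n → ℝ)
    (h : ℝ) (G : ℝ) (Gj : Fin n × Bool → ℝ) (hG : 0 < G) (hGj : ∀ j, 0 < Gj j)
    (hc : HCone k (Wmat U x)) (hcj : ∀ j, HCone k (Wmat U (x + vv h j)))
    (hs : sg k (Wmat U x) = G ^ k) (hsj : ∀ j, sg k (Wmat U (x + vv h j)) = Gj j ^ k) :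
    k * G ^ (k - 1) * ∑ j, (Gj j - G) / h ^ 2 ≤
      -(∑ b, ∑ a, newtonT (k - 1) (Wmat U x) a b * Lh h (pd a (pd b U)) x) +
        (newtonT (k - 1) (Wmat U x)).trace * Lh h (sfun U) x := by
  set T := newtonT (k - 1) (Wmat U x) with hT
  have hTs : T.IsSymm := newtonT_symm _ hc.1 _ (by omega)
  have hTW : (T * Wmat U x).trace = k * G ^ (k - 1) * G := by
    have := trace_newtonT_mul (k - 1) (by omega) (Wmat U x)
    rw [show k - 1 + 1 = k by omega, hs] at this
    rw [hT, this]
    have e : (((k - 1 : ℕ) : ℝ) + 1) = k := by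
      rw [Nat.cast_sub (by omega)]; push_cast; ring
    rw [e]
    obtain ⟨i, rfl⟩ : ∃ i, k = i + 1 := ⟨k - 1, by omega⟩
    simp only [Nat.add_sub_cancel, pow_succ]; ring
  have key : ∀ j, k * G ^ (k - 1) * (Gj j - G) ≤
      -(∑ b, ∑ a, T a b * (pd a (pd b U) (x + vv h j) - pd a (pd b U) x)) +
        T.trace * (sfun U (x + vv h j) - sfun U x) := by
    intro j
    have h1 := garding hkn (by omega) _ _ hc (hcj j) G (Gj j) hG (hGj j) hs (hsj j)
    have h2 : (T * Wmat U (x + vv h j)).trace - (T * Wmat U x).trace =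
        -(∑ b, ∑ a, T a b * (pd a (pd b U) (x + vv h j) - pd a (pd b U) x)) +
        T.trace * (sfun U (x + vv h j) - sfun U x) := by
      have e1 : ∀ y, (T * Wmat U y).trace =
          -(∑ b, ∑ a, T a b * pd a (pd b U) y) + T.trace * sfun U y := by
        intro y
        have : T * Wmat U y = -(T * hess U y) + sfun U y • T := by
          simp only [Wmat, mul_neg, mul_sub, Matrix.mul_smul, mul_one]; abel
        rw [this, Matrix.trace_add, Matrix.trace_neg, Matrix.trace_smul, smul_eq_mul,
          mul_comm (sfun U y)]
        congr 2
        simp only [Matrix.trace, Matrix.diag, Matrix.mul_apply, hess, Matrix.of_apply]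
        refine Finset.sum_congr rfl fun b _ => Finset.sum_congr rfl fun a _ => ?_
        rw [hTs.apply]
      rw [e1, e1]
      simp only [mul_sub, Finset.sum_sub_distrib]; ring
    calc _ = k * G ^ (k - 1) * Gj j - (T * Wmat U x).trace := by rw [hTW]; ring
      _ ≤ (T * Wmat U (x + vv h j)).trace - (T * Wmat U x).trace := by linarith
      _ = _ := h2
  calc k * G ^ (k - 1) * ∑ j, (Gj j - G) / h ^ 2
      = ∑ j, (k * G ^ (k - 1) * (Gj j - G)) / h ^ 2 := by
        rw [Finset.mul_sum]; refine Finset.sum_congr rfl fun j _ => ?_; ring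
    _ ≤ ∑ j, (-(∑ b, ∑ a, T a b * (pd a (pd b U) (x + vv h j) - pd a (pd b U) x)) +
        T.trace * (sfun U (x + vv h j) - sfun U x)) / h ^ 2 := by
        refine Finset.sum_le_sum fun j _ => ?_
        exact div_le_div_of_nonneg_right (key j) (sq_nonneg h)
    _ = _ := by
        simp only [add_div, Finset.sum_add_distrib, Lh, Finset.mul_sum, neg_div, Finset.sum_div,
          Finset.sum_neg_distrib, mul_div_assoc]
        congr 2
        rw [Finset.sum_comm]
        refine Finset.sum_congr rfl fun b _ => ?_
        rw [Finset.sum_comm]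

lemma s_identity {U : (Fin n → ℝ) → ℝ} (x y : Fin n → ℝ) (hx : 0 < U x) (hy : 0 < U y) :
    sfun U y - sfun U x = (∑ b, pd b U x * (pd b U y - pd b U x)) / U x -
      normSq (grad U x) / (2 * U x ^ 2) * (U y - U x) +
      U y / 2 * ∑ b, (pd b U y / U y - pd b U x / U x) ^ 2 := by
  have e1 : ∑ b, (pd b U y / U y - pd b U x / U x) ^ 2 =
      normSq (grad U y) / U y ^ 2 + normSq (grad U x) / U x ^ 2 -
        2 * (∑ b, pd b U x * pd b U y) / (U x * U y) := by
    simp only [normSq, grad, Finset.sum_div, Finset.mul_sum, ← Finset.sum_add_distrib,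
      ← Finset.sum_sub_distrib]
    refine Finset.sum_congr rfl fun b _ => ?_
    field_simp; ring
  have e2 : ∑ b, pd b U x * (pd b U y - pd b U x) =
      (∑ b, pd b U x * pd b U y) - normSq (grad U x) := by
    simp only [normSq, grad, ← Finset.sum_sub_distrib]
    refine Finset.sum_congr rfl fun b _ => ?_
    ring
  rw [e1, e2]; simp only [sfun]; field_simp; ring

lemma Lh_s {U : (Fin n → ℝ) → ℝ} (x : Fin n → ℝ) (h : ℝ) (hU : ∀ x, 0 < U x) :
    Lh h (sfun U) x = (∑ b, pd b U x * Lh h (pd b U) x) / U x -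
      normSq (grad U x) / (2 * U x ^ 2) * Lh h U x +
      ∑ j : Fin n × Bool, (U (x + vv h j) / 2 *
        ∑ b, (pd b U (x + vv h j) / U (x + vv h j) - pd b U x / U x) ^ 2) / h ^ 2 := by
  simp only [Lh]
  calc _ = ∑ j : Fin n × Bool, ((∑ b, pd b U x * (pd b U (x + vv h j) - pd b U x)) / U x -
      normSq (grad U x) / (2 * U x ^ 2) * (U (x + vv h j) - U x) +
      U (x + vv h j) / 2 *
        ∑ b, (pd b U (x + vv h j) / U (x + vv h j) - pd b U x / U x) ^ 2) / h ^ 2 := by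
        refine Finset.sum_congr rfl fun j _ => ?_
        rw [s_identity x _ (hU _) (hU _)]
    _ = _ := by
        simp only [add_div, sub_div, Finset.sum_add_distrib, Finset.sum_sub_distrib, Finset.mul_sum,
          Finset.sum_div, mul_div_assoc]
        congr 2
        · rw [Finset.sum_comm]
          refine Finset.sum_congr rfl fun b _ => ?_
          rw [← Finset.sum_sub_distrib, Finset.mul_sum]
          refine Finset.sum_congr rfl fun j _ => ?_
          ring
        · rw [← Finset.sum_sub_distrib, Finset.mul_sum]

lemma E_bound (K0 P h u u' p p' : ℝ) (hK0 : 1 ≤ K0) (hh : 0 < h) (hP : 0 ≤ P) (hu : K0⁻¹ ≤ u)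
    (hu' : K0⁻¹ ≤ u')
    (hp : |p| ≤ K0) (hd : |u' - u| ≤ h * K0) (hdp : |p' - p| ≤ h * P) :
    (p' / u' - p / u) ^ 2 ≤ h ^ 2 * (K0 * P + K0 ^ 4) ^ 2 := by
  have hK : 0 < K0 := by linarith
  have hki : 0 < K0⁻¹ := by positivity
  have h1 : 0 < u := by linarith
  have h2 : 0 < u' := by linarith
  have i1 : u⁻¹ ≤ K0 := by rw [inv_le_comm₀ h1 hK]; exact hu
  have i2 : u'⁻¹ ≤ K0 := by rw [inv_le_comm₀ h2 hK]; exact hu'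
  have e : p' / u' - p / u = (p' - p) * u'⁻¹ - p * (u' - u) * (u⁻¹ * u'⁻¹) := by
    field_simp; ring
  have hb : |p' / u' - p / u| ≤ h * (K0 * P + K0 ^ 4) := by
    rw [e]
    refine (abs_sub _ _).trans ?_
    rw [abs_mul, abs_mul, abs_mul, abs_of_pos (inv_pos.2 h2),
      abs_of_pos (mul_pos (inv_pos.2 h1) (inv_pos.2 h2))]
    calc _ ≤ (h * P) * K0 + K0 * (h * K0) * (K0 * K0) := by gcongr
      _ = _ := by ring
  rw [← sq_abs, ← mul_pow]
  exact pow_le_pow_left₀ (abs_nonneg _) hb 2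

lemma LG_bound {U : (Fin n → ℝ) → ℝ} (x : Fin n → ℝ) {h K0 P Λ : ℝ} (hh : 0 < h) (hK0 : 0 ≤ K0)
    (hP : 0 ≤ P) (hΛ : 0 ≤ Λ)
    (f : ((Fin n → ℝ) × ℝ × (Fin n → ℝ)) → ℝ)
    (hD : ‖fderiv ℝ f (x, U x, grad U x)‖ ≤ Λ)
    (hfj : ∀ j : Fin n × Bool, f (x, U x, grad U x) + fderiv ℝ f (x, U x, grad U x)
      ((x + vv h j, U (x + vv h j), grad U (x + vv h j)) - (x, U x, grad U x)) -
      Λ * ‖((x + vv h j, U (x + vv h j), grad U (x + vv h j)) : (Fin n → ℝ) × ℝ × (Fin n → ℝ)) -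
        (x, U x, grad U x)‖ ^ 2 ≤ f (x + vv h j, U (x + vv h j), grad U (x + vv h j)))
    (hdu : ∀ j : Fin n × Bool, |U (x + vv h j) - U x| ≤ h * K0)
    (hdp : ∀ (j : Fin n × Bool) b, |pd b U (x + vv h j) - pd b U x| ≤ h * P) :
    -(Λ * (|Lh h U x| + vnorm (fun b => Lh h (pd b U) x) + 2 * n * (1 + K0 + P) ^ 2)) ≤
      ∑ j : Fin n × Bool, (f (x + vv h j, U (x + vv h j), grad U (x + vv h j)) -
        f (x, U x, grad U x)) / h ^ 2 := by
  set L := fderiv ℝ f (x, U x, grad U x) with hL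
  set d : Fin n × Bool → (Fin n → ℝ) × ℝ × (Fin n → ℝ) := fun j =>
    (x + vv h j, U (x + vv h j), grad U (x + vv h j)) - (x, U x, grad U x) with hd
  have hnorm : ∀ j, ‖d j‖ ≤ h * (1 + K0 + P) := by
    intro j
    have a1 : h ≤ h * (1 + K0 + P) := by nlinarith [mul_nonneg hh.le hK0, mul_nonneg hh.le hP]
    have a2 : h * K0 ≤ h * (1 + K0 + P) := by nlinarith [mul_nonneg hh.le hK0, mul_nonneg hh.le hP]
    have a3 : h * P ≤ h * (1 + K0 + P) := by nlinarith [mul_nonneg hh.le hK0, mul_nonneg hh.le hP]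
    simp only [hd, Prod.mk_sub_mk, add_sub_cancel_left]
    refine norm_prod_le_iff.2 ⟨?_, norm_prod_le_iff.2 ⟨?_, ?_⟩⟩
    · simp only; rw [norm_vv hh.le]; exact a1
    · simp only; rw [Real.norm_eq_abs]; exact (hdu j).trans a2
    · simp only
      refine (pi_norm_le_iff_of_nonneg (by positivity)).2 fun b => ?_
      rw [Real.norm_eq_abs]; exact (hdp j b).trans a3
  have hsum : ∑ j, (h ^ 2)⁻¹ • d j = (0, Lh h U x, fun b => Lh h (pd b U) x) := by
    rw [← Finset.smul_sum]
    have e0 : ∑ j, d j = (∑ j : Fin n × Bool, vv h j, ∑ j : Fin n × Bool, (U (x + vv h j) - U x),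
        ∑ j : Fin n × Bool, (grad U (x + vv h j) - grad U x)) := by
      simp only [hd, Prod.mk_sub_mk, add_sub_cancel_left]
      refine Prod.ext ?_ (Prod.ext ?_ ?_)
      · simp [Prod.fst_sum]
      · simp [Prod.fst_sum, Prod.snd_sum]
      · simp [Prod.snd_sum]
    rw [e0, sum_vv]
    refine Prod.ext ?_ (Prod.ext ?_ ?_)
    · simp
    · simp only [Prod.smul_mk, smul_eq_mul, Lh, Finset.mul_sum]
      refine Finset.sum_congr rfl fun j _ => ?_
      ring
    · funext b
      simp only [Prod.smul_mk, Pi.smul_apply, smul_eq_mul, Lh, Finset.sum_apply, Pi.sub_apply, grad,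
        Finset.mul_sum]
      refine Finset.sum_congr rfl fun j _ => ?_
      ring
  have h1 : ∑ j, ((h ^ 2)⁻¹ * L (d j) - Λ * (1 + K0 + P) ^ 2) ≤
      ∑ j : Fin n × Bool, (f (x + vv h j, U (x + vv h j), grad U (x + vv h j)) -
        f (x, U x, grad U x)) / h ^ 2 := by
    refine Finset.sum_le_sum fun j _ => ?_
    have h2 := hfj j
    have h3 : ‖d j‖ ^ 2 ≤ h ^ 2 * (1 + K0 + P) ^ 2 := by
      rw [← mul_pow]; exact pow_le_pow_left₀ (norm_nonneg _) (hnorm j) 2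
    rw [le_div_iff₀ (by positivity)]
    have h4 : Λ * ‖d j‖ ^ 2 ≤ Λ * (h ^ 2 * (1 + K0 + P) ^ 2) := by gcongr
    have e : ((h ^ 2)⁻¹ * L (d j) - Λ * (1 + K0 + P) ^ 2) * h ^ 2 =
      L (d j) - Λ * (h ^ 2 * (1 + K0 + P) ^ 2) := by field_simp
    rw [e]; simp only [hd] at h4 ⊢; linarith
  refine le_trans ?_ h1
  rw [Finset.sum_sub_distrib]
  have e1 : ∑ j, (h ^ 2)⁻¹ * L (d j) = L (0, Lh h U x, fun b => Lh h (pd b U) x) := by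
    rw [← hsum, map_sum]; simp
  rw [e1, Finset.sum_const, Finset.card_univ, Fintype.card_prod, Fintype.card_bool,
          Fintype.card_fin, nsmul_eq_mul]
  have hv0 : 0 ≤ vnorm (fun b => Lh h (pd b U) x) := Real.sqrt_nonneg _
  have h5 : ‖((0, Lh h U x, fun b => Lh h (pd b U) x) : (Fin n → ℝ) × ℝ × (Fin n → ℝ))‖ ≤
      |Lh h U x| + vnorm (fun b => Lh h (pd b U) x) := by
    have := abs_nonneg (Lh h U x)
    refine norm_prod_le_iff.2 ⟨by simp; positivity, norm_prod_le_iff.2 ⟨?_, ?_⟩⟩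
    · simp only [Real.norm_eq_abs]; linarith
    · simp only
      refine (pi_norm_le_iff_of_nonneg (by positivity)).2 fun b => ?_
      rw [Real.norm_eq_abs]
      have : |Lh h (pd b U) x| ≤ vnorm (fun b => Lh h (pd b U) x) := by
        refine Real.abs_le_sqrt ?_
        exact Finset.single_le_sum (f := fun b => Lh h (pd b U) x ^ 2)
          (fun i _ => sq_nonneg _) (Finset.mem_univ b)
      linarith
  have h6 := L.le_opNorm (0, Lh h U x, fun b => Lh h (pd b U) x)
  rw [Real.norm_eq_abs] at h6
  have h7 := (abs_le.1 h6).1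
  have h8 : ‖L‖ * ‖((0, Lh h U x, fun b => Lh h (pd b U) x) : (Fin n → ℝ) × ℝ × (Fin n → ℝ))‖ ≤
      Λ * (|Lh h U x| + vnorm (fun b => Lh h (pd b U) x)) := by gcongr
  push_cast
  nlinarith

end PTsec
open MeasureTheory Metric Set Matrix

noncomputable section PTMsec

variable {n : ℕ}

set_option maxHeartbeats 1000000 in
lemma scal_final (k : ℕ) (hk : 2 ≤ k) (nn CN A K0 C1 Λ Z τ t LU V g S N E J : ℝ)
    (hnn : 0 ≤ nn) (hCN : 0 ≤ CN) (hA : 0 ≤ A) (hK0 : 0 ≤ K0) (hC1 : 0 ≤ C1) (hΛ : 0 ≤ Λ)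
    (hZ : 1 / 2 ≤ Z) (hτ0 : 0 ≤ τ) (hτ : τ ≤ 2 * Z) (ht0 : 0 ≤ t) (ht : t ≤ nn * CN * τ ^ (k - 1))
    (hLU : LU = C1 - Z) (hV : 0 ≤ V) (hg0 : 0 ≤ g) (hg : g ≤ k * Λ ^ (k - 1))
    (hS : -(Λ * (|LU| + V + 2 * nn * (1 + K0 + A * τ) ^ 2)) ≤ S)
    (hN0 : 0 ≤ N) (hN : N ≤ nn * K0 ^ 4)
    (hE : E ≤ nn ^ 2 * K0 * (K0 * (A * τ) + K0 ^ 4) ^ 2)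
    (hJ : g * S + t * (N * LU - E) ≤ J) :
    -(k * Λ ^ k + 2 ^ (k + 1) * (k * Λ ^ k * (1 + 2 * C1 + 2 * nn * (1 + K0 + A) ^ 2) +
      nn * CN * (nn * K0 ^ 4 + nn ^ 2 * K0 * (K0 * A + K0 ^ 4) ^ 2))) * (Z ^ (k + 1) + V) ≤ J := by
  set y := 2 * Z with hy
  have hy1 : 1 ≤ y := by linarith
  have hy0 : 0 ≤ y := by linarith
  have p1 : y ≤ y ^ (k + 1) := le_self_pow₀ hy1 (by omega)
  have p2 : y ^ 2 ≤ y ^ (k + 1) := pow_le_pow_right₀ hy1 (by omega)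
  have p3 : y ^ (k - 1) * y ≤ y ^ (k + 1) := by
    rw [← pow_succ]; exact pow_le_pow_right₀ hy1 (by omega)
  have p4 : y ^ (k - 1) * y ^ 2 = y ^ (k + 1) := by
    rw [← pow_add]; congr 1; omega
  have pΛ : Λ ^ (k - 1) * Λ = Λ ^ k := by
    rw [← pow_succ]; congr 1; omega
  have b1 : |LU| ≤ (1 + 2 * C1) * y := by
    rw [hLU]; refine (abs_sub _ _).trans ?_
    rw [abs_of_nonneg hC1, abs_of_nonneg (by linarith : (0 : ℝ) ≤ Z)]
    nlinarith
  have b2 : (1 + K0 + A * τ) ^ 2 ≤ (1 + K0 + A) ^ 2 * y ^ 2 := by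
    rw [← mul_pow]
    refine pow_le_pow_left₀ (by positivity) ?_ 2
    have : A * τ ≤ A * y := by gcongr
    nlinarith
  have b3 : (K0 * (A * τ) + K0 ^ 4) ^ 2 ≤ (K0 * A + K0 ^ 4) ^ 2 * y ^ 2 := by
    rw [← mul_pow]
    refine pow_le_pow_left₀ (by positivity) ?_ 2
    have h1 : K0 * (A * τ) ≤ K0 * (A * y) := by gcongr
    have : 0 ≤ K0 ^ 4 := by positivity
    nlinarith
  have b4 : t ≤ nn * CN * y ^ (k - 1) := ht.trans (by gcongr)
  have c1 : |LU| + V + 2 * nn * (1 + K0 + A * τ) ^ 2 ≤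
      (1 + 2 * C1 + 2 * nn * (1 + K0 + A) ^ 2) * y ^ (k + 1) + V := by
    have : |LU| ≤ (1 + 2 * C1) * y ^ (k + 1) := b1.trans (by gcongr)
    have : 2 * nn * (1 + K0 + A * τ) ^ 2 ≤ 2 * nn * ((1 + K0 + A) ^ 2 * y ^ (k + 1)) := by
      gcongr; exact b2.trans (by gcongr)
    linarith
  have d1 : g * (Λ * (|LU| + V + 2 * nn * (1 + K0 + A * τ) ^ 2)) ≤
      k * Λ ^ k * ((1 + 2 * C1 + 2 * nn * (1 + K0 + A) ^ 2) * y ^ (k + 1) + V) := by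
    calc _ ≤ (k * Λ ^ (k - 1)) * (Λ * ((1 + 2 * C1 + 2 * nn * (1 + K0 + A) ^ 2) * y ^ (k + 1) + V)) := by
          gcongr
      _ = _ := by rw [← pΛ]; ring
  have d2 : t * (N * Z) ≤ nn * CN * (nn * K0 ^ 4) * y ^ (k + 1) := by
    calc _ ≤ (nn * CN * y ^ (k - 1)) * (nn * K0 ^ 4 * y) := by
          gcongr; linarith
      _ = nn * CN * (nn * K0 ^ 4) * (y ^ (k - 1) * y) := by ring
      _ ≤ _ := by gcongr
  have d3 : t * E ≤ nn * CN * (nn ^ 2 * K0 * (K0 * A + K0 ^ 4) ^ 2) * y ^ (k + 1) := by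
    calc _ ≤ (nn * CN * y ^ (k - 1)) * (nn ^ 2 * K0 * ((K0 * A + K0 ^ 4) ^ 2 * y ^ 2)) := by
          have hE2 : E ≤ nn ^ 2 * K0 * ((K0 * A + K0 ^ 4) ^ 2 * y ^ 2) := hE.trans (by gcongr)
          exact (mul_le_mul_of_nonneg_left hE2 ht0).trans (by gcongr)
      _ = nn * CN * (nn ^ 2 * K0 * (K0 * A + K0 ^ 4) ^ 2) * (y ^ (k - 1) * y ^ 2) := by ring
      _ = _ := by rw [p4]
  have d4 : -(t * (N * Z)) ≤ t * (N * LU) := by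
    rw [hLU]
    have : 0 ≤ t * (N * C1) := by positivity
    nlinarith
  have d5 : -(g * (Λ * (|LU| + V + 2 * nn * (1 + K0 + A * τ) ^ 2))) ≤ g * S := by
    have := mul_le_mul_of_nonneg_left hS hg0
    linarith
  have hyk : y ^ (k + 1) = 2 ^ (k + 1) * Z ^ (k + 1) := by rw [hy, mul_pow]
  rw [hyk] at d1 d2 d3
  set a := k * Λ ^ k with ha
  have ha0 : 0 ≤ a := by positivity
  set b := 1 + 2 * C1 + 2 * nn * (1 + K0 + A) ^ 2 with hb
  have hb0 : 0 ≤ b := by positivity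
  set e := nn * CN * (nn * K0 ^ 4 + nn ^ 2 * K0 * (K0 * A + K0 ^ 4) ^ 2) with he
  have he0 : 0 ≤ e := by positivity
  have hZk : 0 ≤ Z ^ (k + 1) := by positivity
  have f1 : 0 ≤ a * Z ^ (k + 1) := by positivity
  have f2 : 0 ≤ (2 : ℝ) ^ (k + 1) * (a * b + e) * V := by positivity
  have f3 : nn * CN * (nn * K0 ^ 4) * (2 ^ (k + 1) * Z ^ (k + 1)) +
    nn * CN * (nn ^ 2 * K0 * (K0 * A + K0 ^ 4) ^ 2) * (2 ^ (k + 1) * Z ^ (k + 1)) =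
    2 ^ (k + 1) * e * Z ^ (k + 1) := by rw [he]; ring
  have f4 : J ≥ -(a * (b * (2 ^ (k + 1) * Z ^ (k + 1)) + V)) -
     (2 ^ (k + 1) * e * Z ^ (k + 1)) := by
    have : t * (N * LU - E) = t * (N * LU) - t * E := by ring
    linarith
  linarith

lemma qf_eq_dot (T : Matrix (Fin n) (Fin n) ℝ) (ξ : Fin n → ℝ) :
    qf T ξ ξ = ξ ⬝ᵥ (T *ᵥ ξ) := by
  simp only [qf, dotProduct, Matrix.mulVec, Finset.mul_sum]
  rw [Finset.sum_comm]
  refine Finset.sum_congr rfl fun a _ => Finset.sum_congr rfl fun b _ => ?_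
  ring

lemma qf_le (T : Matrix (Fin n) (Fin n) ℝ) (B : ℝ) (hT : ∀ a b, |T a b| ≤ B)
    (ξ : Fin n → ℝ) : qf T ξ ξ ≤ n * B * normSq ξ := by
  have h : ∀ a b, T a b * (ξ a * ξ b) ≤ B * (ξ a ^ 2 / 2) + B * (ξ b ^ 2 / 2) := by
    intro a b
    have hB : 0 ≤ B := (abs_nonneg _).trans (hT a b)
    have h1 : T a b * (ξ a * ξ b) ≤ B * |ξ a * ξ b| := by
      refine (le_abs_self _).trans ?_
      rw [abs_mul]; gcongr; exact hT a b
    have h2 : |ξ a * ξ b| ≤ ξ a ^ 2 / 2 + ξ b ^ 2 / 2 := by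
      rw [abs_le]; constructor <;> nlinarith [sq_nonneg (ξ a - ξ b), sq_nonneg (ξ a + ξ b)]
    nlinarith
  calc qf T ξ ξ ≤ ∑ b, ∑ a, (B * (ξ a ^ 2 / 2) + B * (ξ b ^ 2 / 2)) :=
        Finset.sum_le_sum fun b _ => Finset.sum_le_sum fun a _ => h a b
    _ = _ := by
        simp only [Finset.sum_add_distrib, ← Finset.mul_sum, ← Finset.sum_div, Finset.sum_const,
          Finset.card_univ, Fintype.card_fin, nsmul_eq_mul, normSq]
        ring

set_option maxHeartbeats 2000000 in
lemma pt_main (k : ℕ) (hk2 : 2 ≤ k) (hkn : k ≤ n) (c Λ K0 C1 A : ℝ) (hc : 0 < c) (hΛ : 0 ≤ Λ)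
    (hK0 : 1 ≤ K0) (hC1 : 0 ≤ C1) (hA : 0 ≤ A) :
    ∃ K : ℝ, 1 ≤ K ∧ ∀ (U : (Fin n → ℝ) → ℝ) (f : ((Fin n → ℝ) × ℝ × (Fin n → ℝ)) → ℝ)
      (x : Fin n → ℝ) (h τ : ℝ), ContDiff ℝ 2 U → (∀ y, 0 < U y) → 0 < h → 0 ≤ τ →
      HCone k (Wmat U x) → (∀ j, HCone k (Wmat U (x + vv h j))) →
      sg k (Wmat U x) = f (x, U x, grad U x) ^ k →
      (∀ j, sg k (Wmat U (x + vv h j)) =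
        f (x + vv h j, U (x + vv h j), grad U (x + vv h j)) ^ k) →
      c ≤ f (x, U x, grad U x) → f (x, U x, grad U x) ≤ Λ →
      ‖fderiv ℝ f (x, U x, grad U x)‖ ≤ Λ →
      (∀ j : Fin n × Bool, 0 < f (x + vv h j, U (x + vv h j), grad U (x + vv h j)) ∧
        f (x, U x, grad U x) + fderiv ℝ f (x, U x, grad U x)
      ((x + vv h j, U (x + vv h j), grad U (x + vv h j)) - (x, U x, grad U x)) -
      Λ * ‖((x + vv h j, U (x + vv h j), grad U (x + vv h j)) : (Fin n → ℝ) × ℝ × (Fin n → ℝ)) -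
        (x, U x, grad U x)‖ ^ 2 ≤ f (x + vv h j, U (x + vv h j), grad U (x + vv h j))) →
      K0⁻¹ ≤ U x → U x ≤ K0 → (∀ j, K0⁻¹ ≤ U (x + vv h j) ∧ U (x + vv h j) ≤ K0) →
      (∀ b, |pd b U x| ≤ K0) →
      (∀ j : Fin n × Bool, |U (x + vv h j) - U x| ≤ h * K0) →
      (∀ (j : Fin n × Bool) b, |pd b U (x + vv h j) - pd b U x| ≤ h * (A * τ)) →
      (∀ a b, |Wmat U x a b| ≤ τ) → sg 1 (Wmat U x) ≤ τ →
      1 / 2 ≤ -Lh h U x + C1 → τ ≤ 2 * (-Lh h U x + C1) →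
      Pt k K U (fun y => -Lh h U y + C1) x := by
  obtain ⟨CN, hCN0, hCN⟩ := newton_bound n (k - 1) (by omega)
  set KJ := k * Λ ^ k + 2 ^ (k + 1) * (k * Λ ^ k * (1 + 2 * C1 + 2 * n * (1 + K0 + A) ^ 2) +
      n * CN * (n * K0 ^ 4 + (n : ℝ) ^ 2 * K0 * (K0 * A + K0 ^ 4) ^ 2)) with hKJ
  have hK0' : 0 < K0 := by linarith
  have hKJ0 : 0 ≤ KJ := by positivity
  set K := 1 + KJ + K0 ^ (n - k + 1) + 2 / c ^ k + n * CN * 2 ^ (k - 1) with hK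
  have q1 : 0 ≤ K0 ^ (n - k + 1) := by positivity
  have q2 : 0 ≤ 2 / c ^ k := by positivity
  have q3 : 0 ≤ n * CN * 2 ^ (k - 1) := by positivity
  have hK1 : 1 ≤ K := by linarith
  have hKp : 0 < K := by linarith
  refine ⟨K, hK1, ?_⟩
  intro U f x h τ hU h0 hh hτ0 hW hWj hs hsj hfc hfΛ hfd hfj hU1 hU2 hUj hp hdu hdp hWτ hs1 hz hτz
  set Z := -Lh h U x + C1 with hZ
  set T := newtonT (k - 1) (Wmat U x) with hT
  have hT1 := hCN _ τ hτ0 hWτ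
  have hs1p : 0 < sg 1 (Wmat U x) := hW.sg_one_pos hkn (by omega)
  have hki : 0 < K0⁻¹ := by positivity
  have hlow : ∀ ξ, normSq ξ * c ^ k ≤ 2 * Z * qf T ξ ξ := by
    intro ξ
    have h1 := newton_lower hkn (by omega) hW ξ
    rw [← hT, ← qf_eq_dot, hs] at h1
    have hn0 := normSq_nonneg' ξ
    have h2 : c ^ k ≤ f (x, U x, grad U x) ^ k := pow_le_pow_left₀ hc.le hfc k
    have h3 : 0 ≤ qf T ξ ξ := by
      by_contra hneg
      push Not at hneg
      have := mul_neg_of_pos_of_neg hs1p hneg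
      have h4 : 0 ≤ normSq ξ * f (x, U x, grad U x) ^ k :=
        mul_nonneg hn0 ((pow_pos hc k).le.trans h2)
      linarith
    calc normSq ξ * c ^ k ≤ normSq ξ * f (x, U x, grad U x) ^ k := by gcongr
      _ ≤ _ := h1
      _ ≤ _ := by gcongr; linarith
  refine ⟨?_, ?_, hz, ?_, ?_, ?_⟩
  · apply inv_anti₀ (by have := h0 x; positivity)
    calc U x ^ (n - k + 1) ≤ K0 ^ (n - k + 1) := pow_le_pow_left₀ (h0 x).le hU2 _
      _ ≤ K := by linarith
  · rw [← inv_pow]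
    calc (U x)⁻¹ ^ (n - k + 1) ≤ K0 ^ (n - k + 1) := by
          refine pow_le_pow_left₀ (inv_pos.2 (h0 x)).le ?_ _
          rw [inv_le_comm₀ (h0 x) hK0']; exact hU1
      _ ≤ K := by linarith
  · intro ξ
    show K⁻¹ * normSq ξ ≤ Z * qf T ξ ξ
    have h1 := hlow ξ
    have h2 : K⁻¹ ≤ c ^ k / 2 := by
      rw [inv_le_comm₀ hKp (by positivity), inv_div]; linarith
    calc K⁻¹ * normSq ξ ≤ c ^ k / 2 * normSq ξ := by
          have := normSq_nonneg' ξ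
          gcongr
      _ ≤ _ := by linarith
  · intro ξ
    show qf T ξ ξ ≤ K * Z ^ (k - 1) * normSq ξ
    refine (qf_le T _ hT1 ξ).trans ?_
    refine mul_le_mul_of_nonneg_right ?_ (normSq_nonneg' ξ)
    have hZ0 : 0 ≤ Z ^ (k - 1) := pow_nonneg (by linarith) _
    calc (n : ℝ) * (CN * τ ^ (k - 1)) ≤ n * (CN * (2 * Z) ^ (k - 1)) := by gcongr
      _ = (n * CN * 2 ^ (k - 1)) * Z ^ (k - 1) := by rw [mul_pow]; ring
      _ ≤ _ := by gcongr; linarith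
  · have hd1 : Differentiable ℝ U := hU.differentiable (by norm_num)
    have hd2 : ∀ b, Differentiable ℝ (pd b U) := fun b =>
      (contDiff_pd (N := 1) hU (by norm_num) b).differentiable (by norm_num)
    have e1 : ∀ b, pd b (fun y => -Lh h U y + C1) = fun y => -Lh h (pd b U) y + 0 := by
      intro b; funext y; rw [pd_Lh hd1]; ring
    have e2 : ∀ a b, pd a (pd b (fun y => -Lh h U y + C1)) x = -Lh h (pd a (pd b U)) x := by
      intro a b; rw [e1, pd_Lh (hd2 b)]
    have e3 : vnorm (grad (fun y => -Lh h U y + C1) x) = vnorm (fun b => Lh h (pd b U) x) := by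
      simp only [vnorm, grad, e1]; simp
    simp only [e2, e3]
    simp only [e1, add_zero]
    show -K * (Z ^ (k + 1) + _) ≤ ∑ b, ∑ a, T a b * -Lh h (pd a (pd b U)) x -
      T.trace / U x * ∑ b, pd b U x * -Lh h (pd b U) x
    set V := vnorm (fun b => Lh h (pd b U) x) with hV
    have hV0 : 0 ≤ V := Real.sqrt_nonneg _
    set J := ∑ b, ∑ a, T a b * -Lh h (pd a (pd b U)) x -
      T.trace / U x * ∑ b, pd b U x * -Lh h (pd b U) x with hJ
    have hG0 : 0 < f (x, U x, grad U x) := by linarith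
    have hgs := garding_sum k hk2 hkn x h _
      (fun j => f (x + vv h j, U (x + vv h j), grad U (x + vv h j))) hG0 (fun j => (hfj j).1) hW hWj
      hs hsj
    have hLs := Lh_s x h h0
    have hLG := LG_bound x hh hK0'.le (by positivity : 0 ≤ A * τ) hΛ f hfd (fun j => (hfj j).2) hdu hdp
    rw [← hT, hLs] at hgs
    rw [← hV] at hLG
    set S := ∑ j : Fin n × Bool, (f (x + vv h j, U (x + vv h j), grad U (x + vv h j)) -
        f (x, U x, grad U x)) / h ^ 2 with hS
    set E := ∑ j : Fin n × Bool, (U (x + vv h j) / 2 *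
        ∑ b, (pd b U (x + vv h j) / U (x + vv h j) - pd b U x / U x) ^ 2) / h ^ 2 with hE
    have hEb : E ≤ (n : ℝ) ^ 2 * K0 * (K0 * (A * τ) + K0 ^ 4) ^ 2 := by
      calc E ≤ ∑ j : Fin n × Bool, K0 / 2 * (n * (K0 * (A * τ) + K0 ^ 4) ^ 2) := by
            refine Finset.sum_le_sum fun j _ => ?_
            rw [div_le_iff₀ (by positivity)]
            have hb : ∑ b, (pd b U (x + vv h j) / U (x + vv h j) - pd b U x / U x) ^ 2 ≤
                ∑ _b : Fin n, h ^ 2 * (K0 * (A * τ) + K0 ^ 4) ^ 2 :=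
              Finset.sum_le_sum fun b _ => E_bound K0 (A * τ) h _ _ _ _ hK0 hh (by positivity) hU1
                (hUj j).1 (hp b) (hdu j) (hdp j b)
            rw [Finset.sum_const, Finset.card_univ, Fintype.card_fin, nsmul_eq_mul] at hb
            calc _ ≤ K0 / 2 * (n * (h ^ 2 * (K0 * (A * τ) + K0 ^ 4) ^ 2)) := by
                  have := (hUj j).2
                  have h3 : 0 ≤ ∑ b, (pd b U (x + vv h j) / U (x + vv h j) - pd b U x / U x) ^ 2 :=
                    Finset.sum_nonneg fun _ _ => sq_nonneg _
                  gcongr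
              _ = _ := by ring
        _ = _ := by
            rw [Finset.sum_const, Finset.card_univ, Fintype.card_prod, Fintype.card_bool,
              Fintype.card_fin, nsmul_eq_mul]
            push_cast; ring
    have htr0 : 0 ≤ T.trace := by
      refine Finset.sum_nonneg fun i _ => ?_
      have h1 := hlow (Pi.single i 1)
      have h2 : qf T (Pi.single i 1) (Pi.single i 1) = T i i := by
        simp only [qf]
        rw [Finset.sum_eq_single i, Finset.sum_eq_single i]
        · simp
        · intro a _ ha; simp [ha]
        · simp
        · intro b _ hb; refine Finset.sum_eq_zero fun a _ => ?_; simp [hb]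
        · simp
      rw [h2] at h1
      have h3 : 0 ≤ 2 * Z * T i i := le_trans (mul_nonneg (normSq_nonneg' _) (by positivity)) h1
      exact nonneg_of_mul_nonneg_right h3 (by linarith)
    have htr : T.trace ≤ n * CN * τ ^ (k - 1) := by
      calc T.trace ≤ ∑ _i : Fin n, CN * τ ^ (k - 1) :=
            Finset.sum_le_sum fun i _ => (le_abs_self _).trans (hT1 i i)
        _ = _ := by simp; ring
    have hN0 : 0 ≤ normSq (grad U x) / (2 * U x ^ 2) :=
      div_nonneg (normSq_nonneg' _) (by positivity)
    have hNb : normSq (grad U x) / (2 * U x ^ 2) ≤ n * K0 ^ 4 := by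
      have a1 : normSq (grad U x) ≤ n * K0 ^ 2 := by
        calc normSq (grad U x) ≤ ∑ _i : Fin n, K0 ^ 2 := by
              refine Finset.sum_le_sum fun i _ => ?_
              rw [← sq_abs]
              exact pow_le_pow_left₀ (abs_nonneg _) (hp i) 2
          _ = _ := by simp
      have a2 : (U x ^ 2)⁻¹ ≤ K0 ^ 2 := by
        rw [← inv_pow]
        refine pow_le_pow_left₀ (inv_pos.2 (h0 x)).le ?_ _
        rw [inv_le_comm₀ (h0 x) hK0']; exact hU1
      have hx := h0 x
      calc normSq (grad U x) / (2 * U x ^ 2) = normSq (grad U x) / 2 * (U x ^ 2)⁻¹ := by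
            field_simp
        _ ≤ (n * K0 ^ 2) / 2 * K0 ^ 2 := by gcongr
        _ = n * K0 ^ 4 / 2 := by ring
        _ ≤ _ := by
          have : 0 ≤ (n : ℝ) * K0 ^ 4 := by positivity
          linarith
    have hfin := scal_final k hk2 n CN A K0 C1 Λ Z τ T.trace (Lh h U x) V
      (k * f (x, U x, grad U x) ^ (k - 1)) S (normSq (grad U x) / (2 * U x ^ 2)) E J
      (Nat.cast_nonneg n) hCN0 hA hK0'.le hC1 hΛ hz hτ0 hτz htr0 htr (by rw [hZ]; ring) hV0
      (by positivity) (by gcongr) hLG hN0 hNb hEb (by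
        have eJ : J = -(∑ b, ∑ a, T a b * Lh h (pd a (pd b U)) x) +
            T.trace * ((∑ b, pd b U x * Lh h (pd b U) x) / U x) := by
          rw [hJ]; simp only [mul_neg, Finset.sum_neg_distrib]; ring
        rw [eJ]
        linarith [hgs])
    rw [← hKJ] at hfin
    refine le_trans ?_ hfin
    have hZk : 0 ≤ Z ^ (k + 1) := pow_nonneg (by linarith) _
    have : KJ * (Z ^ (k + 1) + V) ≤ K * (Z ^ (k + 1) + V) := by gcongr; linarith
    linarith

end PTMsec
open MeasureTheory Metric Set Matrix

noncomputable section BDsec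

variable {n : ℕ}

lemma continuous_matNorm : Continuous (matNorm : Matrix (Fin n) (Fin n) ℝ → ℝ) := by
  unfold matNorm
  refine continuous_norm.comp ?_
  have := LinearMap.continuous_of_finiteDimensional
    ((LinearMap.toContinuousLinearMap (𝕜 := ℝ) (E := EuclideanSpace ℝ (Fin n))
      (F' := EuclideanSpace ℝ (Fin n))).toLinearMap.comp
      (Matrix.toEuclideanLin (𝕜 := ℝ) (m := Fin n) (n := Fin n)).toLinearMap)
  exact this

lemma matNorm_nonneg (M : Matrix (Fin n) (Fin n) ℝ) : 0 ≤ matNorm M := norm_nonneg _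

lemma entry_le_matNorm (M : Matrix (Fin n) (Fin n) ℝ) (i j : Fin n) : |M i j| ≤ matNorm M := by
  have h := (LinearMap.toContinuousLinearMap (Matrix.toEuclideanLin M)).le_opNorm
    (EuclideanSpace.single j (1 : ℝ))
  have h2 := EuclideanSpace.norm_eq ((LinearMap.toContinuousLinearMap (Matrix.toEuclideanLin M))
    (EuclideanSpace.single j (1 : ℝ)))
  have h3 : ((LinearMap.toContinuousLinearMap (Matrix.toEuclideanLin M))
    (EuclideanSpace.single j (1 : ℝ))) i = M i j := by
    simp [Matrix.toEuclideanLin, Matrix.toLpLin_apply]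
  have h4 := PiLp.norm_apply_le ((LinearMap.toContinuousLinearMap (Matrix.toEuclideanLin M))
    (EuclideanSpace.single j (1 : ℝ))) i
  rw [h3, Real.norm_eq_abs] at h4
  refine h4.trans (h.trans ?_)
  simp [matNorm]

lemma matNorm_le (M : Matrix (Fin n) (Fin n) ℝ) (B : ℝ) (hB : 0 ≤ B) (h : ∀ i j, |M i j| ≤ B) :
    matNorm M ≤ n * n * B := by
  refine ContinuousLinearMap.opNorm_le_bound _ (by positivity) fun v => ?_
  have h1 : ∀ i, |((LinearMap.toContinuousLinearMap (Matrix.toEuclideanLin M)) v) i| ≤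
      n * B * ‖v‖ := by
    intro i
    have e : ((LinearMap.toContinuousLinearMap (Matrix.toEuclideanLin M)) v) i =
      ∑ j, M i j * v j := by
      simp [Matrix.toEuclideanLin, Matrix.toLpLin_apply, Matrix.mulVec, dotProduct]
    rw [e]
    calc |∑ j, M i j * v j| ≤ ∑ j, |M i j * v j| := Finset.abs_sum_le_sum_abs _ _
      _ ≤ ∑ _j : Fin n, B * ‖v‖ := by
          refine Finset.sum_le_sum fun j _ => ?_
          rw [abs_mul]
          have := PiLp.norm_apply_le v j
          rw [Real.norm_eq_abs] at this
          exact mul_le_mul (h i j) this (abs_nonneg _) hB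
      _ = _ := by simp; ring
  rw [EuclideanSpace.norm_eq]
  refine (Real.sqrt_le_sqrt (y := (n * n * B * ‖v‖) ^ 2) ?_).trans ?_
  · calc _ ≤ ∑ _i : Fin n, (n * B * ‖v‖) ^ 2 := by
          refine Finset.sum_le_sum fun i _ => ?_
          rw [Real.norm_eq_abs]
          exact pow_le_pow_left₀ (abs_nonneg _) (h1 i) 2
      _ = n * (n * B * ‖v‖) ^ 2 := by simp
      _ ≤ n ^ 2 * (n * B * ‖v‖) ^ 2 := by
          refine mul_le_mul_of_nonneg_right ?_ (sq_nonneg _)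
          rcases Nat.eq_zero_or_pos n with h0 | h0
          · simp [h0]
          · have : (1 : ℝ) ≤ n := by exact_mod_cast h0
            nlinarith
      _ = _ := by ring
  · rw [Real.sqrt_sq (by positivity)]

lemma comp_le_vnorm (ξ : Fin n → ℝ) (i : Fin n) : |ξ i| ≤ vnorm ξ := by
  refine Real.abs_le_sqrt ?_
  exact Finset.single_le_sum (f := fun b => ξ b ^ 2) (fun i _ => sq_nonneg _) (Finset.mem_univ i)

lemma continuous_hess {w : (Fin n → ℝ) → ℝ} (hw : ContDiff ℝ 2 w) : Continuous (hess w) := by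
  refine continuous_matrix fun i j => ?_
  exact continuous_pd (contDiff_pd (N := 1) hw (by norm_num) j) i

lemma continuous_grad {w : (Fin n → ℝ) → ℝ} (hw : ContDiff ℝ 1 w) : Continuous (grad w) :=
  continuous_pi fun i => continuous_pd hw i

lemma continuous_vnorm : Continuous (vnorm : (Fin n → ℝ) → ℝ) := by
  unfold vnorm
  exact Real.continuous_sqrt.comp (continuous_finsetSum _ fun i _ => (continuous_apply i).pow 2)

/-- hessian of `U = exp w`. -/
lemma hess_exp {U : (Fin n → ℝ) → ℝ} (hU : ContDiff ℝ 2 U) (h0 : ∀ x, 0 < U x) :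
    (ContDiff ℝ 2 fun x => Real.log (U x)) ∧
    (∀ b x, pd b U x = U x * pd b (fun x => Real.log (U x)) x) ∧
    (∀ a b x, pd a (pd b U) x = U x * (pd a (pd b fun x => Real.log (U x)) x +
      pd a (fun x => Real.log (U x)) x * pd b (fun x => Real.log (U x)) x)) := by
  have hw : ContDiff ℝ 2 fun x => Real.log (U x) := hU.log fun x => (h0 x).ne'
  have hd : Differentiable ℝ U := hU.differentiable (by norm_num)
  have h1 : ∀ b x, pd b U x = U x * pd b (fun x => Real.log (U x)) x := by
    intro b x
    simp only [pd]
    rw [fderiv.log (hd x) (h0 x).ne']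
    simp [mul_inv_cancel_left₀ (h0 x).ne']
  refine ⟨hw, h1, fun a b x => ?_⟩
  have e : pd b U = fun x => U x * pd b (fun x => Real.log (U x)) x := funext fun x => h1 b x
  rw [e, pd_mul (hd x) ((contDiff_pd (N := 1) hw (by norm_num) b).differentiable (by norm_num) x),
    h1 a x]
  ring

lemma rpow_sum_le {a b m p : ℝ} (ha : 0 ≤ a) (hb : 0 ≤ b) (hm : 0 ≤ m) (hp : 0 ≤ p) :
    (a + b * m) ^ p ≤ (2 * (a + b)) ^ p * (1 + m ^ p) := by
  have h1 : a + b * m ≤ 2 * (a + b) * max 1 m := by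
    have h1 := le_max_left 1 m
    have h2 := le_max_right 1 m
    have : 0 ≤ (a + b) * max 1 m := by positivity
    nlinarith [mul_le_mul_of_nonneg_left h1 ha, mul_le_mul_of_nonneg_left h2 hb]
  have h2 : (max 1 m) ^ p ≤ 1 + m ^ p := by
    rcases le_total 1 m with h | h
    · rw [max_eq_right h]; linarith
    · rw [max_eq_left h, Real.one_rpow]
      have := Real.rpow_nonneg hm p
      linarith
  calc (a + b * m) ^ p ≤ (2 * (a + b) * max 1 m) ^ p :=
        Real.rpow_le_rpow (by positivity) h1 hp
    _ = (2 * (a + b)) ^ p * (max 1 m) ^ p := Real.mul_rpow (by positivity) (by positivity)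
    _ ≤ _ := by gcongr

set_option maxHeartbeats 1000000 in
lemma bounds (x₀ : Fin n → ℝ) (ρ p A : ℝ) (hρ : 0 < ρ) (hp : (n : ℝ) < p - 1) :
    ∃ K0 : ℝ, 1 ≤ K0 ∧ ∀ U : (Fin n → ℝ) → ℝ, ContDiff ℝ 2 U → (∀ x, 0 < U x) →
      ∫ x in ball x₀ ρ, (|Real.log (U x)| ^ p + vnorm (grad (fun x => Real.log (U x)) x) ^ p +
        matNorm (hess (fun x => Real.log (U x)) x) ^ p) ≤ A →
      (∀ x ∈ ball x₀ ρ, K0⁻¹ ≤ U x ∧ U x ≤ K0 ∧ (∀ b, |pd b U x| ≤ K0) ∧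
        ∀ a b, |pd a (pd b U) x| ≤ K0 + K0 * matNorm (hess (fun x => Real.log (U x)) x)) ∧
      ∫ x in ball x₀ ρ, matNorm (hess (fun x => Real.log (U x)) x) ^ p ≤ A := by
  obtain ⟨C, hC⟩ := morrey x₀ ρ p A hρ hp
  have hp0 : 0 ≤ p := by
    have : (0 : ℝ) ≤ n := Nat.cast_nonneg n
    linarith
  have hE : 1 ≤ Real.exp |C| := Real.one_le_exp (abs_nonneg C)
  have hC0 := abs_nonneg C
  refine ⟨Real.exp |C| * (1 + |C|) ^ 2, ?_, ?_⟩
  · nlinarith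
  intro U hU h0 hint
  obtain ⟨hw, e1, e2⟩ := hess_exp hU h0
  set w := fun x => Real.log (U x) with hwdef
  have hw1 : ContDiff ℝ 1 w := hw.of_le (by norm_num)
  have c1 : Continuous fun x => |w x| ^ p := hw.continuous.abs.rpow_const fun x => Or.inr hp0
  have c2 : Continuous fun x => vnorm (grad w x) ^ p :=
    (continuous_vnorm.comp (continuous_grad hw1)).rpow_const fun x => Or.inr hp0
  have cm : Continuous fun x => matNorm (hess w x) := continuous_matNorm.comp (continuous_hess hw)
  have c3 : Continuous fun x => matNorm (hess w x) ^ p := cm.rpow_const fun x => Or.inr hp0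
  have hv0 : ∀ ξ : Fin n → ℝ, 0 ≤ vnorm ξ := fun ξ => Real.sqrt_nonneg _
  have p1 : ∀ x, 0 ≤ |w x| ^ p := fun x => Real.rpow_nonneg (abs_nonneg _) _
  have p2 : ∀ x, 0 ≤ vnorm (grad w x) ^ p := fun x => Real.rpow_nonneg (hv0 _) _
  have p3 : ∀ x, 0 ≤ matNorm (hess w x) ^ p := fun x => Real.rpow_nonneg (matNorm_nonneg _) _
  have it : IntegrableOn (fun x => |w x| ^ p + vnorm (grad w x) ^ p + matNorm (hess w x) ^ p)
    (ball x₀ ρ) := integrableOn_ball ((c1.add c2).add c3).continuousOn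
  have mono : ∀ F : (Fin n → ℝ) → ℝ, Continuous F →
      (∀ x, F x ≤ |w x| ^ p + vnorm (grad w x) ^ p + matNorm (hess w x) ^ p) →
      ∫ x in ball x₀ ρ, F x ≤ A := fun F hF h =>
    (setIntegral_mono (integrableOn_ball hF.continuousOn) it h).trans hint
  have i1 := mono _ c1 fun x => by have := p1 x; have := p2 x; have := p3 x; linarith
  have i2 := mono _ c2 fun x => by have := p1 x; have := p2 x; have := p3 x; linarith
  have i3 := mono _ c3 fun x => by have := p1 x; have := p2 x; have := p3 x; linarith
  refine ⟨fun x hx => ?_, i3⟩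
  have b1 : |w x| ≤ C := hC w (fun x => vnorm (grad w x)) hw1
    (continuous_vnorm.comp (continuous_grad hw1)) (fun i x => comp_le_vnorm (grad w x) i)
    (fun x => hv0 _) i2 i1 x hx
  have b2 : ∀ b, |pd b w x| ≤ C := fun b =>
    hC (pd b w) (fun x => matNorm (hess w x)) (contDiff_pd (N := 1) hw (by norm_num) b) cm
    (fun i x => entry_le_matNorm (hess w x) i b) (fun x => matNorm_nonneg _) i3
    (mono _ ((continuous_pd hw1 b).abs.rpow_const fun x => Or.inr hp0) fun x => by
      have h1 := Real.rpow_le_rpow (abs_nonneg _) (comp_le_vnorm (grad w x) b) hp0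
      simp only [grad] at h1 ⊢
      have := p1 x; have := p3 x
      linarith) x hx
  have hCC : C ≤ |C| := le_abs_self C
  have hUx : U x = Real.exp (w x) := (Real.exp_log (h0 x)).symm
  have u1 : U x ≤ Real.exp |C| := by
    rw [hUx]; exact Real.exp_le_exp.2 (((le_abs_self _).trans b1).trans hCC)
  have u2 : (Real.exp |C|)⁻¹ ≤ U x := by
    rw [hUx, ← Real.exp_neg]
    apply Real.exp_le_exp.2
    have := (abs_le.1 (b1.trans hCC)).1
    exact this
  have hsq : 1 ≤ (1 + |C|) ^ 2 := one_le_pow₀ (by linarith)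
  have hEK : Real.exp |C| ≤ Real.exp |C| * (1 + |C|) ^ 2 := le_mul_of_one_le_right (by positivity) hsq
  refine ⟨(inv_anti₀ (by positivity) hEK).trans u2, u1.trans hEK, fun b => ?_, fun a b => ?_⟩
  · rw [e1, abs_mul, abs_of_pos (h0 x)]
    have := (b2 b).trans hCC
    calc _ ≤ Real.exp |C| * (1 + |C|) ^ 2 := by
          gcongr
          nlinarith
      _ = _ := rfl
  · rw [e2, abs_mul, abs_of_pos (h0 x)]
    have h1 := (b2 a).trans hCC
    have h2 := (b2 b).trans hCC
    have h3 : |pd a w x * pd b w x| ≤ |C| * |C| := by rw [abs_mul]; gcongr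
    have h4 : |pd a (pd b w) x| ≤ matNorm (hess w x) := entry_le_matNorm (hess w x) a b
    have hm := matNorm_nonneg (hess w x)
    calc _ ≤ Real.exp |C| * (matNorm (hess w x) + |C| * |C|) := by
          gcongr
          exact (abs_add_le _ _).trans (by linarith)
      _ ≤ Real.exp |C| * ((1 + |C|) ^ 2 + (1 + |C|) ^ 2 * matNorm (hess w x)) := by
          refine mul_le_mul_of_nonneg_left ?_ (Real.exp_pos _).le
          have : matNorm (hess w x) ≤ (1 + |C|) ^ 2 * matNorm (hess w x) :=
            le_mul_of_one_le_left hm hsq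
          nlinarith
      _ = _ := by ring

end BDsec
open MeasureTheory Metric Set Matrix

noncomputable section COsec
variable {n : ℕ}

lemma tau_facts (hn : 3 ≤ n) {k : ℕ} (hk2 : 2 ≤ k) (hkn : k ≤ n) {U : (Fin n → ℝ) → ℝ}
    (hU : ContDiff ℝ 2 U) {x : Fin n → ℝ} {K0 : ℝ} (hK0 : 1 ≤ K0) (h1 : K0⁻¹ ≤ U x)
    (h2 : ∀ b, |pd b U x| ≤ K0) (hG : GammaPlus k (Wmat U x)) :
    HCone k (Wmat U x) ∧ 1 ≤ -lapl U x + (n * (n * K0 ^ 3) + 1) ∧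
    sg 1 (Wmat U x) ≤ -lapl U x + (n * (n * K0 ^ 3) + 1) ∧
    (∀ a b, |Wmat U x a b| ≤ -lapl U x + (n * (n * K0 ^ 3) + 1)) ∧
    ∀ a b, |pd a (pd b U) x| ≤ (1 + n * K0 ^ 3) * (-lapl U x + (n * (n * K0 ^ 3) + 1)) := by
  have hK : 0 < K0 := by linarith
  have hUx : 0 < U x := lt_of_lt_of_le (inv_pos.2 hK) h1
  have hn0 : (0 : ℝ) < n := by exact_mod_cast (by omega : 0 < n)
  have hsym : (Wmat U x).IsSymm := Wmat_symm hU.contDiffAt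
  have hC : HCone k (Wmat U x) := hcone_of_gamma hkn hsym hG
  have p1 : 0 < sg 1 (Wmat U x) := by
    rw [← esymmMat_eq_sg (by omega)]; exact hG 1 le_rfl (by omega)
  have p2 : 0 < sg 2 (Wmat U x) := by
    rw [← esymmMat_eq_sg (by omega)]; exact hG 2 (by omega) hk2
  have hq : normSq (grad U x) ≤ n * K0 ^ 2 := by
    unfold normSq grad
    calc ∑ i, pd i U x ^ 2 ≤ ∑ _i : Fin n, K0 ^ 2 :=
          Finset.sum_le_sum fun i _ => by
            rw [← sq_abs]; exact pow_le_pow_left₀ (abs_nonneg _) (h2 i) 2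
      _ = n * K0 ^ 2 := by simp
  have hs0 : 0 ≤ sfun U x := by
    have := normSq_nonneg' (grad U x)
    unfold sfun; positivity
  have hs1 : sfun U x ≤ n * K0 ^ 3 := by
    unfold sfun
    rw [div_le_iff₀ (by positivity)]
    have h3 : 1 ≤ K0 * U x := by
      have := mul_le_mul_of_nonneg_left h1 hK.le
      rwa [mul_inv_cancel₀ hK.ne'] at this
    have h4 : n * K0 ^ 2 * 1 ≤ n * K0 ^ 2 * (K0 * U x) := by gcongr
    nlinarith [mul_pos hn0 (pow_pos hK 2)]
  have htr : sg 1 (Wmat U x) = -lapl U x + n * sfun U x := by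
    rw [sg_one_eq_trace (by omega)]
    simp [Matrix.trace, Wmat, hess, lapl, Finset.sum_add_distrib, Finset.sum_sub_distrib]
    try ring
  have hns : n * sfun U x ≤ n * (n * K0 ^ 3) := by gcongr
  have hτ1 : 1 ≤ -lapl U x + (n * (n * K0 ^ 3) + 1) := by linarith
  have hτ2 : sg 1 (Wmat U x) ≤ -lapl U x + (n * (n * K0 ^ 3) + 1) := by linarith
  have hW : ∀ a b, |Wmat U x a b| ≤ -lapl U x + (n * (n * K0 ^ 3) + 1) := fun a b =>
    (gamma_entry' (by omega) _ hsym p1 p2 a b).trans hτ2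
  refine ⟨hC, hτ1, hτ2, hW, fun a b => ?_⟩
  have e : pd a (pd b U) x = - Wmat U x a b + sfun U x * (1 : Matrix (Fin n) (Fin n) ℝ) a b := by
    simp [Wmat, hess]
  have hone : |sfun U x * (1 : Matrix (Fin n) (Fin n) ℝ) a b| ≤ n * K0 ^ 3 := by
    rw [abs_mul, abs_of_nonneg hs0, Matrix.one_apply]
    split_ifs
    · simpa using hs1
    · simp; positivity
  rw [e]
  refine (abs_add_le _ _).trans ?_
  rw [abs_neg]
  have h5 := hW a b
  have h6 : 0 < n * K0 ^ 3 := by positivity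
  nlinarith [mul_le_mul_of_nonneg_left hτ1 h6.le]

lemma limit_ineq {a b c χ X Y : ℝ} (hχ : 0 ≤ χ)
    (h : ∀ ε : ℝ, 0 < ε → ε ≤ 1 / 2 → (1 - ε) ^ a * X ≤ (c * ((1 + ε) ^ b * Y)) ^ χ) :
    X ≤ (c * Y) ^ χ := by
  have c1 : ContinuousAt (fun ε : ℝ => (1 - ε) ^ a * X) 0 := by
    refine ContinuousAt.mul (ContinuousAt.rpow_const (by fun_prop) (Or.inl (by norm_num)))
      continuousAt_const
  have c2 : ContinuousAt (fun ε : ℝ => (c * ((1 + ε) ^ b * Y)) ^ χ) 0 := by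
    refine ContinuousAt.rpow_const ?_ (Or.inr hχ)
    refine continuousAt_const.mul (ContinuousAt.mul (ContinuousAt.rpow_const (by fun_prop)
      (Or.inl (by norm_num))) continuousAt_const)
  have t1 := c1.tendsto.mono_left (nhdsWithin_le_nhds (s := Ioi 0))
  have t2 := c2.tendsto.mono_left (nhdsWithin_le_nhds (s := Ioi 0))
  have := le_of_tendsto_of_tendsto t1 t2 (by
    filter_upwards [Ioc_mem_nhdsGT (show (0 : ℝ) < 1 / 2 by norm_num)] with ε hε
    exact h ε hε.1 hε.2)
  simpa using this

lemma hess_unif {U : (Fin n → ℝ) → ℝ} (hU : ContDiff ℝ 2 U) (x₀ : Fin n → ℝ) (ρ δ : ℝ)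
    (hδ : 0 < δ) : ∃ h0 : ℝ, 0 < h0 ∧ ∀ x ∈ closedBall x₀ ρ, ∀ y ∈ closedBall x₀ ρ, dist y x ≤ h0 →
      ∀ a b, |pd a (pd b U) y - pd a (pd b U) x| ≤ δ := by
  have hc : Continuous fun x => (fun a b => pd a (pd b U) x : Fin n → Fin n → ℝ) :=
    continuous_pi fun a => continuous_pi fun b =>
      continuous_pd (contDiff_pd (N := 1) hU (by norm_num) b) a
  have := (isCompact_closedBall x₀ ρ).uniformContinuousOn_of_continuous hc.continuousOn
  rw [Metric.uniformContinuousOn_iff_le] at this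
  obtain ⟨h0, hp, hh⟩ := this δ hδ
  refine ⟨h0, hp, fun x hx y hy hd a b => ?_⟩
  have h1 := hh y hy x hx hd
  have h2 := (dist_le_pi_dist _ _ a).trans h1
  have h3 := (dist_le_pi_dist _ _ b).trans h2
  rwa [Real.dist_eq] at h3

end COsec
open MeasureTheory Metric Set Matrix

noncomputable section CPsec
variable {n : ℕ}

set_option maxHeartbeats 1000000 in
lemma pt_approx (hn : 3 ≤ n) (k : ℕ) (hk2 : 2 ≤ k) (hkn : k ≤ n)
    (Ω : Set (Fin n → ℝ)) (hΩ : IsOpen Ω)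
    (f : ((Fin n → ℝ) × ℝ × (Fin n → ℝ)) → ℝ)
    (hfpos : ∀ y ∈ Ω ×ˢ ((Ioi (0 : ℝ)) ×ˢ (univ : Set (Fin n → ℝ))), 0 < f y)
    (hf : C11On f (Ω ×ˢ ((Ioi (0 : ℝ)) ×ˢ (univ : Set (Fin n → ℝ)))))
    (x₀ : Fin n → ℝ) (R : ℝ) (hR : 0 < R) (hball : closedBall x₀ (7 * R / 4) ⊆ Ω)
    (K0 : ℝ) (hK0 : 1 ≤ K0) :
    ∃ K : ℝ, 1 ≤ K ∧ ∀ U : (Fin n → ℝ) → ℝ, ContDiff ℝ 2 U → (∀ x, 0 < U x) →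
      (∀ x ∈ ball x₀ (7 * R / 4), esymmMat k (Wmat U x) = f (x, U x, grad U x) ^ k ∧
        GammaPlus k (Wmat U x) ∧ K0⁻¹ ≤ U x ∧ U x ≤ K0 ∧ ∀ b, |pd b U x| ≤ K0) →
      ∀ ε : ℝ, 0 < ε → ε ≤ 1 / 2 → ∃ z : (Fin n → ℝ) → ℝ, ContDiff ℝ 2 z ∧
        ∀ x ∈ ball x₀ (3 * R / 2), |z x - (-lapl U x + (n * (n * K0 ^ 3) + 1))| ≤ ε ∧
          Pt k K U z x := by
  have hK : 0 < K0 := by linarith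
  have hn0 : (0 : ℝ) < n := by exact_mod_cast (by omega : 0 < n)
  set Q : Set ((Fin n → ℝ) × ℝ × (Fin n → ℝ)) :=
    closedBall x₀ (7 * R / 4) ×ˢ (Icc K0⁻¹ K0 ×ˢ closedBall 0 K0) with hQ
  obtain ⟨c, Λ, hc, hΛ, hfQ⟩ := f_facts (Ω ×ˢ ((Ioi (0 : ℝ)) ×ˢ (univ : Set (Fin n → ℝ)))) Q
    (hΩ.prod (isOpen_Ioi.prod isOpen_univ)) f hfpos hf
    ((isCompact_closedBall _ _).prod (isCompact_Icc.prod (isCompact_closedBall _ _)))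
    ((convex_closedBall _ _).prod ((convex_Icc _ _).prod (convex_closedBall _ _)))
    (by
      rintro ⟨x, s, ξ⟩ ⟨h1, h2, h3⟩
      exact ⟨hball h1, lt_of_lt_of_le (inv_pos.2 hK) h2.1, mem_univ _⟩)
  set S : ℝ := n * K0 ^ 3 with hS
  have hS0 : 0 < S := by positivity
  obtain ⟨K, hK1, hmain⟩ := pt_main (n := n) k hk2 hkn c Λ K0 (n * S + 1) (2 + S) hc hΛ.le hK0
    (by positivity) (by positivity)
  refine ⟨K, hK1, fun U hU hpos hx ε hε hε2 => ?_⟩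
  have hδ : 0 < ε / (2 * n) := by positivity
  have hδ1 : ε / (2 * n) ≤ 1 := by
    rw [div_le_one (by positivity)]
    have : (3 : ℝ) ≤ n := by exact_mod_cast hn
    linarith
  obtain ⟨h0, hh0, hun⟩ := hess_unif hU x₀ (7 * R / 4) _ hδ
  set h : ℝ := min h0 (R / 8) with hh
  have hhpos : 0 < h := lt_min hh0 (by positivity)
  have hhR : h ≤ R / 8 := min_le_right _ _
  have hhh : h ≤ h0 := min_le_left _ _
  refine ⟨fun y => -Lh h U y + (n * S + 1), ((contDiff_Lh hU h).neg.add contDiff_const),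
    fun x hxb => ?_⟩
  have near : ∀ y, dist y x ≤ h → y ∈ ball x₀ (7 * R / 4) := fun y hy => by
    rw [mem_ball] at hxb ⊢
    have := dist_triangle y x x₀
    linarith
  have hxx : x ∈ ball x₀ (7 * R / 4) := near x (by simpa using hhpos.le)
  have hosc : ∀ y, dist y x ≤ h → ∀ a b,
      |pd a (pd b U) y - pd a (pd b U) x| ≤ ε / (2 * n) := fun y hy =>
    hun x (ball_subset_closedBall hxx) y (ball_subset_closedBall (near y hy)) (hy.trans hhh)
  have hL := Lh_lapl hU x hhpos (δ := ε / (2 * n)) (fun y hy l => hosc y hy l l)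
  have hL' : |Lh h U x - lapl U x| ≤ ε := by
    have : 2 * n * (ε / (2 * n)) = ε := by field_simp
    rwa [this] at hL
  refine ⟨?_, ?_⟩
  · have e : -Lh h U x + (n * S + 1) - (-lapl U x + (n * S + 1)) = -(Lh h U x - lapl U x) := by ring
    rw [e, abs_neg]; exact hL'
  have hv : ∀ j, dist (x + vv h j) x ≤ h := fun j => by
    rw [dist_eq_norm, add_sub_cancel_left, norm_vv hhpos.le]
  have hvb := fun j => near _ (hv j)
  obtain ⟨q1, q2, q3, q4, q5⟩ := hx x hxx
  obtain ⟨t1, t2, t3, t4, t5⟩ := tau_facts hn hk2 hkn hU hK0 q3 q5 q2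
  rw [← hS] at t2 t3 t4 t5
  set τ := -lapl U x + (n * S + 1) with hτ
  have hLτ : |(-Lh h U x + (n * S + 1)) - τ| ≤ ε := by
    have e : -Lh h U x + (n * S + 1) - τ = -(Lh h U x - lapl U x) := by rw [hτ]; ring
    rw [e, abs_neg]; exact hL'
  have hLa := abs_le.1 hLτ
  have memQ : ∀ y ∈ ball x₀ (7 * R / 4), (y, U y, grad U y) ∈ Q := fun y hy => by
    obtain ⟨r1, r2, r3, r4, r5⟩ := hx y hy
    refine ⟨ball_subset_closedBall hy, ⟨r3, r4⟩, ?_⟩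
    rw [mem_closedBall, dist_zero_right, pi_norm_le_iff_of_nonneg hK.le]
    intro b
    rw [Real.norm_eq_abs]; exact r5 b
  obtain ⟨f1, f2, f3, f4⟩ := hfQ _ (memQ x hxx)
  refine hmain U f x h τ hU hpos hhpos (by linarith) t1
    (fun j => ?_) ?_ (fun j => ?_) f1 f2 f3 (fun j => ⟨?_, f4 _ (memQ _ (hvb j))⟩) q3 q4
    (fun j => ⟨(hx _ (hvb j)).2.2.1, (hx _ (hvb j)).2.2.2.1⟩) q5 (fun j => ?_) (fun j b => ?_) t4 t3
    (by linarith) (by linarith)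
  · obtain ⟨r1, r2, r3, r4, r5⟩ := hx _ (hvb j)
    exact hcone_of_gamma hkn (Wmat_symm hU.contDiffAt) r2
  · rw [← esymmMat_eq_sg hkn]; exact q1
  · rw [← esymmMat_eq_sg hkn]; exact (hx _ (hvb j)).1
  · exact hc.trans_le (hfQ _ (memQ _ (hvb j))).1
  · exact diff_bound (hU.differentiable (by norm_num)) x hhpos.le j
      fun y hy => (hx y (near y hy)).2.2.2.2 _
  · refine diff_bound ((contDiff_pd (N := 1) hU (by norm_num) b).differentiable (by norm_num)) x
      hhpos.le j fun y hy => ?_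
    have h1 := hosc y hy j.1 b
    have h2 := t5 j.1 b
    have h3 : |pd j.1 (pd b U) y| ≤ |pd j.1 (pd b U) x| + |pd j.1 (pd b U) y - pd j.1 (pd b U) x| := by
      have := abs_add_le (pd j.1 (pd b U) x) (pd j.1 (pd b U) y - pd j.1 (pd b U) x)
      rwa [add_sub_cancel] at this
    nlinarith

end CPsec
open MeasureTheory Metric Set Matrix

noncomputable section CQsec
variable {n : ℕ}

lemma tau_step {x₀ : Fin n → ℝ} {τ : (Fin n → ℝ) → ℝ} (hτ : Continuous τ) {ρ r r' a b c χ : ℝ}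
    (hr : r ≤ ρ) (hrr : r' < r) (h1 : ∀ x ∈ ball x₀ ρ, 1 ≤ τ x) (ha : 0 ≤ a) (hb : 0 ≤ b)
    (hc : 0 ≤ c) (hχ : 0 ≤ χ)
    (hz : ∀ ε : ℝ, 0 < ε → ε ≤ 1 / 2 → ∃ z : (Fin n → ℝ) → ℝ, Continuous z ∧
      (∀ x ∈ ball x₀ ρ, |z x - τ x| ≤ ε) ∧
      ∫ x in ball x₀ r', z x ^ a ≤ (c * ∫ x in ball x₀ r, z x ^ b) ^ χ) :
    ∫ x in ball x₀ r', τ x ^ a ≤ (c * ∫ x in ball x₀ r, τ x ^ b) ^ χ := by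
  refine limit_ineq (a := a) (b := b) hχ fun ε hε hε2 => ?_
  obtain ⟨z, zc, zτ, hzi⟩ := hz ε hε hε2
  have co : ∀ {g : (Fin n → ℝ) → ℝ} {q s : ℝ}, Continuous g → 0 ≤ q →
      IntegrableOn (fun x => g x ^ q) (ball x₀ s) := fun hg hq =>
    integrableOn_ball (hg.rpow_const fun x => Or.inr hq).continuousOn
  have l1 : (1 - ε) ^ a * ∫ x in ball x₀ r', τ x ^ a ≤ ∫ x in ball x₀ r', z x ^ a := by
    rw [← integral_const_mul]
    refine setIntegral_mono_on ((co hτ ha).const_mul _) (co zc ha) measurableSet_ball fun x hx => ?_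
    have hx' : x ∈ ball x₀ ρ := ball_subset_ball (by linarith) hx
    have q1 := h1 x hx'
    have q2 := abs_le.1 (zτ x hx')
    rw [← Real.mul_rpow (by linarith) (by linarith)]
    exact Real.rpow_le_rpow (mul_nonneg (by linarith) (by linarith)) (by nlinarith) ha
  have l2 : ∫ x in ball x₀ r, z x ^ b ≤ (1 + ε) ^ b * ∫ x in ball x₀ r, τ x ^ b := by
    rw [← integral_const_mul]
    refine setIntegral_mono_on (co zc hb) ((co hτ hb).const_mul _) measurableSet_ball fun x hx => ?_
    have hx' : x ∈ ball x₀ ρ := ball_subset_ball (by linarith) hx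
    have q1 := h1 x hx'
    have q2 := abs_le.1 (zτ x hx')
    rw [← Real.mul_rpow (by linarith) (by linarith)]
    exact Real.rpow_le_rpow (by linarith) (by nlinarith) hb
  have l3 : 0 ≤ ∫ x in ball x₀ r, z x ^ b := by
    refine setIntegral_nonneg measurableSet_ball fun x hx => Real.rpow_nonneg ?_ _
    have hx' : x ∈ ball x₀ ρ := ball_subset_ball (by linarith) hx
    have q1 := h1 x hx'
    have q2 := abs_le.1 (zτ x hx')
    linarith
  exact (l1.trans hzi).trans (Real.rpow_le_rpow (by positivity) (by gcongr) hχ)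

set_option maxHeartbeats 1000000 in
lemma core_est (hn : 3 ≤ n) (k : ℕ) (hk2 : 2 ≤ k) (hkn : k ≤ n)
    (Ω : Set (Fin n → ℝ)) (hΩ : IsOpen Ω)
    (p : ℝ) (hp : ((k + 1) * n : ℝ) / 2 < p)
    (f : ((Fin n → ℝ) × ℝ × (Fin n → ℝ)) → ℝ)
    (hfpos : ∀ y ∈ Ω ×ˢ ((Ioi (0 : ℝ)) ×ˢ (univ : Set (Fin n → ℝ))), 0 < f y)
    (hf : C11On f (Ω ×ˢ ((Ioi (0 : ℝ)) ×ˢ (univ : Set (Fin n → ℝ)))))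
    (x₀ : Fin n → ℝ) (R : ℝ) (hR : 0 < R) (hball : closedBall x₀ (7 * R / 4) ⊆ Ω) (A : ℝ) :
    ∃ C : ℝ, ∀ U : (Fin n → ℝ) → ℝ, ContDiff ℝ 2 U → (∀ x, 0 < U x) →
      HasCompactSupport (fun x => 1 - U x) →
      (∀ x ∈ ball x₀ (7 * R / 4), esymmMat k (Wmat U x) = f (x, U x, grad U x) ^ k ∧
        GammaPlus k (Wmat U x)) →
      ∫ x in ball x₀ (7 * R / 4), (|Real.log (U x)| ^ p +
        vnorm (grad (fun x => Real.log (U x)) x) ^ p +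
        matNorm (hess (fun x => Real.log (U x)) x) ^ p) ≤ A →
      ∀ x ∈ ball x₀ R, matNorm (hess U x) ≤ C := by
  have hn3 : (3 : ℝ) ≤ n := by exact_mod_cast hn
  have hk2' : (2 : ℝ) ≤ k := by exact_mod_cast hk2
  have hpn : (n : ℝ) < p - 1 := by nlinarith
  have hp0 : 0 ≤ p := by linarith
  obtain ⟨K0, hK0, hb⟩ := bounds x₀ (7 * R / 4) p A (by positivity) hpn
  obtain ⟨K, hK1, hpt⟩ := pt_approx hn k hk2 hkn Ω hΩ f hfpos hf x₀ R hR hball K0 hK0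
  obtain ⟨C0, hC0, hst⟩ := step_zhat hn k hk2 hkn K hK1 R hR
  set S : ℝ := n * K0 ^ 3 with hS
  have hS0 : 0 < S := by positivity
  set a0 : ℝ := n * S + 1 + n * K0 with ha0
  set b0 : ℝ := n * K0 with hb0
  have ha0p : 0 ≤ a0 := by positivity
  have hb0p : 0 ≤ b0 := by positivity
  obtain ⟨C', hC'⟩ := iterate_moser hn k (by omega) p hp x₀ R hR C0
    ((2 * (a0 + b0)) ^ p * (volume.real (ball x₀ (7 * R / 4)) + A)) hC0
  refine ⟨n * n * ((1 + S) * |C'|), fun U hU hpos hcs heq hint x hx => ?_⟩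
  obtain ⟨hb1, hb2⟩ := hb U hU hpos hint
  have htf : ∀ x ∈ ball x₀ (7 * R / 4), _ := fun x hx =>
    tau_facts hn hk2 hkn hU hK0 (hb1 x hx).1 (hb1 x hx).2.2.1 (heq x hx).2
  rw [← hS] at htf
  have hsub : ball x₀ (3 * R / 2) ⊆ ball x₀ (7 * R / 4) := ball_subset_ball (by linarith)
  have hτc : Continuous fun x => -lapl U x + (n * S + 1) := by
    unfold lapl
    refine (continuous_finsetSum _ fun l _ => ?_).neg.add continuous_const
    exact continuous_pd (contDiff_pd (N := 1) hU (by norm_num) l) l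
  have hτ1 : ∀ x ∈ ball x₀ (3 * R / 2), 1 ≤ -lapl U x + (n * S + 1) := fun x hx =>
    (htf x (hsub hx)).2.1
  have hτC := hC' (fun x => -lapl U x + (n * S + 1)) hτc hτ1 (by
    intro m r r' hm hr' hrr hr
    have hn2 : (0 : ℝ) < n - 2 := by linarith
    refine tau_step (ρ := 3 * R / 2) hτc hr hrr hτ1 (by positivity) (by positivity)
      (by positivity) (by positivity) fun ε hε hε2 => ?_
    obtain ⟨z, hz, hzz⟩ := hpt U hU hpos (fun x hx => ⟨(heq x hx).1, (heq x hx).2,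
      (hb1 x hx).1, (hb1 x hx).2.1, (hb1 x hx).2.2.1⟩) ε hε hε2
    exact ⟨z, hz.continuous, fun x hx => (hzz x hx).1,
      hst x₀ U z hU hpos hcs hz m r r' hm hr' hrr hr fun x hx =>
        (hzz x (ball_subset_ball hr hx)).2⟩) (by
    have hw := (hess_exp hU hpos).1
    have cm : Continuous fun x => matNorm (hess (fun x => Real.log (U x)) x) ^ p :=
      (continuous_matNorm.comp (continuous_hess hw)).rpow_const fun x => Or.inr hp0
    have cg : Continuous fun x => (2 * (a0 + b0)) ^ p *
        (1 + matNorm (hess (fun x => Real.log (U x)) x) ^ p) :=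
      continuous_const.mul (continuous_const.add cm)
    have ct : Continuous fun x => (-lapl U x + (n * S + 1)) ^ p :=
      hτc.rpow_const fun x => Or.inr hp0
    calc _ ≤ ∫ x in ball x₀ (3 * R / 2), (2 * (a0 + b0)) ^ p *
        (1 + matNorm (hess (fun x => Real.log (U x)) x) ^ p) := by
          refine setIntegral_mono_on (integrableOn_ball ct.continuousOn)
            (integrableOn_ball cg.continuousOn) measurableSet_ball fun x hx => ?_
          have h1 := hτ1 x hx
          have h2 := (hb1 x (hsub hx)).2.2.2
          refine le_trans (Real.rpow_le_rpow (by linarith) ?_ hp0)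
            (rpow_sum_le ha0p hb0p (matNorm_nonneg _) hp0)
          have h3 : -lapl U x ≤ ∑ _l : Fin n,
              (K0 + K0 * matNorm (hess (fun x => Real.log (U x)) x)) := by
            unfold lapl
            rw [← Finset.sum_neg_distrib]
            exact Finset.sum_le_sum fun l _ => (neg_le_abs _).trans (h2 l l)
          simp only [Finset.sum_const, Finset.card_univ, Fintype.card_fin, nsmul_eq_mul] at h3
          rw [ha0, hb0]
          linarith
      _ ≤ ∫ x in ball x₀ (7 * R / 4), (2 * (a0 + b0)) ^ p *
        (1 + matNorm (hess (fun x => Real.log (U x)) x) ^ p) := by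
          refine setIntegral_mono_set (integrableOn_ball cg.continuousOn)
            (Filter.Eventually.of_forall fun x => ?_) hsub.eventuallyLE
          have := Real.rpow_nonneg (matNorm_nonneg (hess (fun x => Real.log (U x)) x)) p
          simp only [Pi.zero_apply]
          positivity
      _ ≤ _ := by
          rw [integral_const_mul]
          refine mul_le_mul_of_nonneg_left ?_ (by positivity)
          rw [integral_add (integrableOn_ball continuous_const.continuousOn)
            (integrableOn_ball cm.continuousOn)]
          rw [setIntegral_const, smul_eq_mul, mul_one]
          linarith) x hx
  have hx' : x ∈ ball x₀ (7 * R / 4) := ball_subset_ball (by linarith) hx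
  refine matNorm_le _ _ (by positivity) fun i j => ?_
  refine ((htf x hx').2.2.2.2 i j).trans ?_
  have := hτC.trans (le_abs_self C')
  gcongr

end CQsec
open MeasureTheory Metric Set Matrix

noncomputable section CRsec
variable {n : ℕ}

lemma contDiffOn_pd {N : ℕ} {V : Set (Fin n → ℝ)} (hV : IsOpen V) {w : (Fin n → ℝ) → ℝ}
    (hw : ContDiffOn ℝ (N + 1 : ℕ) w V) (i : Fin n) : ContDiffOn ℝ N (pd i w) V :=
  (hw.fderiv_of_isOpen hV (by norm_cast)).clm_apply contDiffOn_const

lemma w2p_bound {V : Set (Fin n → ℝ)} (hV : IsOpen V) {w : (Fin n → ℝ) → ℝ}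
    (hw : ContDiffOn ℝ 2 w V) {x₀ : Fin n → ℝ} {r r' p M : ℝ} (hB : closedBall x₀ r ⊆ V)
    (hrr : r' ≤ r) (hp : 0 < p) (h : W2pNorm p w (ball x₀ r) ≤ M) :
    ∫ x in ball x₀ r', (|w x| ^ p + vnorm (grad w x) ^ p + matNorm (hess w x) ^ p) ≤ M ^ p := by
  have n1 : ∀ x, 0 ≤ |w x| ^ p + vnorm (grad w x) ^ p + matNorm (hess w x) ^ p := fun x => by
    have h1 := Real.rpow_nonneg (abs_nonneg (w x)) p
    have h2 := Real.rpow_nonneg (show 0 ≤ vnorm (grad w x) from Real.sqrt_nonneg _) p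
    have h3 := Real.rpow_nonneg (matNorm_nonneg (hess w x)) p
    linarith
  have d1 : ∀ i, ContDiffOn ℝ (1 : ℕ) (pd i w) V := fun i =>
    contDiffOn_pd (N := 1) hV (by exact_mod_cast hw) i
  have d2 : ∀ i j, ContinuousOn (pd i (pd j w)) V := fun i j =>
    (contDiffOn_pd (N := 0) hV (by simpa using d1 j) i).continuousOn
  have c1 : ContinuousOn (fun x => |w x| ^ p) V :=
    hw.continuousOn.abs.rpow_const fun x _ => Or.inr hp.le
  have c2 : ContinuousOn (fun x => vnorm (grad w x) ^ p) V :=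
    (continuous_vnorm.comp_continuousOn
      (continuousOn_pi.2 fun i => (d1 i).continuousOn : ContinuousOn (fun x => grad w x) V)).rpow_const
      fun x _ => Or.inr hp.le
  have c3 : ContinuousOn (fun x => matNorm (hess w x) ^ p) V :=
    (continuous_matNorm.comp_continuousOn
      (continuousOn_pi.2 fun i => continuousOn_pi.2 fun j => d2 i j :
        ContinuousOn (fun x => hess w x) V)).rpow_const fun x _ => Or.inr hp.le
  have hi := integrableOn_ball (((c1.add c2).add c3).mono hB)
  have m1 : ∫ x in ball x₀ r', (|w x| ^ p + vnorm (grad w x) ^ p + matNorm (hess w x) ^ p) ≤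
      ∫ x in ball x₀ r, (|w x| ^ p + vnorm (grad w x) ^ p + matNorm (hess w x) ^ p) :=
    setIntegral_mono_set hi (Filter.Eventually.of_forall n1) (ball_subset_ball hrr).eventuallyLE
  refine m1.trans ?_
  have n2 : 0 ≤ ∫ x in ball x₀ r, (|w x| ^ p + vnorm (grad w x) ^ p + matNorm (hess w x) ^ p) :=
    integral_nonneg n1
  unfold W2pNorm at h
  have := Real.rpow_le_rpow (Real.rpow_nonneg n2 _) h hp.le
  rwa [← Real.rpow_mul n2, one_div, inv_mul_cancel₀ hp.ne', Real.rpow_one] at this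

end CRsec

/-- Interior Hessian estimate for the negative `σ_k`-Yamabe equation
(a priori form of Theorem 1.2). -/
theorem interior_hessian_estimate_negative_sigmak_yamabe
    {n : ℕ} (hn : 3 ≤ n) (k : ℕ) (hk2 : 2 ≤ k) (hkn : k ≤ n)
    (Ω : Set (Fin n → ℝ)) (hΩ : IsOpen Ω)
    (p : ℝ) (hp : ((k + 1) * n : ℝ) / 2 < p)
    (f : ((Fin n → ℝ) × ℝ × (Fin n → ℝ)) → ℝ)
    (hfpos : ∀ y ∈ Ω ×ˢ ((Ioi (0 : ℝ)) ×ˢ (univ : Set (Fin n → ℝ))), 0 < f y)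
    (hf : C11On f (Ω ×ˢ ((Ioi (0 : ℝ)) ×ˢ (univ : Set (Fin n → ℝ)))))
    (x₀ : Fin n → ℝ) (R : ℝ) (hR : 0 < R)
    (hball : closure (ball x₀ (2 * R)) ⊆ Ω)
    (M : ℝ) (hM : 0 < M) :
    ∃ C : ℝ, ∀ u : (Fin n → ℝ) → ℝ,
      ContDiffOn ℝ 2 u Ω →
      (∀ x ∈ Ω, 0 < u x) →
      (∀ x ∈ Ω,
        esymmMat k (-(hess u x -
            (normSq (grad u x) / (2 * u x)) • (1 : Matrix (Fin n) (Fin n) ℝ)))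
          = f (x, u x, grad u x) ^ k ∧
        GammaPlus k (-(hess u x -
            (normSq (grad u x) / (2 * u x)) • (1 : Matrix (Fin n) (Fin n) ℝ)))) →
      W2pNorm p (fun x => Real.log (u x)) (ball x₀ (2 * R)) ≤ M →
      ∀ x ∈ ball x₀ R, matNorm (hess u x) ≤ C := by
  have hcl : closedBall x₀ (2 * R) ⊆ Ω := by
    rwa [closure_ball x₀ (by positivity)] at hball
  have hn3 : (3 : ℝ) ≤ n := by exact_mod_cast hn
  have hk2' : (2 : ℝ) ≤ k := by exact_mod_cast hk2
  have hp0 : 0 < p := by nlinarith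
  obtain ⟨C, hC⟩ := core_est hn k hk2 hkn Ω hΩ p hp f hfpos hf x₀ R hR
    ((closedBall_subset_closedBall (by linarith)).trans hcl) (M ^ p)
  refine ⟨C, fun u hu hpos heq hW x hx => ?_⟩
  obtain ⟨U, hU, hUpos, hUcs, hUu⟩ := extend_pos hΩ hu x₀ (r := 2 * R) (r' := 7 * R / 4)
    (by positivity) (by linarith) (ball_subset_closedBall.trans hcl)
    (fun y hy => hpos y (hcl (ball_subset_closedBall hy)))
  have hev : ∀ y ∈ ball x₀ (7 * R / 4), U =ᶠ[nhds y] u := fun y hy => by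
    filter_upwards [isOpen_ball.mem_nhds hy] with y' hy' using hUu y' hy'
  have hsub : ball x₀ (7 * R / 4) ⊆ Ω :=
    (ball_subset_closedBall.trans (closedBall_subset_closedBall (by linarith))).trans hcl
  have hx' : x ∈ ball x₀ (7 * R / 4) := ball_subset_ball (by linarith) hx
  rw [← hess_congr (hev x hx')]
  refine hC U hU hUpos hUcs (fun y hy => ?_) ?_ x hx
  · have h1 := heq y (hsub hy)
    unfold Wmat sfun
    rw [hess_congr (hev y hy), grad_congr (hev y hy), hUu y hy]
    exact h1
  · have hlog : ContDiffOn ℝ 2 (fun x => Real.log (u x)) Ω :=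
      hu.log fun y hy => (hpos y hy).ne'
    refine le_trans (le_of_eq ?_) (w2p_bound hΩ hlog (r' := 7 * R / 4) hcl (by linarith) hp0 hW)
    refine setIntegral_congr_fun measurableSet_ball fun y hy => ?_
    have he : (fun x => Real.log (U x)) =ᶠ[nhds y] fun x => Real.log (u x) :=
      (hev y hy).fun_comp Real.log
    simp only [hess_congr he, grad_congr he, hUu y hy]
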